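/- Let k be a positive integer with k ≡ 2 (mod 4). Then there is an exact sequence 0 → S_{k+2} × S_{k+6} → J_{k,2}(O_K) → J_{k,2} → M_k → 0, where the map J_{k,2}(O_K) → J_{k,2} is π_1 and J_{k,2} → M_k is D_0. Precisely: D_0 is surjective, the image of π_1 equals the kernel of D_0, and the kernel of π_1 is isomorphic to S_{k+2} × S_{k+6} via φ ↦ (ξ·h_{1,1}, χ_{6,0}(ψ)), where h_{1,1} is the theta component of φ at s = (1+i)/2, ψ := φ − h_{1,1}·(θ^H_{2,(1+i)/2} − θ^H_{2,(1+3i)/2} − θ^H_{2,(3+i)/2} + θ^H_{2,(3+3i)/2}), and χ_{6,0}(ψ) denotes the coefficient of z₁⁶ in the Taylor expansion of ψ around z₁ = z₂ = 0. -/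

import Mathlib

noncomputable section

open Complex

/-- `τ` lies in the upper half plane. -/
def UHP (τ : ℂ) : Prop := 0 < τ.im

/-- `eC w = exp(2 π i w)`. -/
def eC (w : ℂ) : ℂ := Complex.exp (2 * (Real.pi : ℂ) * Complex.I * w)

/-- Entries of a matrix in `SL(2, ℤ)`, as complex numbers. -/
def Ma (M : Matrix.SpecialLinearGroup (Fin 2) ℤ) : ℂ := ((M.1 0 0 : ℤ) : ℂ)
def Mb (M : Matrix.SpecialLinearGroup (Fin 2) ℤ) : ℂ := ((M.1 0 1 : ℤ) : ℂ)
def Mc (M : Matrix.SpecialLinearGroup (Fin 2) ℤ) : ℂ := ((M.1 1 0 : ℤ) : ℂ)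
def Md (M : Matrix.SpecialLinearGroup (Fin 2) ℤ) : ℂ := ((M.1 1 1 : ℤ) : ℂ)

/-- Hermitian Jacobi form of weight `k` and index `m` for the Hermitian Jacobi group over
`ℤ[i]`.  A form is a function `φ : ℂ → ℂ → ℂ → ℂ`, all conditions being imposed for `τ`
in the upper half plane.  Units `ε ∈ ℤ[i]ˣ = {1, -1, i, -i}`, and the elliptic variables
`λ = p + q i`, `μ = u + v i` range over `ℤ[i]`.  The Fourier expansion is indexed by
`n ∈ ℕ` and `r = (a + b i)/2 ∈ O_K^♯ = (i/2)ℤ[i]`, supported on `N(r) ≤ n m`,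
i.e. `a² + b² ≤ 4 n m`. -/
structure IsHJF (k m : ℕ) (φ : ℂ → ℂ → ℂ → ℂ) : Prop where
  holo : DifferentiableOn ℂ (fun p : ℂ × ℂ × ℂ => φ p.1 p.2.1 p.2.2) {p | UHP p.1}
  transf : ∀ ε : ℂ, ε ∈ ({1, -1, Complex.I, -Complex.I} : Set ℂ) →
    ∀ M : Matrix.SpecialLinearGroup (Fin 2) ℤ, ∀ τ z₁ z₂ : ℂ, UHP τ →
      φ ((Ma M * τ + Mb M) / (Mc M * τ + Md M))
        (ε * z₁ / (Mc M * τ + Md M))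
        ((starRingEnd ℂ) ε * z₂ / (Mc M * τ + Md M))
      = ε ^ k * (Mc M * τ + Md M) ^ k *
          eC ((m : ℂ) * Mc M * z₁ * z₂ / (Mc M * τ + Md M)) * φ τ z₁ z₂
  ellip : ∀ p q u v : ℤ, ∀ τ z₁ z₂ : ℂ, UHP τ →
      φ τ (z₁ + ((p : ℂ) + (q : ℂ) * Complex.I) * τ + ((u : ℂ) + (v : ℂ) * Complex.I))
          (z₂ + ((p : ℂ) - (q : ℂ) * Complex.I) * τ + ((u : ℂ) - (v : ℂ) * Complex.I))
      = eC (-(m : ℂ) * (((p : ℂ) ^ 2 + (q : ℂ) ^ 2) * τ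
          + ((p : ℂ) - (q : ℂ) * Complex.I) * z₁
          + ((p : ℂ) + (q : ℂ) * Complex.I) * z₂)) * φ τ z₁ z₂
  fourier : ∃ c : ℕ → ℤ → ℤ → ℂ,
      (∀ (n : ℕ) (a b : ℤ), 4 * (n : ℤ) * m < a ^ 2 + b ^ 2 → c n a b = 0) ∧
      ∀ τ z₁ z₂ : ℂ, UHP τ →
        HasSum (fun p : ℕ × ℤ × ℤ => c p.1 p.2.1 p.2.2 *
          eC ((p.1 : ℂ) * τ + (((p.2.1 : ℂ) + (p.2.2 : ℂ) * Complex.I) / 2) * z₁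
            + (((p.2.1 : ℂ) - (p.2.2 : ℂ) * Complex.I) / 2) * z₂)) (φ τ z₁ z₂)

/-- Classical Jacobi form of weight `k` and index `m` for `SL(2,ℤ) ⋉ ℤ²`. -/
structure IsJF (k m : ℕ) (φ : ℂ → ℂ → ℂ) : Prop where
  holo : DifferentiableOn ℂ (fun p : ℂ × ℂ => φ p.1 p.2) {p | UHP p.1}
  transf : ∀ M : Matrix.SpecialLinearGroup (Fin 2) ℤ, ∀ τ z : ℂ, UHP τ →
      φ ((Ma M * τ + Mb M) / (Mc M * τ + Md M)) (z / (Mc M * τ + Md M))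
      = (Mc M * τ + Md M) ^ k *
          eC ((m : ℂ) * Mc M * z ^ 2 / (Mc M * τ + Md M)) * φ τ z
  ellip : ∀ p q : ℤ, ∀ τ z : ℂ, UHP τ →
      φ τ (z + (p : ℂ) * τ + (q : ℂ))
      = eC (-(m : ℂ) * ((p : ℂ) ^ 2 * τ + 2 * (p : ℂ) * z)) * φ τ z
  fourier : ∃ c : ℕ → ℤ → ℂ,
      (∀ (n : ℕ) (r : ℤ), 4 * (n : ℤ) * m < r ^ 2 → c n r = 0) ∧
      ∀ τ z : ℂ, UHP τ →
        HasSum (fun p : ℕ × ℤ => c p.1 p.2 * eC ((p.1 : ℂ) * τ + (p.2 : ℂ) * z)) (φ τ z)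

/-- Modular form of weight `k` for `SL(2,ℤ)`. -/
structure IsMF (k : ℕ) (f : ℂ → ℂ) : Prop where
  holo : DifferentiableOn ℂ f {τ | UHP τ}
  transf : ∀ M : Matrix.SpecialLinearGroup (Fin 2) ℤ, ∀ τ : ℂ, UHP τ →
      f ((Ma M * τ + Mb M) / (Mc M * τ + Md M)) = (Mc M * τ + Md M) ^ k * f τ
  bounded : ∃ A B : ℝ, ∀ τ : ℂ, B ≤ τ.im → ‖f τ‖ ≤ A

/-- Cusp form of weight `k` for `SL(2,ℤ)`. -/
structure IsCF (k : ℕ) (f : ℂ → ℂ) : Prop where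
  holo : DifferentiableOn ℂ f {τ | UHP τ}
  transf : ∀ M : Matrix.SpecialLinearGroup (Fin 2) ℤ, ∀ τ : ℂ, UHP τ →
      f ((Ma M * τ + Mb M) / (Mc M * τ + Md M)) = (Mc M * τ + Md M) ^ k * f τ
  decay : ∀ ε : ℝ, 0 < ε → ∃ B : ℝ, ∀ τ : ℂ, B ≤ τ.im → ‖f τ‖ ≤ ε

/-- `M_w(SL(2,ℤ), ω̄)` for the character `ω` of `SL(2,ℤ)` with `ω(T) = ω(S) = i`:
holomorphic functions on the upper half plane, bounded at infinity, with
`f|_w T = -i f` and `f|_w S = -i f`. -/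
structure IsMFOmegaBar (w : ℕ) (f : ℂ → ℂ) : Prop where
  holo : DifferentiableOn ℂ f {τ | UHP τ}
  transT : ∀ τ : ℂ, UHP τ → f (τ + 1) = -Complex.I * f τ
  transS : ∀ τ : ℂ, UHP τ → f (-1 / τ) = -Complex.I * τ ^ w * f τ
  bounded : ∃ A B : ℝ, ∀ τ : ℂ, B ≤ τ.im → ‖f τ‖ ≤ A

/-- Hermitian theta function `θ^H_{m,s}` of index `m` with characteristic
`s = (a + b i)/2 ∈ O_K^♯`; the sum is over `r = s + m (g₁ + g₂ i) ∈ s + m ℤ[i]`. -/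
def thetaH (m : ℕ) (a b : ℤ) (τ z₁ z₂ : ℂ) : ℂ :=
  ∑' g : ℤ × ℤ,
    eC ((((a : ℂ) + 2 * m * g.1) ^ 2 + ((b : ℂ) + 2 * m * g.2) ^ 2) / (4 * m) * τ
      + (((a : ℂ) + 2 * m * g.1) + ((b : ℂ) + 2 * m * g.2) * Complex.I) / 2 * z₁
      + (((a : ℂ) + 2 * m * g.1) - ((b : ℂ) + 2 * m * g.2) * Complex.I) / 2 * z₂)

/-- Classical theta function `θ_{m,μ}(τ,z) = Σ_{r ≡ μ mod 2m} e(r²τ/(4m) + r z)`. -/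
def thetaJ (m : ℕ) (μ : ℤ) (τ z : ℂ) : ℂ :=
  ∑' g : ℤ, eC (((μ : ℂ) + 2 * m * g) ^ 2 / (4 * m) * τ + ((μ : ℂ) + 2 * m * g) * z)

/-- `h` is the family of theta components of `φ` (for index `m`): the `h_{a,b}` depend
only on `(a, b) mod 2m` and `φ = Σ_{s ∈ O_K^♯ / m O_K} h_s θ^H_{m,s}`. -/
def HasThetaDecomp (m : ℕ) (φ : ℂ → ℂ → ℂ → ℂ) (h : ℤ → ℤ → ℂ → ℂ) : Prop :=
  (∀ (a b : ℤ) (τ : ℂ), h (a + 2 * m) b τ = h a b τ ∧ h a (b + 2 * m) τ = h a b τ) ∧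
  ∀ τ z₁ z₂ : ℂ, UHP τ →
    φ τ z₁ z₂ = ∑ a ∈ Finset.range (2 * m), ∑ b ∈ Finset.range (2 * m),
      h (a : ℤ) (b : ℤ) τ * thetaH m (a : ℤ) (b : ℤ) τ z₁ z₂

/-- `ϑ₀(τ) = Σ_{r ∈ ℤ} e(r² τ)`. -/
def theta0C (τ : ℂ) : ℂ := ∑' r : ℤ, eC ((r : ℂ) ^ 2 * τ)

/-- `ϑ₁(τ) = Σ_{r odd} e(r² τ / 4)`. -/
def theta1C (τ : ℂ) : ℂ := ∑' r : ℤ, eC ((2 * (r : ℂ) + 1) ^ 2 * τ / 4)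

/-- `ξ = ϑ₁ ϑ₀' − ϑ₀ ϑ₁'`. -/
def xiC (τ : ℂ) : ℂ := theta1C τ * deriv theta0C τ - theta0C τ * deriv theta1C τ

/-- Taylor coefficient `χ_{α,β}(τ)` of `φ(τ, z₁, z₂)` around `z₁ = z₂ = 0`. -/
def chiHJF (φ : ℂ → ℂ → ℂ → ℂ) (α β : ℕ) (τ : ℂ) : ℂ :=
  (1 / ((α.factorial : ℂ) * (β.factorial : ℂ))) *
    iteratedDeriv α (fun z₁ => iteratedDeriv β (fun z₂ => φ τ z₁ z₂) 0) 0

/-- `D₀ : J_{k,m} → M_k`, `ψ ↦ ψ(·, 0)`. -/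
def D0J (ψ : ℂ → ℂ → ℂ) : ℂ → ℂ := fun τ => ψ τ 0

/-- `D₂ : J_{k,m} → S_{k+2}`, `D₂ψ = (2k/(2πi)²) ψ₂ − (2m/(2πi)) ψ₀'`, where `ψ_ν` are
the Taylor coefficients of `ψ` around `z = 0`. -/
def D2J (k m : ℕ) (ψ : ℂ → ℂ → ℂ) : ℂ → ℂ := fun τ =>
  (2 * (k : ℂ) / (2 * (Real.pi : ℂ) * Complex.I) ^ 2) *
      ((1 / 2) * iteratedDeriv 2 (fun z => ψ τ z) 0)
    - (2 * (m : ℂ) / (2 * (Real.pi : ℂ) * Complex.I)) * deriv (fun t => ψ t 0) τ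

/-- Normalized Eisenstein series `E₄`. -/
def E4C (τ : ℂ) : ℂ :=
  1 + 240 * ∑' n : ℕ, ((ArithmeticFunction.sigma 3) n : ℂ) * eC ((n : ℂ) * τ)

/-- Normalized Eisenstein series `E₆`. -/
def E6C (τ : ℂ) : ℂ :=
  1 - 504 * ∑' n : ℕ, ((ArithmeticFunction.sigma 5) n : ℂ) * eC ((n : ℂ) * τ)

/-- `f` agrees on the upper half plane with a polynomial in `E₄` and `E₆²` that is
homogeneous of weight `k - v`, i.e. supported on `4a + 12b + v = k`. -/
def IsE4E6sqPoly (v k : ℕ) (f : ℂ → ℂ) : Prop :=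
  ∃ lam : ℕ × ℕ → ℂ, ∀ τ : ℂ, UHP τ →
    f τ = ∑ p ∈ (Finset.range (k + 1) ×ˢ Finset.range (k + 1)).filter
        (fun p => 4 * p.1 + 12 * p.2 + v = k),
      lam p * E4C τ ^ p.1 * E6C τ ^ (2 * p.2)

/-- The slash action `φ|_{k,m} M` of `M ∈ SL(2,ℤ)` on functions `ℂ → ℂ → ℂ → ℂ`. -/
def slashHJF (k m : ℕ) (φ : ℂ → ℂ → ℂ → ℂ) (M : Matrix.SpecialLinearGroup (Fin 2) ℤ)
    (τ z₁ z₂ : ℂ) : ℂ :=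
  ((Mc M * τ + Md M) ^ k)⁻¹ *
    eC (-(m : ℂ) * Mc M * z₁ * z₂ / (Mc M * τ + Md M)) *
    φ ((Ma M * τ + Mb M) / (Mc M * τ + Md M)) (z₁ / (Mc M * τ + Md M)) (z₂ / (Mc M * τ + Md M))

/-- Hermitian Jacobi form of weight `k` and index `m` for the congruence subgroup `Γ₀(N)`,
with at each cusp a Fourier expansion supported on `(n, r) ∈ ℚ_{≥0} × O_K^♯`
with `N(r) ≤ n m`. -/
structure IsHJFLevel (k m N : ℕ) (φ : ℂ → ℂ → ℂ → ℂ) : Prop where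
  holo : DifferentiableOn ℂ (fun p : ℂ × ℂ × ℂ => φ p.1 p.2.1 p.2.2) {p | UHP p.1}
  transf : ∀ ε : ℂ, ε ∈ ({1, -1, Complex.I, -Complex.I} : Set ℂ) →
    ∀ M : Matrix.SpecialLinearGroup (Fin 2) ℤ, (N : ℤ) ∣ M.1 1 0 →
    ∀ τ z₁ z₂ : ℂ, UHP τ →
      φ ((Ma M * τ + Mb M) / (Mc M * τ + Md M))
        (ε * z₁ / (Mc M * τ + Md M))
        ((starRingEnd ℂ) ε * z₂ / (Mc M * τ + Md M))
      = ε ^ k * (Mc M * τ + Md M) ^ k *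
          eC ((m : ℂ) * Mc M * z₁ * z₂ / (Mc M * τ + Md M)) * φ τ z₁ z₂
  ellip : ∀ p q u v : ℤ, ∀ τ z₁ z₂ : ℂ, UHP τ →
      φ τ (z₁ + ((p : ℂ) + (q : ℂ) * Complex.I) * τ + ((u : ℂ) + (v : ℂ) * Complex.I))
          (z₂ + ((p : ℂ) - (q : ℂ) * Complex.I) * τ + ((u : ℂ) - (v : ℂ) * Complex.I))
      = eC (-(m : ℂ) * (((p : ℂ) ^ 2 + (q : ℂ) ^ 2) * τ
          + ((p : ℂ) - (q : ℂ) * Complex.I) * z₁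
          + ((p : ℂ) + (q : ℂ) * Complex.I) * z₂)) * φ τ z₁ z₂
  cusp : ∀ M : Matrix.SpecialLinearGroup (Fin 2) ℤ,
      ∃ c : ℚ → ℤ → ℤ → ℂ,
        (∀ (n : ℚ) (a b : ℤ),
          ¬ (0 ≤ n ∧ ((a : ℚ) ^ 2 + (b : ℚ) ^ 2) ≤ 4 * n * m) → c n a b = 0) ∧
        ∀ τ z₁ z₂ : ℂ, UHP τ →
          HasSum (fun p : ℚ × ℤ × ℤ => c p.1 p.2.1 p.2.2 *
            eC ((p.1 : ℂ) * τ + (((p.2.1 : ℂ) + (p.2.2 : ℂ) * Complex.I) / 2) * z₁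
              + (((p.2.1 : ℂ) - (p.2.2 : ℂ) * Complex.I) / 2) * z₂))
            (slashHJF k m φ M τ z₁ z₂)

/-- Theta constant `x`. -/
def thConstX (τ : ℂ) : ℂ := ∑' n : ℤ, eC ((n : ℂ) ^ 2 * τ / 2)

/-- Theta constant `y`. -/
def thConstY (τ : ℂ) : ℂ := ∑' n : ℤ, (-1 : ℂ) ^ n * eC ((n : ℂ) ^ 2 * τ / 2)

/-- Theta constant `z`. -/
def thConstZ (τ : ℂ) : ℂ := ∑' n : ℤ, eC (((n : ℂ) + 1 / 2) ^ 2 * τ / 2)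

/-- `ψ = φ − h_{1,1}(θ^H_{1,1} − θ^H_{1,3} − θ^H_{3,1} + θ^H_{3,3})` (index 2). -/
def psiOf (φ : ℂ → ℂ → ℂ → ℂ) (h : ℤ → ℤ → ℂ → ℂ) : ℂ → ℂ → ℂ → ℂ :=
  fun τ z₁ z₂ => φ τ z₁ z₂ - h 1 1 τ *
    (thetaH 2 1 1 τ z₁ z₂ - thetaH 2 1 3 τ z₁ z₂
      - thetaH 2 3 1 τ z₁ z₂ + thetaH 2 3 3 τ z₁ z₂)



/-! ### Basics on `eC` -/

lemma eC_add (a b : ℂ) : eC (a + b) = eC a * eC b := by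
  simp only [eC, mul_add, Complex.exp_add]

lemma eC_zero : eC 0 = 1 := by simp [eC]

lemma eC_ne_zero (a : ℂ) : eC a ≠ 0 := Complex.exp_ne_zero _

lemma eC_neg (a : ℂ) : eC (-a) = (eC a)⁻¹ := by
  simp only [eC, mul_neg, Complex.exp_neg]

lemma eC_sub (a b : ℂ) : eC (a - b) = eC a / eC b := by
  rw [sub_eq_add_neg, eC_add, eC_neg, div_eq_mul_inv]

lemma eC_int (n : ℤ) : eC (n : ℂ) = 1 := by
  rw [eC, Complex.exp_eq_one_iff]; exact ⟨n, by ring⟩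

lemma eC_nat (n : ℕ) : eC (n : ℂ) = 1 := by exact_mod_cast eC_int n

lemma eC_one : eC 1 = 1 := by simpa using eC_int 1

lemma eC_nat_mul (n : ℕ) (a : ℂ) : eC (n * a) = eC a ^ n := by
  rw [eC, eC, ← Complex.exp_nat_mul]; ring_nf

lemma norm_eC (a : ℂ) : ‖eC a‖ = Real.exp (-2 * Real.pi * a.im) := by
  rw [eC, Complex.norm_exp]; congr 1; simp

lemma eC_add_int (a : ℂ) (n : ℤ) : eC (a + n) = eC a := by rw [eC_add, eC_int, mul_one]

lemma eC_half : eC (1 / 2) = -1 := by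
  rw [eC, show 2 * (Real.pi : ℂ) * I * (1 / 2) = Real.pi * I by ring, Complex.exp_pi_mul_I]

lemma eC_quarter : eC (1 / 4) = I := by
  rw [eC, show 2 * (Real.pi : ℂ) * I * (1 / 4) = Real.pi / 2 * I by ring, Complex.exp_pi_div_two_mul_I]

lemma differentiable_eC : Differentiable ℂ eC := by
  unfold eC; fun_prop

lemma hasDerivAt_eC (a : ℂ) : HasDerivAt eC (2 * Real.pi * I * eC a) a := by
  unfold eC
  have := ((hasDerivAt_id a).const_mul (2 * (Real.pi : ℂ) * I)).cexp
  simpa [mul_comm] using this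

/-! ### The theta series -/

/-- general term -/
def eA (A : ℤ) (τ w : ℂ) : ℂ := eC ((A : ℂ) ^ 2 / 8 * τ + A * w)

/-- theta series with coefficients -/
def thT (χ : ℤ → ℂ) (j : ℕ) (τ w : ℂ) : ℂ := ∑' A : ℤ, χ A * (A : ℂ) ^ j * eA A τ w

lemma eA_eq (A : ℤ) (τ w : ℂ) : eA A τ w = jacobiTheta₂_term A w (τ / 4) := by
  rw [eA, eC, jacobiTheta₂_term]; congr 1; ring

lemma eA_bound {S T : ℝ} (hT : 0 < T) {τ w : ℂ} (hw : |w.im| ≤ S) (hτ : T ≤ τ.im)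
    {χ : ℤ → ℂ} (hχ : ∀ A, ‖χ A‖ ≤ 1) (j : ℕ) (A : ℤ) :
    ‖χ A * (A : ℂ) ^ j * eA A τ w‖ ≤
      (|A| ^ j : ℝ) * Real.exp (-Real.pi * (T / 4 * A ^ 2 - 2 * S * |A|)) := by
  rw [norm_mul, norm_mul, norm_pow, norm_intCast, eA_eq]
  have h1 := norm_jacobiTheta₂_term_le (S := S) (T := T / 4) (by positivity) hw
    (τ := τ / 4) (by simp; linarith) A
  have h2 : ‖χ A‖ * |(A : ℝ)| ^ j ≤ |(A : ℝ)| ^ j :=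
    mul_le_of_le_one_left (by positivity) (hχ A)
  push_cast at h1 ⊢
  exact mul_le_mul h2 h1 (norm_nonneg _) (by positivity)

lemma summable_thT {χ : ℤ → ℂ} (hχ : ∀ A, ‖χ A‖ ≤ 1) (j : ℕ) {τ : ℂ} (hτ : UHP τ) (w : ℂ) :
    Summable (fun A : ℤ => χ A * (A : ℂ) ^ j * eA A τ w) := by
  have hT : 0 < τ.im := hτ
  refine (summable_pow_mul_jacobiTheta₂_term_bound |w.im| (T := τ.im / 4) (by positivity) j).of_norm_bounded ?_
  intro A
  exact eA_bound hT le_rfl le_rfl hχ j A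

lemma summable_norm_eA {τ : ℂ} (hτ : UHP τ) (w : ℂ) : Summable (fun A : ℤ => ‖eA A τ w‖) := by
  have := (summable_thT (χ := fun _ => 1) (by simp) 0 hτ w).norm
  simpa using this

lemma hasSum_thT {χ : ℤ → ℂ} (hχ : ∀ A, ‖χ A‖ ≤ 1) (j : ℕ) {τ : ℂ} (hτ : UHP τ) (w : ℂ) :
    HasSum (fun A : ℤ => χ A * (A : ℂ) ^ j * eA A τ w) (thT χ j τ w) :=
  (summable_thT hχ j hτ w).hasSum

lemma hasDerivAt_eA_w (A : ℤ) (τ w : ℂ) :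
    HasDerivAt (fun w => eA A τ w) (2 * Real.pi * I * A * eA A τ w) w := by
  have h : HasDerivAt (fun w : ℂ => (A : ℂ) ^ 2 / 8 * τ + A * w) (A : ℂ) w := by
    simpa using ((hasDerivAt_id w).const_mul (A : ℂ)).const_add ((A : ℂ) ^ 2 / 8 * τ)
  have := (hasDerivAt_eC _).comp w h
  simp only [Function.comp_def] at this
  refine this.congr_deriv ?_
  rw [eA]; ring

lemma hasDerivAt_eA_tau (A : ℤ) (τ w : ℂ) :
    HasDerivAt (fun τ => eA A τ w) (2 * Real.pi * I / 8 * A ^ 2 * eA A τ w) τ := by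
  have h : HasDerivAt (fun τ : ℂ => (A : ℂ) ^ 2 / 8 * τ + A * w) ((A : ℂ) ^ 2 / 8) τ := by
    simpa using ((hasDerivAt_id τ).const_mul ((A : ℂ) ^ 2 / 8)).add_const (A * w)
  have := (hasDerivAt_eC _).comp τ h
  simp only [Function.comp_def] at this
  refine this.congr_deriv ?_
  rw [eA]; ring

lemma hasDerivAt_thT_w {χ : ℤ → ℂ} (hχ : ∀ A, ‖χ A‖ ≤ 1) (j : ℕ) {τ : ℂ} (hτ : UHP τ) (w : ℂ) :
    HasDerivAt (fun w => thT χ j τ w) (2 * Real.pi * I * thT χ (j + 1) τ w) w := by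
  have hT : 0 < τ.im := hτ
  obtain ⟨S, hS⟩ := exists_gt |w.im|
  have hU : IsOpen {u : ℂ | |u.im| < S} :=
    isOpen_lt (by fun_prop) continuous_const
  have hsum := summable_pow_mul_jacobiTheta₂_term_bound S (T := τ.im / 4) (by positivity) j
  have hd : ∀ A : ℤ, DifferentiableOn ℂ (fun w => χ A * (A : ℂ) ^ j * eA A τ w) {u : ℂ | |u.im| < S} :=
    fun A u _ => ((hasDerivAt_eA_w A τ u).const_mul _).differentiableAt.differentiableWithinAt
  have hb : ∀ (A : ℤ) (u : ℂ), u ∈ {u : ℂ | |u.im| < S} → ‖χ A * (A : ℂ) ^ j * eA A τ u‖ ≤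
      (|A| ^ j : ℝ) * Real.exp (-Real.pi * (τ.im / 4 * A ^ 2 - 2 * S * |A|)) := by
    intro A u hu
    have hu' : |u.im| ≤ S := le_of_lt hu
    exact eA_bound hT hu' le_rfl hχ j A
  have h1 := differentiableOn_tsum_of_summable_norm hsum hd hU hb
  have h2 := hasSum_deriv_of_summable_norm hsum hd hU hb (show w ∈ {u : ℂ | |u.im| < S} from hS)
  have h3 : HasSum (fun A : ℤ => deriv (fun w => χ A * (A : ℂ) ^ j * eA A τ w) w)
      (2 * Real.pi * I * thT χ (j + 1) τ w) := by
    have := (hasSum_thT hχ (j + 1) hτ w).mul_left (2 * Real.pi * I)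
    refine this.congr_fun ?_
    intro A
    rw [((hasDerivAt_eA_w A τ w).const_mul _).deriv]; ring
  rw [← h2.unique h3]
  exact (h1.differentiableAt (hU.mem_nhds hS)).hasDerivAt

lemma hasDerivAt_thT_tau {χ : ℤ → ℂ} (hχ : ∀ A, ‖χ A‖ ≤ 1) (j : ℕ) {τ : ℂ} (hτ : UHP τ) (w : ℂ) :
    HasDerivAt (fun τ => thT χ j τ w) (2 * Real.pi * I / 8 * thT χ (j + 2) τ w) τ := by
  obtain ⟨T, hT, hT'⟩ := exists_between (show 0 < τ.im from hτ)
  have hU : IsOpen {u : ℂ | T < u.im} := isOpen_lt continuous_const (by fun_prop)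
  have hsum := summable_pow_mul_jacobiTheta₂_term_bound |w.im| (T := T / 4) (by positivity) j
  have hd : ∀ A : ℤ, DifferentiableOn ℂ (fun τ => χ A * (A : ℂ) ^ j * eA A τ w) {u : ℂ | T < u.im} :=
    fun A u _ => ((hasDerivAt_eA_tau A u w).const_mul _).differentiableAt.differentiableWithinAt
  have hb : ∀ (A : ℤ) (u : ℂ), u ∈ {u : ℂ | T < u.im} → ‖χ A * (A : ℂ) ^ j * eA A u w‖ ≤
      (|A| ^ j : ℝ) * Real.exp (-Real.pi * (T / 4 * A ^ 2 - 2 * |w.im| * |A|)) := by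
    intro A u hu
    have hu' : T ≤ u.im := le_of_lt hu
    exact eA_bound hT le_rfl hu' hχ j A
  have h1 := differentiableOn_tsum_of_summable_norm hsum hd hU hb
  have h2 := hasSum_deriv_of_summable_norm hsum hd hU hb (show τ ∈ {u : ℂ | T < u.im} from hT')
  have h3 : HasSum (fun A : ℤ => deriv (fun τ => χ A * (A : ℂ) ^ j * eA A τ w) τ)
      (2 * Real.pi * I / 8 * thT χ (j + 2) τ w) := by
    have := (hasSum_thT hχ (j + 2) hτ w).mul_left (2 * Real.pi * I / 8)
    refine this.congr_fun ?_
    intro A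
    rw [((hasDerivAt_eA_tau A τ w).const_mul _).deriv]; ring
  rw [← h2.unique h3]
  exact (h1.differentiableAt (hU.mem_nhds hT')).hasDerivAt

/-- the four coefficient functions -/
def cX (A : ℤ) : ℂ := if A % 4 = 0 then 1 else if A % 4 = 2 then 1 else 0
def cY (A : ℤ) : ℂ := if A % 4 = 0 then 1 else if A % 4 = 2 then -1 else 0
def cZ (A : ℤ) : ℂ := if A % 4 = 1 then 1 else if A % 4 = 3 then 1 else 0
def cO (A : ℤ) : ℂ := if A % 4 = 1 then 1 else if A % 4 = 3 then -1 else 0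
def cI (a A : ℤ) : ℂ := if A % 4 = a % 4 then 1 else 0

lemma cX_bd (A : ℤ) : ‖cX A‖ ≤ 1 := by unfold cX; split_ifs <;> simp
lemma cY_bd (A : ℤ) : ‖cY A‖ ≤ 1 := by unfold cY; split_ifs <;> simp
lemma cZ_bd (A : ℤ) : ‖cZ A‖ ≤ 1 := by unfold cZ; split_ifs <;> simp
lemma cO_bd (A : ℤ) : ‖cO A‖ ≤ 1 := by unfold cO; split_ifs <;> simp
lemma cI_bd (a A : ℤ) : ‖cI a A‖ ≤ 1 := by unfold cI; split_ifs <;> simp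

abbrev tX (τ w : ℂ) : ℂ := thT cX 0 τ w
abbrev tY (τ w : ℂ) : ℂ := thT cY 0 τ w
abbrev tZ (τ w : ℂ) : ℂ := thT cZ 0 τ w
abbrev tO (τ w : ℂ) : ℂ := thT cO 0 τ w
abbrev tI (a : ℤ) (τ w : ℂ) : ℂ := thT (cI a) 0 τ w

lemma thT_congr {χ χ' : ℤ → ℂ} (h : ∀ A, χ A = χ' A) (j : ℕ) (τ w : ℂ) : thT χ j τ w = thT χ' j τ w := by
  rw [show χ = χ' from funext h]

lemma thT_neg_w (χ : ℤ → ℂ) (τ w : ℂ) : thT χ 0 τ (-w) = thT (fun A => χ (-A)) 0 τ w := by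
  unfold thT
  rw [← (Equiv.neg ℤ).tsum_eq]
  refine tsum_congr fun A => ?_
  simp only [eA, Equiv.neg_apply]
  push_cast; simp

lemma tX_neg (τ w : ℂ) : tX τ (-w) = tX τ w := by
  rw [tX, thT_neg_w]; refine thT_congr (fun A => ?_) _ _ _; unfold cX; grind
lemma tY_neg (τ w : ℂ) : tY τ (-w) = tY τ w := by
  rw [tY, thT_neg_w]; refine thT_congr (fun A => ?_) _ _ _; unfold cY; grind
lemma tZ_neg (τ w : ℂ) : tZ τ (-w) = tZ τ w := by
  rw [tZ, thT_neg_w]; refine thT_congr (fun A => ?_) _ _ _; unfold cZ; grind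
lemma tO_neg (τ w : ℂ) : tO τ (-w) = - tO τ w := by
  rw [tO, thT_neg_w, show (-thT cO 0 τ w) = thT (fun A => - cO A) 0 τ w by
    simp only [thT, neg_mul, tsum_neg]]
  refine thT_congr (fun A => ?_) _ _ _; unfold cO; grind
lemma tI_neg (a : ℤ) (τ w : ℂ) : tI a τ (-w) = tI (-a) τ w := by
  rw [tI, thT_neg_w]; refine thT_congr (fun A => ?_) _ _ _; unfold cI; grind

lemma tX_eq (τ w : ℂ) : tX τ w = jacobiTheta₂ (2 * w) τ := by
  rw [tX, thT, jacobiTheta₂]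
  have hi : Function.Injective (fun n : ℤ => 2 * n) := fun a b h => by simpa using h
  rw [← hi.tsum_eq]
  · refine tsum_congr fun n => ?_
    have : cX (2 * n) = 1 := by unfold cX; grind
    rw [this, eA, eC, jacobiTheta₂_term]; push_cast; ring_nf
  · intro A hA
    by_contra h
    apply hA
    have : cX A = 0 := by
      unfold cX
      have h1 : A % 4 ≠ 0 := fun h0 => h ⟨A / 2, by simp; omega⟩
      have h2 : A % 4 ≠ 2 := fun h0 => h ⟨A / 2, by simp; omega⟩
      simp [h1, h2]
    simp [this]

lemma tY_eq (τ w : ℂ) : tY τ w = jacobiTheta₂ (2 * w + 1 / 2) τ := by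
  rw [tY, thT, jacobiTheta₂]
  have hi : Function.Injective (fun n : ℤ => 2 * n) := fun a b h => by simpa using h
  rw [← hi.tsum_eq]
  · refine tsum_congr fun n => ?_
    have : cY (2 * n) = eC (n / 2) := by
      rcases Int.even_or_odd' n with ⟨m, rfl | rfl⟩
      · rw [show ((2 * m : ℤ) : ℂ) / 2 = (m : ℤ) by push_cast; ring, eC_int]; unfold cY; grind
      · rw [show ((2 * m + 1 : ℤ) : ℂ) / 2 = 1 / 2 + (m : ℤ) by push_cast; ring, eC_add_int, eC_half]
        unfold cY; grind
    rw [this, eA, eC, eC, jacobiTheta₂_term, pow_zero, mul_one, ← Complex.exp_add]; push_cast; ring_nf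
  · intro A hA
    by_contra h
    apply hA
    have : cY A = 0 := by
      unfold cY
      have h1 : A % 4 ≠ 0 := fun h0 => h ⟨A / 2, by simp; omega⟩
      have h2 : A % 4 ≠ 2 := fun h0 => h ⟨A / 2, by simp; omega⟩
      simp [h1, h2]
    simp [this]

lemma tZ_eq (τ w : ℂ) : tZ τ w = eC (τ / 8 + w) * jacobiTheta₂ (2 * w + τ / 2) τ := by
  rw [tZ, thT, jacobiTheta₂, ← tsum_mul_left]
  have hi : Function.Injective (fun n : ℤ => 2 * n + 1) := fun a b h => by simpa using h
  rw [← hi.tsum_eq]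
  · refine tsum_congr fun n => ?_
    have : cZ (2 * n + 1) = 1 := by unfold cZ; grind
    rw [this, eA, eC, eC, jacobiTheta₂_term, pow_zero, mul_one, one_mul, ← Complex.exp_add]; push_cast; ring_nf
  · intro A hA
    by_contra h
    apply hA
    have : cZ A = 0 := by
      unfold cZ
      have h1 : A % 4 ≠ 1 := fun h0 => h ⟨A / 2, by simp; omega⟩
      have h2 : A % 4 ≠ 3 := fun h0 => h ⟨A / 2, by simp; omega⟩
      simp [h1, h2]
    simp [this]

lemma tO_eq (τ w : ℂ) : tO τ w = eC (τ / 8 + w) * jacobiTheta₂ (2 * w + τ / 2 + 1 / 2) τ := by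
  rw [tO, thT, jacobiTheta₂, ← tsum_mul_left]
  have hi : Function.Injective (fun n : ℤ => 2 * n + 1) := fun a b h => by simpa using h
  rw [← hi.tsum_eq]
  · refine tsum_congr fun n => ?_
    have : cO (2 * n + 1) = eC (n / 2) := by
      rcases Int.even_or_odd' n with ⟨m, rfl | rfl⟩
      · rw [show ((2 * m : ℤ) : ℂ) / 2 = (m : ℤ) by push_cast; ring, eC_int]; unfold cO; grind
      · rw [show ((2 * m + 1 : ℤ) : ℂ) / 2 = 1 / 2 + (m : ℤ) by push_cast; ring, eC_add_int, eC_half]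
        unfold cO; grind
    rw [this, eA, eC, eC, eC, jacobiTheta₂_term, pow_zero, mul_one, ← Complex.exp_add, ← Complex.exp_add]
    push_cast; ring_nf
  · intro A hA
    by_contra h
    apply hA
    have : cO A = 0 := by
      unfold cO
      have h1 : A % 4 ≠ 1 := fun h0 => h ⟨A / 2, by simp; omega⟩
      have h2 : A % 4 ≠ 3 := fun h0 => h ⟨A / 2, by simp; omega⟩
      simp [h1, h2]
    simp [this]

/-! ### decomposition into residue classes -/

lemma thT_decomp {χ : ℤ → ℂ} (hper : ∀ A, χ (A + 4) = χ A) (j : ℕ) {τ : ℂ} (hτ : UHP τ) (w : ℂ) :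
    thT χ j τ w = ∑ a ∈ Finset.range 4, χ (a : ℤ) * thT (cI a) j τ w := by
  have hmod : ∀ A, χ A = χ (A % 4) := by
    have hp : Function.Periodic χ 4 := hper
    intro A
    have := hp.sub_zsmul_eq (x := A) (A / 4)
    rw [← this]; congr 1; simp only [smul_eq_mul]; omega
  have h : HasSum (fun A : ℤ => ∑ a ∈ Finset.range 4, χ (a : ℤ) * (cI a A * (A : ℂ) ^ j * eA A τ w))
      (∑ a ∈ Finset.range 4, χ (a : ℤ) * thT (cI a) j τ w) :=
    hasSum_sum fun a _ => (hasSum_thT (cI_bd a) j hτ w).mul_left _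
  rw [thT, ← h.tsum_eq]
  refine tsum_congr fun A => ?_
  rw [hmod A]
  have : A % 4 = 0 ∨ A % 4 = 1 ∨ A % 4 = 2 ∨ A % 4 = 3 := by omega
  rcases this with h | h | h | h <;>
  simp [Finset.sum_range_succ, cI, h, mul_assoc]

lemma tI_tsum (a : ℤ) (τ w : ℂ) :
    tI a τ w = ∑' g : ℤ, eC (((a : ℂ) + 4 * g) ^ 2 / 8 * τ + ((a : ℂ) + 4 * g) * w) := by
  rw [tI, thT]
  have hi : Function.Injective (fun n : ℤ => a + 4 * n) := fun a b h => by simpa using h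
  rw [← hi.tsum_eq]
  · refine tsum_congr fun n => ?_
    have : cI a (a + 4 * n) = 1 := by unfold cI; grind
    rw [this, eA]; push_cast; ring_nf
  · intro A hA
    by_contra h
    apply hA
    have : cI a A = 0 := by
      unfold cI
      have h1 : A % 4 ≠ a % 4 := fun h0 => h ⟨(A - a) / 4, by simp; omega⟩
      simp [h1]
    simp [this]

lemma thetaH_eq (a b : ℤ) {τ : ℂ} (hτ : UHP τ) (z₁ z₂ : ℂ) :
    thetaH 2 a b τ z₁ z₂ = tI a τ ((z₁ + z₂) / 2) * tI b τ (I * (z₁ - z₂) / 2) := by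
  have hs : ∀ (a : ℤ) (w : ℂ), Summable
      (fun g : ℤ => ‖eC (((a : ℂ) + 4 * g) ^ 2 / 8 * τ + ((a : ℂ) + 4 * g) * w)‖) := by
    intro a w
    have hi : Function.Injective (fun n : ℤ => a + 4 * n) := fun a b h => by simpa using h
    have := (summable_norm_eA hτ w).comp_injective hi
    refine this.congr fun g => ?_
    simp [eA]
  rw [tI_tsum, tI_tsum, tsum_mul_tsum_of_summable_norm (hs a _) (hs b _), thetaH]
  refine tsum_congr fun g => ?_
  rw [← eC_add]
  congr 1
  push_cast; ring


/-! ### transformation laws of theta series -/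

lemma uhp_add_one {τ : ℂ} (hτ : UHP τ) : UHP (τ + 1) := by simpa [UHP] using hτ

lemma uhp_ne_zero {τ : ℂ} (hτ : UHP τ) : τ ≠ 0 := by
  rintro rfl; simp [UHP] at hτ

lemma uhp_S {τ : ℂ} (hτ : UHP τ) : UHP (-1 / τ) := by
  have h0 := uhp_ne_zero hτ
  have : 0 < Complex.normSq τ := Complex.normSq_pos.2 h0
  have hτ' : 0 < τ.im := hτ
  have : (-1 / τ).im = τ.im / Complex.normSq τ := by
    rw [Complex.div_im]; simp [neg_div]
  rw [UHP, this]; positivity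

lemma isOpen_UHP : IsOpen {τ : ℂ | UHP τ} := isOpen_lt continuous_const Complex.continuous_im

/-- the square root factor -/
def rtS (τ : ℂ) : ℂ := (-I * τ) ^ (1 / 2 : ℂ)

lemma rtS_sq (τ : ℂ) : rtS τ ^ 2 = -I * τ := by
  rw [rtS, ← Complex.cpow_nat_mul]; norm_num

lemma rtS_ne_zero {τ : ℂ} (hτ : UHP τ) : rtS τ ≠ 0 := by
  intro h
  have := rtS_sq τ
  rw [h] at this
  have h0 := uhp_ne_zero hτ
  simp at this
  exact h0 this

lemma eC_sq8 : eC (1 / 8) ^ 2 = I := by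
  rw [← eC_quarter, ← eC_nat_mul]; congr 1; push_cast; ring

lemma tT_gen {χ χ' : ℤ → ℂ} {c : ℂ} (h : ∀ A : ℤ, χ A * eC ((A : ℂ) ^ 2 / 8) = c * χ' A) (j : ℕ) (τ w : ℂ) :
    thT χ j (τ + 1) w = c * thT χ' j τ w := by
  rw [thT, thT, ← tsum_mul_left]
  refine tsum_congr fun A => ?_
  rw [eA, show (A : ℂ) ^ 2 / 8 * (τ + 1) + A * w = (A : ℂ) ^ 2 / 8 + ((A : ℂ) ^ 2 / 8 * τ + A * w) by ring,
    eC_add, ← eA]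
  linear_combination (A : ℂ) ^ j * eA A τ w * h A

lemma eC_odd_sq {A : ℤ} (h : A % 2 = 1) : eC ((A : ℂ) ^ 2 / 8) = eC (1 / 8) := by
  obtain ⟨m, hm⟩ : ∃ m : ℤ, A ^ 2 = 8 * m + 1 := by
    obtain ⟨b, rfl⟩ : ∃ b, A = 2 * b + 1 := ⟨A / 2, by omega⟩
    obtain ⟨d, hd⟩ := Int.even_mul_succ_self b
    exact ⟨d, by linear_combination 4 * hd⟩
  have : (A : ℂ) ^ 2 / 8 = 1 / 8 + (m : ℤ) := by
    have : (A : ℂ) ^ 2 = 8 * m + 1 := by exact_mod_cast hm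
    rw [this]; ring
  rw [this, eC_add_int]

lemma eC_0_sq {A : ℤ} (h : A % 4 = 0) : eC ((A : ℂ) ^ 2 / 8) = 1 := by
  obtain ⟨b, rfl⟩ : ∃ b, A = 4 * b := ⟨A / 4, by omega⟩
  have : ((4 * b : ℤ) : ℂ) ^ 2 / 8 = ((2 * b ^ 2 : ℤ) : ℂ) := by push_cast; ring
  rw [this, eC_int]

lemma eC_2_sq {A : ℤ} (h : A % 4 = 2) : eC ((A : ℂ) ^ 2 / 8) = -1 := by
  obtain ⟨b, rfl⟩ : ∃ b, A = 4 * b + 2 := ⟨A / 4, by omega⟩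
  have : ((4 * b + 2 : ℤ) : ℂ) ^ 2 / 8 = 1 / 2 + ((2 * b ^ 2 + 2 * b : ℤ) : ℂ) := by push_cast; ring
  rw [this, eC_add_int, eC_half]

lemma tX_T (j : ℕ) (τ w : ℂ) : thT cX j (τ + 1) w = thT cY j τ w := by
  rw [tT_gen (χ' := cY) (c := 1), one_mul]
  intro A
  unfold cX cY
  split_ifs with h1 h2
  · rw [eC_0_sq h1]
  · rw [eC_2_sq h2]
  · ring

lemma tY_T (j : ℕ) (τ w : ℂ) : thT cY j (τ + 1) w = thT cX j τ w := by
  rw [tT_gen (χ' := cX) (c := 1), one_mul]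
  intro A
  unfold cX cY
  split_ifs with h1 h2
  · rw [eC_0_sq h1]
  · rw [eC_2_sq h2]; ring
  · ring

lemma tZ_T (j : ℕ) (τ w : ℂ) : thT cZ j (τ + 1) w = eC (1 / 8) * thT cZ j τ w := by
  rw [tT_gen (χ' := cZ) (c := eC (1 / 8))]
  intro A
  unfold cZ
  split_ifs with h1 h2
  · rw [eC_odd_sq (by omega)]; ring
  · rw [eC_odd_sq (by omega)]; ring
  · ring

lemma tO_T (j : ℕ) (τ w : ℂ) : thT cO j (τ + 1) w = eC (1 / 8) * thT cO j τ w := by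
  rw [tT_gen (χ' := cO) (c := eC (1 / 8))]
  intro A
  unfold cO
  split_ifs with h1 h2
  · rw [eC_odd_sq (by omega)]; ring
  · rw [eC_odd_sq (by omega)]; ring
  · ring

lemma jt_S {τ : ℂ} (hτ : UHP τ) (z : ℂ) :
    jacobiTheta₂ (z / τ) (-1 / τ) = rtS τ * eC (z ^ 2 / (2 * τ)) * jacobiTheta₂ z τ := by
  have h := jacobiTheta₂_functional_equation z τ
  have h0 := uhp_ne_zero hτ
  have h1 := rtS_ne_zero hτ
  rw [← rtS] at h
  have h2 : cexp (-Real.pi * I * z ^ 2 / τ) = (eC (z ^ 2 / (2 * τ)))⁻¹ := by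
    rw [← eC_neg, eC]; congr 1; field_simp
  have h3 := eC_ne_zero (z ^ 2 / (2 * τ))
  rw [h, h2]
  generalize eC (z ^ 2 / (2 * τ)) = e at *
  generalize jacobiTheta₂ (z / τ) (-1 / τ) = b at *
  field_simp

lemma tX_S {τ : ℂ} (hτ : UHP τ) (w : ℂ) :
    tX (-1 / τ) (w / τ) = rtS τ * eC (2 * w ^ 2 / τ) * tX τ w := by
  have h0 := uhp_ne_zero hτ
  rw [tX_eq, tX_eq, show 2 * (w / τ) = (2 * w) / τ by ring, jt_S hτ]
  congr 3; field_simp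

lemma tY_S {τ : ℂ} (hτ : UHP τ) (w : ℂ) :
    tY (-1 / τ) (w / τ) = rtS τ * eC (2 * w ^ 2 / τ) * tZ τ w := by
  have h0 := uhp_ne_zero hτ
  rw [tY_eq, tZ_eq, show 2 * (w / τ) + 1 / 2 = (2 * w + τ / 2) / τ by field_simp, jt_S hτ]
  have : eC ((2 * w + τ / 2) ^ 2 / (2 * τ)) = eC (2 * w ^ 2 / τ) * eC (τ / 8 + w) := by
    rw [← eC_add]; congr 1; field_simp; ring
  rw [this]; ring

lemma jt_add_one (z τ : ℂ) : jacobiTheta₂ (z - 1) τ = jacobiTheta₂ z τ := by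
  have := jacobiTheta₂_add_left (z - 1) τ
  rw [← this]; simp

lemma tZ_S {τ : ℂ} (hτ : UHP τ) (w : ℂ) :
    tZ (-1 / τ) (w / τ) = rtS τ * eC (2 * w ^ 2 / τ) * tY τ w := by
  have h0 := uhp_ne_zero hτ
  rw [tZ_eq, tY_eq, show 2 * (w / τ) + (-1 / τ) / 2 = (2 * w - 1 / 2) / τ by field_simp; ring, jt_S hτ,
    show 2 * w - 1 / 2 = (2 * w + 1 / 2) - 1 by ring, jt_add_one]
  have : eC ((2 * w + 1 / 2 - 1) ^ 2 / (2 * τ)) * eC (-1 / τ / 8 + w / τ) = eC (2 * w ^ 2 / τ) := by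
    rw [← eC_add]; congr 1; field_simp; ring
  rw [← this]; ring

lemma tO_S {τ : ℂ} (hτ : UHP τ) (w : ℂ) :
    tO (-1 / τ) (w / τ) = -I * (rtS τ * eC (2 * w ^ 2 / τ) * tO τ w) := by
  have h0 := uhp_ne_zero hτ
  rw [tO_eq, tO_eq, show 2 * (w / τ) + (-1 / τ) / 2 + 1 / 2 = (2 * w - 1 / 2 + τ / 2) / τ by field_simp; ring, jt_S hτ,
    show 2 * w - 1 / 2 + τ / 2 = (2 * w + τ / 2 + 1 / 2) - 1 by ring, jt_add_one]
  have h1 : -I = eC (-(1 / 4)) := by rw [eC_neg, eC_quarter, Complex.inv_I]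
  have : eC ((2 * w + τ / 2 + 1 / 2 - 1) ^ 2 / (2 * τ)) * eC (-1 / τ / 8 + w / τ) =
      -I * eC (2 * w ^ 2 / τ) * eC (τ / 8 + w) := by
    rw [h1, ← eC_add, ← eC_add, ← eC_add]; congr 1; field_simp; ring
  linear_combination (rtS τ * jacobiTheta₂ (2 * w + τ / 2 + 1 / 2) τ) * this

lemma thT_ellip {χ : ℤ → ℂ} (hper : ∀ A, χ (A + 4) = χ A) (p q : ℤ) (τ w : ℂ) :
    thT χ 0 τ (w + p * τ + q) = eC (-(2 * p ^ 2 * τ + 4 * p * w)) * thT χ 0 τ w := by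
  have hp : Function.Periodic χ 4 := hper
  rw [thT, thT, ← tsum_mul_left, ← (Equiv.addRight (4 * p)).tsum_eq (fun A => eC (-(2 * p ^ 2 * τ + 4 * p * w)) * (χ A * (A : ℂ) ^ 0 * eA A τ w))]
  refine tsum_congr fun A => ?_
  have h1 : χ (A + 4 * p) = χ A := by
    have := hp.zsmul p A
    rw [smul_eq_mul, mul_comm] at this; exact this
  simp only [Equiv.coe_addRight, h1, pow_zero, mul_one]
  have : eA A τ (w + p * τ + q) = eC (-(2 * p ^ 2 * τ + 4 * p * w)) * eA (A + 4 * p) τ w := by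
    rw [eA, eA, ← eC_add, show (A : ℂ) ^ 2 / 8 * τ + A * (w + p * τ + q) = -(2 * p ^ 2 * τ + 4 * p * w) +
      (((A + 4 * p : ℤ) : ℂ) ^ 2 / 8 * τ + ((A + 4 * p : ℤ) : ℂ) * w) + ((A * q : ℤ) : ℂ) by push_cast; ring,
      eC_add_int]
  rw [this]; ring

lemma cX_per (A : ℤ) : cX (A + 4) = cX A := by unfold cX; simp
lemma cY_per (A : ℤ) : cY (A + 4) = cY A := by unfold cY; simp
lemma cZ_per (A : ℤ) : cZ (A + 4) = cZ A := by unfold cZ; simp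
lemma cO_per (A : ℤ) : cO (A + 4) = cO A := by unfold cO; simp
lemma cI_per (a A : ℤ) : cI a (A + 4) = cI a A := by unfold cI; simp

/-! ### joint differentiability -/

lemma jt_diff {E : Type*} [NormedAddCommGroup E] [NormedSpace ℂ E] {f g : E → ℂ} {x : E}
    (hf : DifferentiableAt ℂ f x) (hg : DifferentiableAt ℂ g x) (h : UHP (g x)) :
    DifferentiableAt ℂ (fun x => jacobiTheta₂ (f x) (g x)) x := by
  have h1 := (hasFDerivAt_jacobiTheta₂ (f x) (τ := g x) h).differentiableAt
  exact DifferentiableAt.comp (f := fun x => (f x, g x)) (g := fun p : ℂ × ℂ => jacobiTheta₂ p.1 p.2) x h1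
    (hf.prodMk hg)

lemma tX_diff {E : Type*} [NormedAddCommGroup E] [NormedSpace ℂ E] {f g : E → ℂ} {x : E}
    (hf : DifferentiableAt ℂ f x) (hg : DifferentiableAt ℂ g x) (h : UHP (g x)) :
    DifferentiableAt ℂ (fun x => tX (g x) (f x)) x := by
  simp only [tX_eq]
  exact jt_diff (by fun_prop) hg h

lemma tY_diff {E : Type*} [NormedAddCommGroup E] [NormedSpace ℂ E] {f g : E → ℂ} {x : E}
    (hf : DifferentiableAt ℂ f x) (hg : DifferentiableAt ℂ g x) (h : UHP (g x)) :
    DifferentiableAt ℂ (fun x => tY (g x) (f x)) x := by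
  simp only [tY_eq]
  exact jt_diff (by fun_prop) hg h

lemma eC_diff {E : Type*} [NormedAddCommGroup E] [NormedSpace ℂ E] {f : E → ℂ} {x : E}
    (hf : DifferentiableAt ℂ f x) : DifferentiableAt ℂ (fun x => eC (f x)) x :=
  (differentiable_eC (f x)).comp x hf

lemma tZ_diff {E : Type*} [NormedAddCommGroup E] [NormedSpace ℂ E] {f g : E → ℂ} {x : E}
    (hf : DifferentiableAt ℂ f x) (hg : DifferentiableAt ℂ g x) (h : UHP (g x)) :
    DifferentiableAt ℂ (fun x => tZ (g x) (f x)) x := by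
  simp only [tZ_eq]
  exact (eC_diff (by fun_prop)).mul (jt_diff (by fun_prop) hg h)

lemma tO_diff {E : Type*} [NormedAddCommGroup E] [NormedSpace ℂ E] {f g : E → ℂ} {x : E}
    (hf : DifferentiableAt ℂ f x) (hg : DifferentiableAt ℂ g x) (h : UHP (g x)) :
    DifferentiableAt ℂ (fun x => tO (g x) (f x)) x := by
  simp only [tO_eq]
  exact (eC_diff (by fun_prop)).mul (jt_diff (by fun_prop) hg h)

lemma thT_diff {χ : ℤ → ℂ} (hχ : ∀ A, ‖χ A‖ ≤ 1) (j : ℕ) (w : ℂ) {τ : ℂ} (hτ : UHP τ) :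
    DifferentiableAt ℂ (fun τ => thT χ j τ w) τ := (hasDerivAt_thT_tau hχ j hτ w).differentiableAt

/-! ### `SL(2,ℤ)` from generators -/

open Matrix in
lemma slash_gen {V : Type*} [AddCommGroup V] [Module ℂ V] (q : V → ℂ)
    (hq : ∀ (a : ℂ) v, q (a • v) = a ^ 2 * q v) (k : ℕ) (m : ℂ) (F : ℂ → V → ℂ)
    (hT : ∀ τ v, UHP τ → F (τ + 1) v = F τ v)
    (hS : ∀ τ v, UHP τ → F (-1 / τ) ((1 / τ) • v) = τ ^ k * eC (m * q v / τ) * F τ v)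
    (M : Matrix.SpecialLinearGroup (Fin 2) ℤ) (τ : ℂ) (v : V) (hτ : UHP τ) :
    F ((Ma M * τ + Mb M) / (Mc M * τ + Md M)) ((1 / (Mc M * τ + Md M)) • v) =
      (Mc M * τ + Md M) ^ k * eC (m * Mc M * q v / (Mc M * τ + Md M)) * F τ v := by
  have hden : ∀ (M : Matrix.SpecialLinearGroup (Fin 2) ℤ) (τ : ℂ), UHP τ → Mc M * τ + Md M ≠ 0 := by
    intro M τ hτ h
    have hdet := M.det_coe
    rw [Matrix.det_fin_two] at hdet
    have him := congrArg Complex.im h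
    have hre := congrArg Complex.re h
    simp only [Mc, Md] at him hre
    simp at him hre
    have h1 : M.1 1 0 = 0 := by
      rcases him with h | h
      · exact_mod_cast h
      · exact absurd h (ne_of_gt hτ)
    rw [h1] at hre hdet
    simp at hre
    rw [hre] at hdet; simp at hdet
  have hdetC : ∀ M : Matrix.SpecialLinearGroup (Fin 2) ℤ, Ma M * Md M - Mb M * Mc M = 1 := by
    intro M
    have hdet := M.det_coe
    rw [Matrix.det_fin_two] at hdet
    simp only [Ma, Mb, Mc, Md]; exact_mod_cast hdet
  have him : ∀ (M : Matrix.SpecialLinearGroup (Fin 2) ℤ) (τ : ℂ), UHP τ →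
      UHP ((Ma M * τ + Mb M) / (Mc M * τ + Md M)) := by
    intro M τ hτ
    have h0 := hden M τ hτ
    have hd := hdetC M
    have hn : 0 < Complex.normSq (Mc M * τ + Md M) := Complex.normSq_pos.2 h0
    have hτ' : 0 < τ.im := hτ
    have : ((Ma M * τ + Mb M) / (Mc M * τ + Md M)).im = τ.im / Complex.normSq (Mc M * τ + Md M) := by
      rw [Complex.div_im]
      have hdr : ((M.1 0 0 : ℤ) : ℝ) * (M.1 1 1 : ℤ) - (M.1 0 1 : ℤ) * (M.1 1 0 : ℤ) = 1 := by
        have hdet := M.det_coe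
        rw [Matrix.det_fin_two] at hdet
        exact_mod_cast hdet
      simp only [Ma, Mb, Mc, Md]
      rw [div_sub_div_same]
      congr 1
      simp
      linear_combination τ.im * hdr
    rw [UHP, this]; positivity
  have key : ∀ M ∈ Subgroup.closure {ModularGroup.S, ModularGroup.T}, ∀ (τ : ℂ) (v : V), UHP τ →
      F ((Ma M * τ + Mb M) / (Mc M * τ + Md M)) ((1 / (Mc M * τ + Md M)) • v) =
      (Mc M * τ + Md M) ^ k * eC (m * Mc M * q v / (Mc M * τ + Md M)) * F τ v := by
    intro M hM
    induction hM using Subgroup.closure_induction with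
    | mem x hx =>
      intro τ v hτ
      rcases hx with rfl | rfl
      · have := hS τ v hτ
        simpa [Ma, Mb, Mc, Md, ModularGroup.S] using this
      · have := hT τ v hτ
        simpa [Ma, Mb, Mc, Md, ModularGroup.T, eC_zero] using this
    | one =>
      intro τ v hτ
      simp [Ma, Mb, Mc, Md, eC_zero]
    | mul x y _ _ hx hy =>
      intro τ v hτ
      have ha : Ma (x * y) = Ma x * Ma y + Mb x * Mc y := by
        simp [Ma, Mb, Mc, Matrix.mul_apply, Fin.sum_univ_two]
      have hb : Mb (x * y) = Ma x * Mb y + Mb x * Md y := by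
        simp [Ma, Mb, Md, Matrix.mul_apply, Fin.sum_univ_two]
      have hc : Mc (x * y) = Mc x * Ma y + Md x * Mc y := by
        simp [Ma, Md, Mc, Matrix.mul_apply, Fin.sum_univ_two]
      have hd : Md (x * y) = Mc x * Mb y + Md x * Md y := by
        simp [Mb, Mc, Md, Matrix.mul_apply, Fin.sum_univ_two]
      have n1 := hden y τ hτ
      have n2 := hden x _ (him y τ hτ)
      have h1 := hx _ ((1 / (Mc y * τ + Md y)) • v) (him y τ hτ)
      rw [hy τ v hτ, smul_smul, hq] at h1
      have e1 : (Mc x * ((Ma y * τ + Mb y) / (Mc y * τ + Md y)) + Md x) * (Mc y * τ + Md y) =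
        Mc (x * y) * τ + Md (x * y) := by
        rw [hc, hd, add_mul, mul_assoc, div_mul_cancel₀ _ n1]; ring
      have e1' : (Ma x * ((Ma y * τ + Mb y) / (Mc y * τ + Md y)) + Mb x) * (Mc y * τ + Md y) =
        Ma (x * y) * τ + Mb (x * y) := by
        rw [ha, hb, add_mul, mul_assoc, div_mul_cancel₀ _ n1]; ring
      have n3 := hden (x * y) τ hτ
      have e2 : (Ma x * ((Ma y * τ + Mb y) / (Mc y * τ + Md y)) + Mb x) /
        (Mc x * ((Ma y * τ + Mb y) / (Mc y * τ + Md y)) + Md x) =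
        (Ma (x * y) * τ + Mb (x * y)) / (Mc (x * y) * τ + Md (x * y)) := by
        rw [div_eq_div_iff n2 n3, ← e1, ← e1']; ring
      rw [e2, one_div_mul_one_div, e1] at h1
      rw [h1, ← e1, mul_pow]
      have e3 : eC (m * Mc (x * y) * q v / ((Mc x * ((Ma y * τ + Mb y) / (Mc y * τ + Md y)) + Md x) * (Mc y * τ + Md y)))
        = eC (m * Mc x * ((1 / (Mc y * τ + Md y)) ^ 2 * q v) / (Mc x * ((Ma y * τ + Mb y) / (Mc y * τ + Md y)) + Md x)) *
          eC (m * Mc y * q v / (Mc y * τ + Md y)) := by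
        rw [← eC_add]
        congr 1
        have hdy := hdetC y
        have n4 : Mc x * (Ma y * τ + Mb y) + Md x * (Mc y * τ + Md y) ≠ 0 := by
          intro h; apply n3; rw [hc, hd]; linear_combination h
        rw [hc]
        set D := Mc y * τ + Md y with hD
        have e4 : Mc x * ((Ma y * τ + Mb y) / D) + Md x = (Mc x * (Ma y * τ + Mb y) + Md x * D) / D := by
          field_simp
        rw [e4]
        field_simp
        rw [hD]
        linear_combination (m * Mc x * q v) * hdy
      rw [e3]; ring
    | inv x _ hx =>
      intro τ v hτ
      have ha : Ma x⁻¹ = Md x := by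
        simp only [Ma, Md, Matrix.SpecialLinearGroup.coe_inv, Matrix.adjugate_fin_two]; simp
      have hb : Mb x⁻¹ = -Mb x := by
        simp only [Mb, Matrix.SpecialLinearGroup.coe_inv, Matrix.adjugate_fin_two]; simp
      have hc : Mc x⁻¹ = -Mc x := by
        simp only [Mc, Matrix.SpecialLinearGroup.coe_inv, Matrix.adjugate_fin_two]; simp
      have hd : Md x⁻¹ = Ma x := by
        simp only [Ma, Md, Matrix.SpecialLinearGroup.coe_inv, Matrix.adjugate_fin_two]; simp
      have n1 := hden x⁻¹ τ hτ
      have hu := him x⁻¹ τ hτ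
      have n2 := hden x _ hu
      have h1 := hx _ ((1 / (Mc x⁻¹ * τ + Md x⁻¹)) • v) hu
      have hdx := hdetC x
      have e1 : (Mc x * ((Ma x⁻¹ * τ + Mb x⁻¹) / (Mc x⁻¹ * τ + Md x⁻¹)) + Md x) * (Mc x⁻¹ * τ + Md x⁻¹) = 1 := by
        rw [add_mul, mul_assoc, div_mul_cancel₀ _ n1, ha, hb, hc, hd]
        linear_combination hdx
      have e2 : (Ma x * ((Ma x⁻¹ * τ + Mb x⁻¹) / (Mc x⁻¹ * τ + Md x⁻¹)) + Mb x) =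
        τ * (Mc x * ((Ma x⁻¹ * τ + Mb x⁻¹) / (Mc x⁻¹ * τ + Md x⁻¹)) + Md x) := by
        apply mul_right_cancel₀ n1
        rw [mul_assoc τ, e1, add_mul, mul_assoc, div_mul_cancel₀ _ n1, ha, hb, hc, hd]
        linear_combination τ * hdx
      rw [e2, mul_div_assoc, div_self n2, mul_one, smul_smul, hq, one_div_mul_one_div, e1] at h1
      simp only [div_one, one_smul] at h1
      rw [h1]
      set J := Mc x * ((Ma x⁻¹ * τ + Mb x⁻¹) / (Mc x⁻¹ * τ + Md x⁻¹)) + Md x with hJ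
      have e5 : (Mc x⁻¹ * τ + Md x⁻¹) ^ k * J ^ k = 1 := by
        rw [← mul_pow, mul_comm, e1, one_pow]
      have e6 : eC (m * Mc x⁻¹ * q v / (Mc x⁻¹ * τ + Md x⁻¹)) *
        eC (m * Mc x * ((1 / (Mc x⁻¹ * τ + Md x⁻¹)) ^ 2 * q v) / J) = 1 := by
        rw [← eC_add]
        refine Eq.trans ?_ eC_zero
        congr 1
        have : J = 1 / (Mc x⁻¹ * τ + Md x⁻¹) := by
          rw [eq_div_iff n1]; exact e1
        rw [this]
        have aux : ∀ D a b : ℂ, D ≠ 0 → m * (-a) * b / D + m * a * ((1 / D) ^ 2 * b) / (1 / D) = 0 := by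
          intro D a b hD; field_simp; ring
        have aux2 := aux _ (Mc x) (q v) n1
        rw [← hc] at aux2
        exact aux2
      linear_combination (-F ((Ma x⁻¹ * τ + Mb x⁻¹) / (Mc x⁻¹ * τ + Md x⁻¹)) ((1 / (Mc x⁻¹ * τ + Md x⁻¹)) • v)) * e5 - ((Mc x⁻¹ * τ + Md x⁻¹) ^ k * J ^ k * F ((Ma x⁻¹ * τ + Mb x⁻¹) / (Mc x⁻¹ * τ + Md x⁻¹)) ((1 / (Mc x⁻¹ * τ + Md x⁻¹)) • v)) * e6
  exact key M (by simp [SpecialLinearGroup.SL2Z_generators]) τ v hτ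


/-! ### asymptotics at the cusp -/

open Filter Topology

/-- the filter of neighbourhoods of the cusp -/
abbrev Iinf : Filter ℂ := Filter.comap Complex.im Filter.atTop

instance : Iinf.NeBot := by
  refine comap_neBot_iff_frequently.mpr (Eventually.frequently ?_)
  exact Eventually.of_forall fun t => ⟨I * t, by simp⟩

lemma eventually_uhp : ∀ᶠ τ in Iinf, UHP τ := by
  have : Tendsto Complex.im Iinf atTop := tendsto_comap
  exact this.eventually (eventually_gt_atTop 0)

lemma eventually_ge (B : ℝ) : ∀ᶠ τ in Iinf, B ≤ τ.im := by
  have : Tendsto Complex.im Iinf atTop := tendsto_comap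
  exact this.eventually (eventually_ge_atTop B)

lemma Iinf_iff {p : ℂ → Prop} : (∀ᶠ τ in Iinf, p τ) ↔ ∃ B : ℝ, ∀ τ : ℂ, B ≤ τ.im → p τ := by
  constructor
  · intro h
    rw [eventually_comap] at h
    obtain ⟨B, hB⟩ := eventually_atTop.1 h
    exact ⟨B, fun τ hτ => hB _ hτ _ rfl⟩
  · rintro ⟨B, hB⟩
    exact (eventually_ge B).mono hB

lemma tendsto_zero_Iinf {f : ℂ → ℂ} :
    Tendsto f Iinf (𝓝 0) ↔ ∀ ε : ℝ, 0 < ε → ∃ B : ℝ, ∀ τ : ℂ, B ≤ τ.im → ‖f τ‖ ≤ ε := by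
  rw [Metric.nhds_basis_closedBall.tendsto_right_iff]
  simp only [mem_closedBall_zero_iff, Iinf_iff]

lemma bdd_Iinf {f : ℂ → ℂ} : f =O[Iinf] (fun _ => (1 : ℂ)) ↔
    ∃ A B : ℝ, ∀ τ : ℂ, B ≤ τ.im → ‖f τ‖ ≤ A := by
  rw [Asymptotics.isBigO_iff]
  simp only [norm_one, mul_one, Iinf_iff]

lemma eC_tendsto_zero {a : ℝ} (ha : 0 < a) : Tendsto (fun τ : ℂ => eC ((a : ℂ) * τ)) Iinf (𝓝 0) := by
  rw [tendsto_zero_iff_norm_tendsto_zero]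
  have h : Tendsto Complex.im Iinf atTop := tendsto_comap
  have : (fun τ : ℂ => ‖eC ((a : ℂ) * τ)‖) = fun τ : ℂ => Real.exp (-(2 * Real.pi * a * τ.im)) := by
    funext τ
    rw [norm_eC]; congr 1; simp; ring
  rw [this]
  refine Real.tendsto_exp_neg_atTop_nhds_zero.comp ?_
  exact h.const_mul_atTop (by positivity)

lemma thT_asymp {χ : ℤ → ℂ} (hχ : ∀ A, ‖χ A‖ ≤ 1) (N : ℕ) (h0 : ∀ A : ℤ, A ^ 2 < N → χ A = 0) (j : ℕ) :
    Tendsto (fun τ => thT χ j τ 0 * eC (-(N / 8 * τ))) Iinf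
      (𝓝 (∑' A : ℤ, if A ^ 2 = N then χ A * (A : ℂ) ^ j else 0)) := by
  have h1 : ∀ τ, thT χ j τ 0 * eC (-(N / 8 * τ)) =
      ∑' A : ℤ, χ A * (A : ℂ) ^ j * eA A τ 0 * eC (-(N / 8 * τ)) := by
    intro τ; rw [thT, tsum_mul_right]
  simp only [h1]
  have hnorm : ∀ (A : ℤ) (τ : ℂ), eA A τ 0 * eC (-(N / 8 * τ)) =
      eC (((((A ^ 2 - N : ℤ) : ℝ) / 8 : ℝ) : ℂ) * τ) := by
    intro A τ
    rw [eA, ← eC_add]; congr 1; push_cast; ring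
  have hsum := (summable_pow_mul_jacobiTheta₂_term_bound 0 (T := 1 / 4) (by norm_num) j).mul_left
    (Real.exp (Real.pi * N / 4))
  refine tendsto_tsum_of_dominated_convergence hsum ?_ ?_
  · intro A
    rcases lt_trichotomy (A ^ 2) (N : ℤ) with h | h | h
    · rw [if_neg h.ne, h0 A h]; simp
    · rw [if_pos h]
      refine tendsto_const_nhds.congr ?_
      intro τ
      rw [mul_assoc _ (eA A τ 0), hnorm, h]; simp [eC_zero]
    · rw [if_neg h.ne']
      have : Tendsto (fun τ => χ A * (A : ℂ) ^ j * eC (((((A ^ 2 - N : ℤ) : ℝ) / 8 : ℝ) : ℂ) * τ)) Iinf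
          (𝓝 (χ A * (A : ℂ) ^ j * 0)) := by
        refine Tendsto.const_mul _ (eC_tendsto_zero ?_)
        have : (0 : ℝ) < ((A ^ 2 - N : ℤ) : ℝ) := by exact_mod_cast sub_pos.2 h
        positivity
      rw [mul_zero] at this
      refine this.congr ?_
      intro τ
      rw [mul_assoc _ (eA A τ 0), hnorm]
  · filter_upwards [eventually_ge 1] with τ hτ
    intro A
    rw [mul_assoc _ (eA A τ 0), hnorm, norm_mul, norm_mul, norm_pow, norm_intCast, norm_eC]
    by_cases h : A ^ 2 < (N : ℤ)
    · rw [h0 A h]; simp; positivity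
    · have hA : (0 : ℝ) ≤ ((A ^ 2 - N : ℤ) : ℝ) := by
        have : 0 ≤ A ^ 2 - N := by omega
        exact_mod_cast this
      have e1 : Real.exp (-2 * Real.pi * (((((A ^ 2 - N : ℤ) : ℝ) / 8 : ℝ) : ℂ) * τ).im) ≤
          Real.exp (Real.pi * N / 4) * Real.exp (-Real.pi * (1 / 4 * A ^ 2 - 2 * 0 * |A|)) := by
        rw [← Real.exp_add]
        apply Real.exp_le_exp.2
        rw [Complex.im_ofReal_mul]
        push_cast at hA ⊢
        have := mul_le_mul_of_nonneg_left hτ (mul_nonneg hA Real.pi_pos.le)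
        nlinarith
      have e2 : ‖χ A‖ * |(A : ℝ)| ^ j ≤ |(A : ℝ)| ^ j :=
        mul_le_of_le_one_left (by positivity) (hχ A)
      calc _ ≤ |(A : ℝ)| ^ j * (Real.exp (Real.pi * N / 4) * Real.exp (-Real.pi * (1 / 4 * A ^ 2 - 2 * 0 * |A|))) :=
            mul_le_mul e2 e1 (by positivity) (by positivity)
        _ = _ := by push_cast; ring

lemma asymp_XY0 (j : ℕ) : Tendsto (fun τ => thT (cI 0) j τ 0) Iinf (𝓝 (0 ^ j)) := by
  have := thT_asymp (χ := cI 0) (cI_bd 0) 0 (fun A h => absurd h (by push_cast; exact not_lt.2 (sq_nonneg A))) j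
  simp only [Nat.cast_zero, zero_div, zero_mul, neg_zero, eC_zero, mul_one] at this
  convert this using 2
  rw [tsum_eq_single 0]
  · simp [cI]
  · intro A hA; rw [if_neg]; simpa using hA

lemma tsum_pm {f : ℤ → ℂ} {a : ℤ} (ha : 0 < a) {N : ℕ} (hN : (N : ℤ) = a ^ 2) :
    (∑' A : ℤ, if A ^ 2 = (N : ℤ) then f A else 0) = f a + f (-a) := by
  rw [tsum_eq_sum (s := {a, -a})]
  · rw [Finset.sum_pair (by omega)]; simp [hN]
  · intro A hA
    rw [if_neg]
    rw [hN, sq_eq_sq_iff_eq_or_eq_neg]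
    simpa using hA

lemma asymp_2 (j : ℕ) : Tendsto (fun τ => thT (cI 2) j τ 0 * eC (-(1 / 2 * τ))) Iinf
    (𝓝 (2 ^ j + (-2) ^ j)) := by
  have := thT_asymp (χ := cI 2) (cI_bd 2) 4 (fun A h => by
    have h1 : A < 2 := by norm_num at h; nlinarith
    have h2 : -2 < A := by norm_num at h; nlinarith
    have : A = -1 ∨ A = 0 ∨ A = 1 := by omega
    rcases this with rfl | rfl | rfl <;> simp [cI]) j
  rw [tsum_pm (a := 2) (by norm_num) (by norm_num)] at this
  have e : ∀ τ : ℂ, ((4 : ℕ) : ℂ) / 8 * τ = 1 / 2 * τ := by intro τ; push_cast; ring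
  simp only [e] at this
  simpa [cI] using this

lemma asymp_Z (j : ℕ) : Tendsto (fun τ => thT cZ j τ 0 * eC (-(1 / 8 * τ))) Iinf
    (𝓝 (1 + (-1) ^ j)) := by
  have := thT_asymp (χ := cZ) cZ_bd 1 (fun A h => by
    have h1 : A < 1 := by norm_num at h; nlinarith
    have h2 : -1 < A := by norm_num at h; nlinarith
    have : A = 0 := by omega
    subst this; simp [cZ]) j
  rw [tsum_pm (a := 1) (by norm_num) (by norm_num)] at this
  simpa [cZ] using this

lemma cX_eq (A : ℤ) : cX A = cI 0 A + cI 2 A := by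
  unfold cX cI; split_ifs <;> first | omega | simp
lemma cY_eq (A : ℤ) : cY A = cI 0 A - cI 2 A := by
  unfold cY cI; split_ifs <;> first | omega | simp
lemma cZ_eq (A : ℤ) : cZ A = cI 1 A + cI 3 A := by
  unfold cZ cI; split_ifs <;> first | omega | simp
lemma cO_eq (A : ℤ) : cO A = cI 1 A - cI 3 A := by
  unfold cO cI; split_ifs <;> first | omega | simp

lemma thX_I (j : ℕ) {τ : ℂ} (hτ : UHP τ) (w : ℂ) : thT cX j τ w = thT (cI 0) j τ w + thT (cI 2) j τ w := by
  refine (((hasSum_thT (cI_bd 0) j hτ w).add (hasSum_thT (cI_bd 2) j hτ w)).congr_fun ?_).tsum_eq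
  intro A; rw [cX_eq]; ring
lemma thY_I (j : ℕ) {τ : ℂ} (hτ : UHP τ) (w : ℂ) : thT cY j τ w = thT (cI 0) j τ w - thT (cI 2) j τ w := by
  refine (((hasSum_thT (cI_bd 0) j hτ w).sub (hasSum_thT (cI_bd 2) j hτ w)).congr_fun ?_).tsum_eq
  intro A; rw [cY_eq]; ring
lemma thZ_I (j : ℕ) {τ : ℂ} (hτ : UHP τ) (w : ℂ) : thT cZ j τ w = thT (cI 1) j τ w + thT (cI 3) j τ w := by
  refine (((hasSum_thT (cI_bd 1) j hτ w).add (hasSum_thT (cI_bd 3) j hτ w)).congr_fun ?_).tsum_eq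
  intro A; rw [cZ_eq]; ring
lemma thO_I (j : ℕ) {τ : ℂ} (hτ : UHP τ) (w : ℂ) : thT cO j τ w = thT (cI 1) j τ w - thT (cI 3) j τ w := by
  refine (((hasSum_thT (cI_bd 1) j hτ w).sub (hasSum_thT (cI_bd 3) j hτ w)).congr_fun ?_).tsum_eq
  intro A; rw [cO_eq]; ring

lemma asymp_X (j : ℕ) : Tendsto (fun τ => thT cX j τ 0) Iinf (𝓝 (0 ^ j)) := by
  have := thT_asymp (χ := cX) cX_bd 0 (fun A h => absurd h (by push_cast; exact not_lt.2 (sq_nonneg A))) j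
  simp only [Nat.cast_zero, zero_div, zero_mul, neg_zero, eC_zero, mul_one] at this
  convert this using 2
  rw [tsum_eq_single 0]
  · simp [cX]
  · intro A hA; rw [if_neg]; simpa using hA
lemma asymp_Y (j : ℕ) : Tendsto (fun τ => thT cY j τ 0) Iinf (𝓝 (0 ^ j)) := by
  have := thT_asymp (χ := cY) cY_bd 0 (fun A h => absurd h (by push_cast; exact not_lt.2 (sq_nonneg A))) j
  simp only [Nat.cast_zero, zero_div, zero_mul, neg_zero, eC_zero, mul_one] at this
  convert this using 2
  rw [tsum_eq_single 0]
  · simp [cY]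
  · intro A hA; rw [if_neg]; simpa using hA

/-! ### cusp forms of weight 12 -/

section
open UpperHalfPlane hiding I
open scoped MatrixGroups ModularForm

lemma cusp12 {f : ℂ → ℂ} (hf : ∀ τ, UHP τ → DifferentiableAt ℂ f τ)
    (hT : ∀ τ, UHP τ → f (τ + 1) = f τ) (hS : ∀ τ, UHP τ → f (-1 / τ) = τ ^ 12 * f τ)
    {L : ℂ} (hL : L ≠ 0) (hlim : Tendsto (fun τ => f τ * eC (-τ)) Iinf (𝓝 L)) {τ : ℂ} (hτ : UHP τ) :
    f τ ≠ 0 := by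
  let F : ℍ → ℂ := fun z => f z
  have hz : IsZeroAtImInfty F := by
    have h1 := hlim.mul (eC_tendsto_zero (a := 1) one_pos)
    have h2 : Tendsto f Iinf (𝓝 0) := by
      rw [mul_zero] at h1
      refine h1.congr fun τ => ?_
      rw [mul_assoc, ← eC_add]; simp [eC_zero]
    exact h2.comp tendsto_coe_atImInfty
  have hFS : F ∣[(12 : ℤ)] ModularGroup.S = F := by
    ext z
    have h1 := hS z z.2
    have h0 : (z : ℂ) ≠ 0 := z.ne_zero
    suffices f (-(↑z)⁻¹) * ((z : ℂ) ^ 12)⁻¹ = f z by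
      rw [ModularForm.SL_slash_apply, UpperHalfPlane.modular_S_smul]
      rw [ModularGroup.denom_S]
      simpa [F]
    rw [show -(z : ℂ)⁻¹ = -1 / z by rw [neg_div, one_div], h1]
    field_simp
  have hFT : F ∣[(12 : ℤ)] ModularGroup.T = F := by
    ext z
    have h1 := hT z z.2
    suffices f (1 + z) = f z by
      rw [ModularForm.SL_slash_apply, modular_T_smul]
      have hd : denom (ModularGroup.T : SL(2, ℤ)) z = 1 := by
        rw [ModularGroup.denom_apply]; simp [ModularGroup.T]
      rw [hd]
      simpa [F]
    rw [add_comm, h1]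
  let G : CuspForm 𝒮ℒ 12 :=
    { toFun := F
      slash_action_eq' := fun A hA => by
        obtain ⟨A, rfl⟩ := hA
        exact SlashInvariantForm.slash_action_generators_SL2Z hFS hFT A
      holo' := by
        rw [UpperHalfPlane.mdifferentiable_iff]
        refine DifferentiableOn.congr (f := f) (fun z hz ↦ (hf z hz).differentiableWithinAt) fun z hz ↦ ?_
        simp [F, ofComplex_apply_of_im_pos hz]
      zero_at_cusps' := fun hc => by
        rw [Subgroup.IsArithmetic.isCusp_iff_isCusp_SL2Z] at hc
        rw [OnePoint.isZeroAt_iff_forall_SL2Z hc]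
        intro γ _
        rw [SlashInvariantForm.slash_action_generators_SL2Z hFS hFT]
        exact hz }
  obtain ⟨c, hc⟩ := CuspForm.exists_smul_discriminant_of_weight_eq_twelve G
  have hval : ∀ z : ℍ, f z = c * ModularForm.discriminant z := by
    intro z
    have := DFunLike.congr_fun hc z
    exact this.symm
  have hc0 : c ≠ 0 := by
    rintro rfl
    apply hL
    refine tendsto_nhds_unique hlim (tendsto_const_nhds.congr' ?_)
    filter_upwards [eventually_uhp] with τ hτ
    have := hval ⟨τ, hτ⟩
    simp at this
    rw [this, zero_mul]
  have := hval ⟨τ, hτ⟩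
  simp only at this
  rw [this]
  exact mul_ne_zero hc0 (ModularForm.discriminant_ne_zero _)

end


/-! ### nonvanishing -/

section nonvan
open Filter Topology

lemma tX_S0 {τ : ℂ} (hτ : UHP τ) : tX (-1 / τ) 0 = rtS τ * tX τ 0 := by
  simpa [eC_zero] using tX_S hτ 0
lemma tY_S0 {τ : ℂ} (hτ : UHP τ) : tY (-1 / τ) 0 = rtS τ * tZ τ 0 := by
  simpa [eC_zero] using tY_S hτ 0
lemma tZ_S0 {τ : ℂ} (hτ : UHP τ) : tZ (-1 / τ) 0 = rtS τ * tY τ 0 := by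
  simpa [eC_zero] using tZ_S hτ 0

/-- product of the three theta constants -/
def xyz (τ : ℂ) : ℂ := tX τ 0 * tY τ 0 * tZ τ 0

lemma xyz_T (τ : ℂ) : xyz (τ + 1) = eC (1 / 8) * xyz τ := by
  unfold xyz tX tY tZ
  rw [tX_T, tY_T, tZ_T]; ring

lemma xyz_S {τ : ℂ} (hτ : UHP τ) : xyz (-1 / τ) = rtS τ ^ 3 * xyz τ := by
  unfold xyz
  rw [tX_S0 hτ, tY_S0 hτ, tZ_S0 hτ]; ring

lemma xyz_diff {τ : ℂ} (hτ : UHP τ) : DifferentiableAt ℂ xyz τ :=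
  ((thT_diff cX_bd 0 0 hτ).mul (thT_diff cY_bd 0 0 hτ)).mul (thT_diff cZ_bd 0 0 hτ)

lemma xyz_lim : Tendsto (fun τ => xyz τ * eC (-(1 / 8 * τ))) Iinf (𝓝 2) := by
  have h := ((asymp_X 0).mul (asymp_Y 0)).mul (asymp_Z 0)
  norm_num at h
  refine h.congr fun τ => ?_
  unfold xyz; ring_nf

lemma z8_4 : eC (1 / 8) ^ 4 = -1 := by
  rw [show (4 : ℕ) = 2 * 2 from rfl, pow_mul, eC_sq8, I_sq]

lemma s_pow (τ : ℂ) (n : ℕ) : rtS τ ^ (2 * n) = (-I * τ) ^ n := by rw [pow_mul, rtS_sq]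

lemma xyz_ne {τ : ℂ} (hτ : UHP τ) : xyz τ ≠ 0 := by
  have := @cusp12 (fun τ => xyz τ ^ 8) (fun τ hτ => (xyz_diff hτ).pow 8)
    (fun τ hτ => by
      rw [xyz_T, mul_pow, show (8 : ℕ) = 4 * 2 from rfl, pow_mul, z8_4]; norm_num)
    (fun τ hτ => by
      rw [xyz_S hτ, mul_pow, ← pow_mul, show 3 * 8 = 2 * 12 from rfl, s_pow, mul_pow,
        neg_pow, show (12 : ℕ) = 4 * 3 from rfl, pow_mul I, I_pow_four]; norm_num)
    (2 ^ 8) (by norm_num) (by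
      refine (xyz_lim.pow 8).congr fun τ => ?_
      rw [mul_pow, ← eC_nat_mul]; congr 2; push_cast; ring) τ hτ
  exact fun h => this (by simp [h])

lemma x_ne {τ : ℂ} (hτ : UHP τ) : tX τ 0 ≠ 0 := fun h => xyz_ne hτ (by simp [xyz, h])
lemma y_ne {τ : ℂ} (hτ : UHP τ) : tY τ 0 ≠ 0 := fun h => xyz_ne hτ (by simp [xyz, h])
lemma z_ne {τ : ℂ} (hτ : UHP τ) : tZ τ 0 ≠ 0 := fun h => xyz_ne hτ (by simp [xyz, h])

/-- the determinant form -/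
def DD (τ u v : ℂ) : ℂ :=
  tX τ 0 * (tY τ u * tZ τ v - tZ τ u * tY τ v) + tY τ 0 * (tZ τ u * tX τ v - tX τ u * tZ τ v)
    + tZ τ 0 * (tX τ u * tY τ v - tY τ u * tX τ v)

/-- determinant of moments -/
def WW (τ : ℂ) : ℂ :=
  thT cX 0 τ 0 * (thT cY 2 τ 0 * thT cZ 4 τ 0 - thT cZ 2 τ 0 * thT cY 4 τ 0)
    + thT cY 0 τ 0 * (thT cZ 2 τ 0 * thT cX 4 τ 0 - thT cX 2 τ 0 * thT cZ 4 τ 0)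
    + thT cZ 0 τ 0 * (thT cX 2 τ 0 * thT cY 4 τ 0 - thT cY 2 τ 0 * thT cX 4 τ 0)

lemma thT_iter {χ : ℤ → ℂ} (hχ : ∀ A, ‖χ A‖ ≤ 1) {τ : ℂ} (hτ : UHP τ) (c : ℂ) (n : ℕ) :
    iteratedDeriv n (fun z => thT χ 0 τ (c * z)) =
      fun z => (2 * Real.pi * I * c) ^ n * thT χ n τ (c * z) := by
  induction n with
  | zero => simp
  | succ n ih =>
    rw [iteratedDeriv_succ, ih]
    funext z
    have h1 : HasDerivAt (fun z => thT χ n τ (c * z)) (2 * Real.pi * I * thT χ (n + 1) τ (c * z) * c) z :=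
      HasDerivAt.comp z (hasDerivAt_thT_w hχ n hτ (c * z)) (by simpa using (hasDerivAt_id z).const_mul c)
    rw [(h1.const_mul _).deriv]; ring

lemma thT_cdiff {χ : ℤ → ℂ} (hχ : ∀ A, ‖χ A‖ ≤ 1) {τ : ℂ} (hτ : UHP τ) (c : ℂ) :
    ContDiff ℂ ⊤ (fun z => thT χ 0 τ (c * z)) := by
  apply Differentiable.contDiff
  intro z
  exact (HasDerivAt.comp z (hasDerivAt_thT_w hχ 0 hτ (c * z)) (by simpa using (hasDerivAt_id z).const_mul c)).differentiableAt

lemma thT_odd {χ : ℤ → ℂ} (he : ∀ A, χ (-A) = χ A) {j : ℕ} (hj : Odd j) (τ : ℂ) : thT χ j τ 0 = 0 := by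
  have h : thT χ j τ 0 = - thT χ j τ 0 := by
    conv_lhs => rw [thT, ← (Equiv.neg ℤ).tsum_eq]
    rw [thT, ← tsum_neg]
    refine tsum_congr fun A => ?_
    simp [he, eA, hj.neg_pow]
  linear_combination h / 2

lemma cX_ev (A : ℤ) : cX (-A) = cX A := by
  unfold cX; split_ifs <;> first | rfl | omega
lemma cY_ev (A : ℤ) : cY (-A) = cY A := by
  unfold cY; split_ifs <;> first | rfl | omega
lemma cZ_ev (A : ℤ) : cZ (-A) = cZ A := by
  unfold cZ; split_ifs <;> first | rfl | omega

lemma prod6 {χ χ' : ℤ → ℂ} (h1 : ∀ A, ‖χ A‖ ≤ 1) (h2 : ∀ A, ‖χ' A‖ ≤ 1) (e1 : ∀ A, χ (-A) = χ A)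
    (e2 : ∀ A, χ' (-A) = χ' A) {τ : ℂ} (hτ : UHP τ) :
    iteratedDeriv 6 (fun z => thT χ 0 τ (1 / 2 * z) * thT χ' 0 τ (I / 2 * z)) 0 =
      (Real.pi * I) ^ 6 * (-(thT χ 0 τ 0 * thT χ' 6 τ 0) + 15 * (thT χ 2 τ 0 * thT χ' 4 τ 0)
        - 15 * (thT χ 4 τ 0 * thT χ' 2 τ 0) + thT χ 6 τ 0 * thT χ' 0 τ 0) := by
  have := iteratedDeriv_mul (n := 6) (x := (0 : ℂ)) ((thT_cdiff h1 hτ (1 / 2)).contDiffAt.of_le le_top)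
    ((thT_cdiff h2 hτ (I / 2)).contDiffAt.of_le le_top)
  rw [show (fun z => thT χ 0 τ (1 / 2 * z) * thT χ' 0 τ (I / 2 * z)) =
    (fun z => thT χ 0 τ (1 / 2 * z)) * (fun z => thT χ' 0 τ (I / 2 * z)) from rfl, this]
  simp only [thT_iter h1 hτ, thT_iter h2 hτ, Finset.sum_range_succ, Finset.sum_range_zero]
  have o1 := thT_odd e1 (j := 1) (by decide) τ
  have o3 := thT_odd e1 (j := 3) (by decide) τ
  have o5 := thT_odd e1 (j := 5) (by decide) τ
  norm_num [Nat.choose, o1, o3, o5]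
  have hI : I ^ 2 = -1 := I_sq
  have hI4 : I ^ 4 = 1 := I_pow_four
  have hI6 : I ^ 6 = -1 := by rw [show (6 : ℕ) = 4 + 2 from rfl, pow_add, hI, hI4]; norm_num
  have hI12 : I ^ 12 = 1 := by rw [show (12 : ℕ) = 4 * 3 from rfl, pow_mul, hI4]; norm_num
  have hI8 : I ^ 8 = 1 := by rw [show (8 : ℕ) = 4 * 2 from rfl, pow_mul, hI4]; norm_num
  have hI10 : I ^ 10 = -1 := by rw [show (10 : ℕ) = 4 * 2 + 2 from rfl, pow_add, pow_mul, hI4, hI]; norm_num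
  ring_nf
  simp only [hI6, hI12, hI8, hI10]
  ring

lemma DD_iter {τ : ℂ} (hτ : UHP τ) :
    iteratedDeriv 6 (fun z => DD τ (1 / 2 * z) (I / 2 * z)) 0 = 30 * (Real.pi * I) ^ 6 * WW τ := by
  have cd : ∀ {χ χ' : ℤ → ℂ} (h1 : ∀ A, ‖χ A‖ ≤ 1) (h2 : ∀ A, ‖χ' A‖ ≤ 1),
      ContDiffAt ℂ (6 : ℕ) (fun z => thT χ 0 τ (1 / 2 * z) * thT χ' 0 τ (I / 2 * z)) 0 := fun h1 h2 =>
    ((thT_cdiff h1 hτ (1 / 2)).mul (thT_cdiff h2 hτ (I / 2))).contDiffAt.of_le le_top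
  have sub : ∀ {χ χ' : ℤ → ℂ} (c : ℂ) (h1 : ∀ A, ‖χ A‖ ≤ 1) (h2 : ∀ A, ‖χ' A‖ ≤ 1) (e1 : ∀ A, χ (-A) = χ A)
    (e2 : ∀ A, χ' (-A) = χ' A), 
      iteratedDeriv 6 (fun z => c * (thT χ 0 τ (1 / 2 * z) * thT χ' 0 τ (I / 2 * z)
        - thT χ' 0 τ (1 / 2 * z) * thT χ 0 τ (I / 2 * z))) 0 =
      c * ((Real.pi * I) ^ 6 * (30 * (thT χ 2 τ 0 * thT χ' 4 τ 0 - thT χ' 2 τ 0 * thT χ 4 τ 0)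
        + 2 * (thT χ 6 τ 0 * thT χ' 0 τ 0 - thT χ 0 τ 0 * thT χ' 6 τ 0))) := by
    intro χ χ' c h1 h2 e1 e2
    rw [iteratedDeriv_const_mul_field, iteratedDeriv_fun_sub (cd h1 h2) (cd h2 h1), prod6 h1 h2 e1 e2 hτ,
      prod6 h2 h1 e2 e1 hτ]
    ring
  unfold DD
  have c3 : ∀ {χ χ' : ℤ → ℂ} (c : ℂ) (h1 : ∀ A, ‖χ A‖ ≤ 1) (h2 : ∀ A, ‖χ' A‖ ≤ 1), ContDiffAt ℂ (6 : ℕ)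
    (fun z => c * (thT χ 0 τ (1 / 2 * z) * thT χ' 0 τ (I / 2 * z)
        - thT χ' 0 τ (1 / 2 * z) * thT χ 0 τ (I / 2 * z))) 0 := fun c h1 h2 =>
    contDiffAt_const.mul ((cd h1 h2).sub (cd h2 h1))
  rw [iteratedDeriv_fun_add ((c3 _ cY_bd cZ_bd).add (c3 _ cZ_bd cX_bd)) (c3 _ cX_bd cY_bd),
    iteratedDeriv_fun_add (c3 _ cY_bd cZ_bd) (c3 _ cZ_bd cX_bd), sub _ cY_bd cZ_bd cY_ev cZ_ev,
    sub _ cZ_bd cX_bd cZ_ev cX_ev, sub _ cX_bd cY_bd cX_ev cY_ev]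
  unfold WW
  ring

lemma DD_S {τ : ℂ} (hτ : UHP τ) (u v : ℂ) :
    DD (-1 / τ) (u / τ) (v / τ) = - (rtS τ ^ 3 * eC (2 * (u ^ 2 + v ^ 2) / τ)) * DD τ u v := by
  unfold DD
  rw [tX_S0 hτ, tY_S0 hτ, tZ_S0 hτ, tX_S hτ, tX_S hτ, tY_S hτ, tY_S hτ, tZ_S hτ, tZ_S hτ,
    show 2 * (u ^ 2 + v ^ 2) / τ = 2 * u ^ 2 / τ + 2 * v ^ 2 / τ by ring, eC_add]
  ring

lemma DD_T (τ u v : ℂ) : DD (τ + 1) u v = - eC (1 / 8) * DD τ u v := by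
  unfold DD tX tY tZ
  simp only [tX_T, tY_T, tZ_T]; ring

lemma WW_T (τ : ℂ) : WW (τ + 1) = - eC (1 / 8) * WW τ := by
  unfold WW
  simp only [tX_T, tY_T, tZ_T]; ring

lemma WW_S {τ : ℂ} (hτ : UHP τ) : WW (-1 / τ) = - rtS τ ^ 3 * τ ^ 6 * WW τ := by
  have hne := uhp_ne_zero hτ
  have h1 : (fun z => DD (-1 / τ) (1 / 2 * (τ⁻¹ * z)) (I / 2 * (τ⁻¹ * z))) =
      fun z => - rtS τ ^ 3 * DD τ (1 / 2 * z) (I / 2 * z) := by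
    funext z
    have := DD_S hτ (1 / 2 * z) (I / 2 * z)
    rw [show (1 / 2 * z) ^ 2 + (I / 2 * z) ^ 2 = 0 by ring_nf; rw [I_sq]; ring] at this
    simp only [mul_zero, zero_div, eC_zero, mul_one] at this
    rw [← this]; congr 1 <;> ring
  have h2 : ContDiff ℂ (6 : ℕ) (fun z => DD (-1 / τ) (1 / 2 * z) (I / 2 * z)) := by
    have hh := uhp_S hτ
    have a := fun c => (thT_cdiff cX_bd hh c).of_le (m := ((6 : ℕ) : WithTop ℕ∞)) le_top
    have b := fun c => (thT_cdiff cY_bd hh c).of_le (m := ((6 : ℕ) : WithTop ℕ∞)) le_top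
    have d := fun c => (thT_cdiff cZ_bd hh c).of_le (m := ((6 : ℕ) : WithTop ℕ∞)) le_top
    unfold DD tX tY tZ
    exact ((contDiff_const.mul (((b _).mul (d _)).sub ((d _).mul (b _)))).add
      (contDiff_const.mul (((d _).mul (a _)).sub ((a _).mul (d _))))).add
      (contDiff_const.mul (((a _).mul (b _)).sub ((b _).mul (a _))))
  have h3 := iteratedDeriv_comp_const_mul h2 τ⁻¹
  have h4 := congrFun h3 0
  rw [h1, iteratedDeriv_const_mul_field, DD_iter hτ] at h4
  simp only [mul_zero] at h4
  rw [DD_iter (uhp_S hτ)] at h4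
  have hpi : (30 * (Real.pi * I) ^ 6 : ℂ) ≠ 0 := by
    have := Real.pi_ne_zero
    simp [this]
  have h5 : (30 * (Real.pi * I) ^ 6 : ℂ) * (- rtS τ ^ 3 * WW τ) = (30 * (Real.pi * I) ^ 6 : ℂ) * (τ⁻¹ ^ 6 * WW (-1 / τ)) := by
    linear_combination h4
  have h6 := mul_left_cancel₀ hpi h5
  rw [inv_pow] at h6
  field_simp at h6 ⊢
  linear_combination -h6

lemma WW_diff {τ : ℂ} (hτ : UHP τ) : DifferentiableAt ℂ WW τ := by
  have a := fun j => thT_diff cX_bd j 0 hτ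
  have b := fun j => thT_diff cY_bd j 0 hτ
  have d := fun j => thT_diff cZ_bd j 0 hτ
  exact (((a _).mul (((b _).mul (d _)).sub ((d _).mul (b _)))).add
      ((b _).mul (((d _).mul (a _)).sub ((a _).mul (d _))))).add
      ((d _).mul (((a _).mul (b _)).sub ((b _).mul (a _))))

lemma WW_lim : Tendsto (fun τ => WW τ * eC (-(5 / 8 * τ))) Iinf (𝓝 96) := by
  have a := fun j => asymp_XY0 j
  have b := fun j => asymp_2 j
  have d := fun j => asymp_Z j
  have := ((((a 0).mul (((b 2).mul (d 4)).sub ((d 2).mul (b 4)))).add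
      ((b 0).mul (((d 2).mul (a 4)).sub ((a 2).mul (d 4))))).add
      ((d 0).mul (((a 2).mul (b 4)).sub ((b 2).mul (a 4))))).const_mul (-2)
  norm_num at this
  refine this.congr' ?_
  filter_upwards [eventually_uhp] with τ hτ
  unfold WW
  rw [thX_I 0 hτ, thX_I 2 hτ, thX_I 4 hτ, thY_I 0 hτ, thY_I 2 hτ, thY_I 4 hτ,
    show -(5 / 8 * τ) = -(1 / 2 * τ) + -(1 / 8 * τ) by ring, eC_add]
  ring

lemma WW_ne {τ : ℂ} (hτ : UHP τ) : WW τ ≠ 0 := by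
  have := @cusp12 (fun τ => WW τ * xyz τ ^ 3) (fun τ hτ => (WW_diff hτ).mul ((xyz_diff hτ).pow 3))
    (fun τ hτ => by
      rw [xyz_T, WW_T]
      linear_combination (-WW τ * xyz τ ^ 3) * z8_4)
    (fun τ hτ => by
      rw [xyz_S hτ, WW_S hτ]
      have h : rtS τ ^ 12 = - τ ^ 6 := by
        rw [show (12 : ℕ) = 2 * 6 from rfl, s_pow, mul_pow,
          neg_pow, show (6 : ℕ) = 4 + 2 from rfl, pow_add I, I_pow_four, I_sq]; norm_num
      linear_combination (-WW τ * xyz τ ^ 3 * τ ^ 6) * h)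
    (96 * 2 ^ 3) (by norm_num) (by
      refine (WW_lim.mul (xyz_lim.pow 3)).congr fun τ => ?_
      rw [mul_pow, ← eC_nat_mul, show -τ = -(5 / 8 * τ) + (3 : ℕ) * (-(1 / 8 * τ)) by push_cast; ring, eC_add]
      ring) τ hτ
  exact fun h => this (by simp [h])

end nonvan


/-! ### the form xi -/

section xi
open Filter Topology

lemma theta0C_eq (τ : ℂ) : theta0C τ = tX (2 * τ) 0 := by
  rw [tX_eq, theta0C, jacobiTheta₂]
  refine tsum_congr fun n => ?_
  rw [eC, jacobiTheta₂_term]; congr 1; ring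

lemma theta1C_eq (τ : ℂ) : theta1C τ = tZ (2 * τ) 0 := by
  rw [tZ_eq, theta1C, jacobiTheta₂, ← tsum_mul_left]
  refine tsum_congr fun n => ?_
  rw [eC, eC, jacobiTheta₂_term, ← Complex.exp_add]; congr 1; ring

lemma uhp_two {τ : ℂ} (hτ : UHP τ) : UHP (2 * τ) := by simpa [UHP] using hτ
lemma uhp_half {τ : ℂ} (hτ : UHP τ) : UHP (τ / 2) := by
  simpa [UHP] using hτ

lemma theta0C_deriv {τ : ℂ} (hτ : UHP τ) : HasDerivAt theta0C (Real.pi * I / 2 * thT cX 2 (2 * τ) 0) τ := by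
  have h2 : HasDerivAt (fun t : ℂ => 2 * t) 2 τ := by simpa using (hasDerivAt_id τ).const_mul (2 : ℂ)
  have h := HasDerivAt.comp (h₂ := fun t => thT cX 0 t 0) (h := fun t => 2 * t) τ (hasDerivAt_thT_tau cX_bd 0 (uhp_two hτ) 0) h2
  rw [show theta0C = (fun t => thT cX 0 t 0) ∘ (fun t => 2 * t) from funext theta0C_eq]
  refine h.congr_deriv ?_
  rw [zero_add]; ring

lemma theta1C_deriv {τ : ℂ} (hτ : UHP τ) : HasDerivAt theta1C (Real.pi * I / 2 * thT cZ 2 (2 * τ) 0) τ := by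
  have h2 : HasDerivAt (fun t : ℂ => 2 * t) 2 τ := by simpa using (hasDerivAt_id τ).const_mul (2 : ℂ)
  have h := HasDerivAt.comp (h₂ := fun t => thT cZ 0 t 0) (h := fun t => 2 * t) τ (hasDerivAt_thT_tau cZ_bd 0 (uhp_two hτ) 0) h2
  rw [show theta1C = (fun t => thT cZ 0 t 0) ∘ (fun t => 2 * t) from funext theta1C_eq]
  refine h.congr_deriv ?_
  rw [zero_add]; ring

lemma xi_eq {τ : ℂ} (hτ : UHP τ) : xiC τ = Real.pi * I / 2 *
    (thT cZ 0 (2 * τ) 0 * thT cX 2 (2 * τ) 0 - thT cX 0 (2 * τ) 0 * thT cZ 2 (2 * τ) 0) := by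
  rw [xiC, (theta0C_deriv hτ).deriv, (theta1C_deriv hτ).deriv, theta0C_eq, theta1C_eq]
  ring

lemma xi_T {τ : ℂ} (hτ : UHP τ) : xiC (τ + 1) = I * xiC τ := by
  rw [xi_eq hτ, xi_eq (uhp_add_one hτ), show 2 * (τ + 1) = 2 * τ + 1 + 1 by ring]
  simp only [tX_T, tY_T, tZ_T]
  linear_combination (Real.pi * I / 2 *
    (thT cZ 0 (2 * τ) 0 * thT cX 2 (2 * τ) 0 - thT cX 0 (2 * τ) 0 * thT cZ 2 (2 * τ) 0)) * eC_sq8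

lemma xi_lim : Tendsto (fun τ => xiC τ * eC (-(1 / 4 * τ))) Iinf (𝓝 (-(Real.pi * I))) := by
  have h2 : Tendsto (fun τ : ℂ => 2 * τ) Iinf Iinf := by
    rw [tendsto_comap_iff]
    have h : Tendsto Complex.im Iinf atTop := tendsto_comap
    refine (h.const_mul_atTop (r := 2) two_pos).congr fun τ => ?_
    simp
  have h := ((((asymp_Z 0).mul (asymp_X 2)).sub ((asymp_X 0).mul (asymp_Z 2))).const_mul
    (Real.pi * I / 2 : ℂ)).comp h2
  norm_num at h
  refine h.congr' ?_
  filter_upwards [eventually_uhp] with τ hτ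
  rw [xi_eq hτ, show -(1 / 4 * τ) = -(1 / 8 * (2 * τ)) by ring]
  simp only [Function.comp]
  norm_num
  ring

lemma tX_half {τ : ℂ} (hτ : UHP τ) : tX (τ / 2) 0 = theta0C τ + theta1C τ := by
  rw [theta0C_eq, theta1C_eq]
  rw [tX, tX, tZ, thT, thT, thT, ← (summable_thT cX_bd 0 (uhp_two hτ) 0).tsum_add
    (summable_thT cZ_bd 0 (uhp_two hτ) 0)]
  have := tX_eq (τ / 2) 0
  rw [tX, thT] at this
  rw [this, jacobiTheta₂]
  refine tsum_congr fun n => ?_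
  rw [eA, eC, jacobiTheta₂_term, ← add_mul, ← add_mul]
  have : cX n + cZ n = 1 := by
    unfold cX cZ; split_ifs <;> first | (exfalso; omega) | norm_num
  rw [this]; simp; congr 1; ring

lemma tY_half {τ : ℂ} (hτ : UHP τ) : tY (τ / 2) 0 = theta0C τ - theta1C τ := by
  rw [theta0C_eq, theta1C_eq]
  rw [tY, tX, tZ, thT, thT, thT, ← (summable_thT cX_bd 0 (uhp_two hτ) 0).tsum_sub
    (summable_thT cZ_bd 0 (uhp_two hτ) 0)]
  have := tY_eq (τ / 2) 0
  rw [tY, thT] at this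
  rw [this, jacobiTheta₂]
  refine tsum_congr fun n => ?_
  rw [eA, eC, jacobiTheta₂_term, ← sub_mul, ← sub_mul]
  have hc : cX n - cZ n = Complex.exp (2 * Real.pi * I * n * (1 / 2)) := by
    rcases Int.emod_two_eq_zero_or_one n with h | h
    · have : n = 2 * (n / 2) := by omega
      have h1 : Complex.exp (2 * Real.pi * I * n * (1 / 2)) = 1 := by
        rw [Complex.exp_eq_one_iff]; exact ⟨n / 2, by rw [this]; push_cast; simp; ring⟩
      rw [h1]; unfold cX cZ; split_ifs <;> first | (exfalso; omega) | norm_num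
    · have : n = 2 * (n / 2) + 1 := by omega
      have h1 : Complex.exp (2 * Real.pi * I * n * (1 / 2)) = -1 := by
        rw [this]; push_cast
        rw [show (2 * Real.pi * I * (2 * ((n / 2 : ℤ) : ℂ) + 1) * (1 / 2) : ℂ) =
          Real.pi * I + (n / 2 : ℤ) * (2 * Real.pi * I) by ring, Complex.exp_periodic.int_mul]
        exact Complex.exp_pi_mul_I
      rw [h1]; unfold cX cZ; split_ifs <;> first | (exfalso; omega) | norm_num
  rw [hc, pow_zero, mul_one, ← Complex.exp_add]; congr 1; ring

lemma theta0C_S {τ : ℂ} (hτ : UHP τ) : theta0C (-1 / τ) = rtS (τ / 2) * (theta0C τ + theta1C τ) := by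
  rw [theta0C_eq (-1 / τ), show 2 * (-1 / τ) = -1 / (τ / 2) by field_simp, tX_S0 (uhp_half hτ), tX_half hτ]
lemma theta1C_S {τ : ℂ} (hτ : UHP τ) : theta1C (-1 / τ) = rtS (τ / 2) * (theta0C τ - theta1C τ) := by
  rw [theta1C_eq (-1 / τ), show 2 * (-1 / τ) = -1 / (τ / 2) by field_simp, tZ_S0 (uhp_half hτ), tY_half hτ]

lemma rtS_diff {τ : ℂ} (hτ : UHP τ) : DifferentiableAt ℂ rtS τ := by
  unfold rtS
  refine DifferentiableAt.cpow_const (by fun_prop) ?_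
  left
  simpa [UHP] using hτ

lemma xi_S {τ : ℂ} (hτ : UHP τ) : xiC (-1 / τ) = I * τ ^ 3 * xiC τ := by
  have hne := uhp_ne_zero hτ
  have hr : HasDerivAt (fun t => rtS (t / 2)) (deriv rtS (τ / 2) * (1 / 2)) τ :=
    HasDerivAt.comp (h₂ := rtS) (h := fun t => t / 2) τ (rtS_diff (uhp_half hτ)).hasDerivAt (by simpa using (hasDerivAt_id τ).div_const 2)
  have hA := (theta0C_deriv hτ).differentiableAt.hasDerivAt
  have hB := (theta1C_deriv hτ).differentiableAt.hasDerivAt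
  have hi : HasDerivAt (fun t : ℂ => -1 / t) (1 / τ ^ 2) τ := by
    have := (hasDerivAt_inv hne).const_mul (-1)
    simpa [div_eq_mul_inv] using this
  have hA' := HasDerivAt.comp τ (theta0C_deriv (uhp_S hτ)).differentiableAt.hasDerivAt hi
  have hB' := HasDerivAt.comp τ (theta1C_deriv (uhp_S hτ)).differentiableAt.hasDerivAt hi
  have ev : ∀ᶠ t in 𝓝 τ, UHP t := isOpen_UHP.mem_nhds hτ
  have e1 := (hr.mul (hA.add hB)).congr_of_eventuallyEq
    (f₁ := theta0C ∘ fun t => -1 / t) (ev.mono fun t ht => theta0C_S ht)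
  have e2 := (hr.mul (hA.sub hB)).congr_of_eventuallyEq
    (f₁ := theta1C ∘ fun t => -1 / t) (ev.mono fun t ht => theta1C_S ht)
  have u1 := hA'.unique e1
  have u2 := hB'.unique e2
  have hs := rtS_sq (τ / 2)
  have v1 : deriv theta0C (-1 / τ) = τ ^ 2 * (deriv theta0C (-1 / τ) * (1 / τ ^ 2)) := by field_simp
  have v2 : deriv theta1C (-1 / τ) = τ ^ 2 * (deriv theta1C (-1 / τ) * (1 / τ ^ 2)) := by field_simp
  rw [xiC, v1, v2, u1, u2, theta0C_S hτ, theta1C_S hτ, xiC]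
  simp only [Pi.add_apply, Pi.sub_apply]
  linear_combination (τ ^ 2 * (-2) * (theta1C τ * deriv theta0C τ - theta0C τ * deriv theta1C τ)) * hs

lemma xi_diff {τ : ℂ} (hτ : UHP τ) : DifferentiableAt ℂ xiC τ := by
  have ev : ∀ᶠ t in 𝓝 τ, UHP t := isOpen_UHP.mem_nhds hτ
  have h : ∀ {χ : ℤ → ℂ} (_ : ∀ A, ‖χ A‖ ≤ 1) (j : ℕ), DifferentiableAt ℂ (fun t => thT χ j (2 * t) 0) τ :=
    fun hχ j => DifferentiableAt.comp (g := fun t => thT _ j t 0) τ (thT_diff hχ j 0 (uhp_two hτ)) (by fun_prop)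
  have := (((h cZ_bd 0).mul (h cX_bd 2)).sub ((h cX_bd 0).mul (h cZ_bd 2))).const_mul (Real.pi * I / 2 : ℂ)
  exact this.congr_of_eventuallyEq (ev.mono fun t ht => xi_eq ht)

lemma xi_ne {τ : ℂ} (hτ : UHP τ) : xiC τ ≠ 0 := by
  have := @cusp12 (fun τ => xiC τ * xyz τ ^ 6) (fun τ hτ => (xi_diff hτ).mul ((xyz_diff hτ).pow 6))
    (fun τ hτ => by
      rw [xyz_T, xi_T hτ]
      have h : I * eC (1 / 8) ^ 6 = 1 := by
        rw [show eC (1 / 8) ^ 6 = (eC (1 / 8) ^ 2) ^ 3 by ring, eC_sq8, ← pow_succ']; exact I_pow_four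
      linear_combination (xiC τ * xyz τ ^ 6) * h)
    (fun τ hτ => by
      rw [xyz_S hτ, xi_S hτ]
      have h : I * rtS τ ^ 18 = τ ^ 9 := by
        rw [show (18 : ℕ) = 2 * 9 from rfl, s_pow, mul_pow, show (-I) ^ 9 = ((-I) ^ 4) ^ 2 * (-I) by ring]
        rw [show (-I) ^ 4 = 1 by rw [neg_pow, I_pow_four]; norm_num]
        linear_combination (-τ ^ 9) * I_mul_I
      linear_combination (xiC τ * xyz τ ^ 6 * τ ^ 3) * h)
    (-(Real.pi * I) * 2 ^ 6) (by simp [Real.pi_ne_zero]) (by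
      refine (xi_lim.mul (xyz_lim.pow 6)).congr fun τ => ?_
      rw [mul_pow, ← eC_nat_mul, show -τ = -(1 / 4 * τ) + (6 : ℕ) * (-(1 / 8 * τ)) by push_cast; ring, eC_add]
      ring) τ hτ
  exact fun h => this (by simp [h])

end xi


/-! ### values at quarter periods -/

section quarter
open Filter Topology

lemma thT_shift {χ χ' : ℤ → ℂ} {c : ℂ} (h : ∀ A : ℤ, χ A * eC (A * c) = χ' A) (τ w : ℂ) :
    thT χ 0 τ (w + c) = thT χ' 0 τ w := by
  unfold thT
  refine tsum_congr fun A => ?_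
  rw [← h A, eA, eA, show (A : ℂ) ^ 2 / 8 * τ + A * (w + c) = A * c + (A ^ 2 / 8 * τ + A * w) by ring, eC_add]
  ring

lemma eC_q (A : ℤ) : eC (A * (1 / 4)) = if A % 4 = 0 then 1 else if A % 4 = 1 then I else if A % 4 = 2 then -1 else -I := by
  have hA : (A : ℂ) * (1 / 4) = ((A % 4 : ℤ) : ℂ) * (1 / 4) + ((A / 4 : ℤ) : ℂ) := by
    have : A = A % 4 + 4 * (A / 4) := by omega
    have h2 : (A : ℂ) = ((A % 4 : ℤ) : ℂ) + 4 * ((A / 4 : ℤ) : ℂ) := by exact_mod_cast this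
    rw [h2]; ring
  rw [hA, eC_add_int]
  have h : A % 4 = 0 ∨ A % 4 = 1 ∨ A % 4 = 2 ∨ A % 4 = 3 := by omega
  have h4 := eC_quarter
  have h2 : ∀ n : ℕ, eC (n * (1 / 4)) = I ^ n := fun n => by rw [eC_nat_mul, eC_quarter]
  rcases h with h | h | h | h <;> rw [h]
  · simpa using h2 0
  · simpa using h2 1
  · have := h2 2; rw [I_sq] at this; simpa using this
  · have := h2 3
    rw [pow_succ, I_sq] at this; simpa using this

lemma tX_q (τ w : ℂ) : tX τ (w + 1 / 4) = tY τ w := by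
  refine thT_shift (fun A => ?_) τ w
  rw [eC_q]; unfold cX cY; split_ifs <;> first | (exfalso; omega) | simp
lemma tY_q (τ w : ℂ) : tY τ (w + 1 / 4) = tX τ w := by
  refine thT_shift (fun A => ?_) τ w
  rw [eC_q]; unfold cX cY; split_ifs <;> first | (exfalso; omega) | simp
lemma tZ_q (τ w : ℂ) : tZ τ (w + 1 / 4) = I * tO τ w := by
  rw [tZ, thT_shift (χ' := fun A => I * cO A)]
  · rw [tO, thT, thT, ← tsum_mul_left]; refine tsum_congr fun A => ?_; ring
  · intro A; rw [eC_q]; unfold cZ cO; split_ifs <;> first | (exfalso; omega) | simp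
lemma tO_q (τ w : ℂ) : tO τ (w + 1 / 4) = I * tZ τ w := by
  rw [tO, thT_shift (χ' := fun A => I * cZ A)]
  · rw [tZ, thT, thT, ← tsum_mul_left]; refine tsum_congr fun A => ?_; ring
  · intro A; rw [eC_q]; unfold cZ cO; split_ifs <;> first | (exfalso; omega) | simp

lemma tO_zero (τ : ℂ) : tO τ 0 = 0 := by
  have := tO_neg τ 0
  rw [neg_zero] at this
  linear_combination this / 2

lemma half_split : (1 / 2 : ℂ) = 0 + 1 / 4 + 1 / 4 := by norm_num
lemma quarter_split : (1 / 4 : ℂ) = 0 + 1 / 4 := by norm_num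
lemma tX_14 (τ : ℂ) : tX τ (1 / 4) = tY τ 0 := by rw [quarter_split, tX_q]
lemma tY_14 (τ : ℂ) : tY τ (1 / 4) = tX τ 0 := by rw [quarter_split, tY_q]
lemma tZ_14 (τ : ℂ) : tZ τ (1 / 4) = 0 := by rw [quarter_split, tZ_q, tO_zero, mul_zero]
lemma tO_14 (τ : ℂ) : tO τ (1 / 4) = I * tZ τ 0 := by rw [quarter_split, tO_q]
lemma tX_12 (τ : ℂ) : tX τ (1 / 2) = tX τ 0 := by rw [half_split, tX_q, tY_q]
lemma tY_12 (τ : ℂ) : tY τ (1 / 2) = tY τ 0 := by rw [half_split, tY_q, tX_q]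
lemma tZ_12 (τ : ℂ) : tZ τ (1 / 2) = - tZ τ 0 := by
  rw [half_split, tZ_q, tO_q, ← mul_assoc, I_mul_I]; ring
lemma tO_12 (τ : ℂ) : tO τ (1 / 2) = 0 := by
  rw [half_split, tO_q, tZ_q, tO_zero]; simp

/-! theta constants for the classes `0` and `2` -/

lemma uhp_four {τ : ℂ} (hτ : UHP τ) : UHP (4 * τ) := by simpa [UHP] using hτ

lemma tI0_zero (τ : ℂ) : tI 0 τ 0 = tX (4 * τ) 0 := by
  rw [tI_tsum, tX_eq, jacobiTheta₂]
  refine tsum_congr fun n => ?_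
  rw [eC, jacobiTheta₂_term]; congr 1; push_cast; ring

lemma tI2_zero (τ : ℂ) : tI 2 τ 0 = tZ (4 * τ) 0 := by
  rw [tI_tsum, tZ_eq, jacobiTheta₂, ← tsum_mul_left]
  refine tsum_congr fun n => ?_
  rw [eC, eC, jacobiTheta₂_term, ← Complex.exp_add]; congr 1; push_cast; ring

lemma t0_ne {τ : ℂ} (hτ : UHP τ) : tI 0 τ 0 ≠ 0 := by rw [tI0_zero]; exact x_ne (uhp_four hτ)
lemma t2_ne {τ : ℂ} (hτ : UHP τ) : tI 2 τ 0 ≠ 0 := by rw [tI2_zero]; exact z_ne (uhp_four hτ)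

lemma tI_13 (τ : ℂ) : tI 3 τ 0 = tI 1 τ 0 := by
  have := tI_neg 1 τ 0
  rw [neg_zero] at this
  rw [this]
  refine thT_congr (fun A => ?_) 0 τ 0
  unfold cI; norm_num
lemma t1_eq {τ : ℂ} (hτ : UHP τ) : tZ τ 0 = 2 * tI 1 τ 0 := by
  have := thZ_I 0 hτ 0
  rw [tZ, this, ← tI, ← tI, tI_13]; ring
lemma t1_ne {τ : ℂ} (hτ : UHP τ) : tI 1 τ 0 ≠ 0 := by
  intro h; apply z_ne hτ; rw [t1_eq hτ, h, mul_zero]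

lemma x_y_sub {τ : ℂ} (hτ : UHP τ) : tX τ 0 - tY τ 0 = 2 * tI 2 τ 0 := by
  rw [tX, tY, thX_I 0 hτ, thY_I 0 hτ]; ring
lemma x_y_add {τ : ℂ} (hτ : UHP τ) : tX τ 0 + tY τ 0 = 2 * tI 0 τ 0 := by
  rw [tX, tY, thX_I 0 hτ, thY_I 0 hτ]; ring

lemma tI_shift (a : ℕ) (τ w : ℂ) : tI a τ (w + 1 / 4) = I ^ a * tI a τ w := by
  rw [tI, thT_shift (χ' := fun A => I ^ a * cI a A)]
  · rw [tI, thT, thT, ← tsum_mul_left]; refine tsum_congr fun A => ?_; ring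
  · intro A
    by_cases h : A % 4 = (a : ℤ) % 4
    · have h1 : cI a A = 1 := by simp [cI, h]
      have h2 : eC (A * (1 / 4)) = eC (a * (1 / 4)) := by
        have := eC_q a
        rw [← h, ← eC_q A] at this
        rw [← this]; norm_num
      rw [h1, h2, eC_nat_mul, eC_quarter]; ring
    · simp [cI, h]

lemma tI_li {τ : ℂ} (hτ : UHP τ) {c : ℕ → ℂ}
    (h : ∀ w, ∑ a ∈ Finset.range 4, c a * tI a τ w = 0) : c 0 = 0 ∧ c 1 = 0 ∧ c 2 = 0 ∧ c 3 = 0 := by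
  have h0 := h 0
  have h1 := h (0 + 1 / 4)
  have h2 := h (0 + 1 / 4 + 1 / 4)
  have h3 := h (0 + 1 / 4 + 1 / 4 + 1 / 4)
  simp only [tI_shift] at h0 h1 h2 h3
  simp only [Finset.sum_range_succ, Finset.sum_range_zero, I_sq, show I ^ 3 = -I from I_pow_three] at h0 h1 h2 h3
  norm_num at h0 h1 h2 h3
  have hI : I * I = -1 := I_mul_I
  have n0 := t0_ne hτ
  have n1 := t1_ne hτ
  have n2 := t2_ne hτ
  have n3 : tI 3 τ 0 ≠ 0 := by rw [tI_13]; exact n1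
  have h2' : c 0 * tI 0 τ 0 - c 1 * tI 1 τ 0 + c 2 * tI 2 τ 0 - c 3 * tI 3 τ 0 = 0 := by
    linear_combination h2 - hI * (c 1 * tI 1 τ 0 + c 3 * tI 3 τ 0)
  have h3' : c 0 * tI 0 τ 0 - I * (c 1 * tI 1 τ 0) - c 2 * tI 2 τ 0 + I * (c 3 * tI 3 τ 0) = 0 := by
    linear_combination h3 - hI * I * (c 1 * tI 1 τ 0 - c 3 * tI 3 τ 0)
  have k1 : c 0 * tI 0 τ 0 = 0 := by linear_combination (h0 + h1 + h2' + h3') / 4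
  have k2 : c 2 * tI 2 τ 0 = 0 := by linear_combination (h0 - h1 + h2' - h3') / 4
  have k3 : c 1 * tI 1 τ 0 = 0 := by
    linear_combination (h0 - I * h1 - h2' + I * h3') / 4 + hI * (c 1 * tI 1 τ 0 - c 3 * tI 3 τ 0) / 2
  have k4 : c 3 * tI 3 τ 0 = 0 := by linear_combination h0 - k1 - k2 - k3
  exact ⟨(mul_eq_zero.1 k1).resolve_right n0, (mul_eq_zero.1 k3).resolve_right n1,
    (mul_eq_zero.1 k2).resolve_right n2, (mul_eq_zero.1 k4).resolve_right n3⟩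

end quarter


/-! ### q-expansions -/

section
open Filter Topology Asymptotics

lemma qexp {f : ℂ → ℂ} (hol : ∀ τ, UHP τ → DifferentiableAt ℂ f τ)
    (hT : ∀ τ, UHP τ → f (τ + 1) = f τ) (hb : f =O[Iinf] (fun _ => (1 : ℂ))) :
    ∃ d : ℕ → ℂ, Tendsto f Iinf (𝓝 (d 0)) ∧
      ((fun τ => f τ - d 0) =O[Iinf] fun τ => eC τ) ∧
      ∀ τ, UHP τ → HasSum (fun n : ℕ => d n * eC (n * τ)) (f τ) := by
  classical
  set F : ℂ → ℂ := fun τ => if UHP τ then f τ else 0 with hF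
  have hFf : ∀ τ, UHP τ → F τ = f τ := fun τ h => by simp [hF, h]
  have hev : F =ᶠ[Iinf] f := eventually_uhp.mono hFf
  have hper : Function.Periodic F ((1 : ℝ) : ℂ) := by
    intro τ
    by_cases h : UHP τ
    · have h' : UHP (τ + 1) := uhp_add_one h
      simp [hF, h, h', hT τ h]
    · have h' : ¬ UHP (τ + 1) := by simpa [UHP] using h
      simp [hF, h, h']
  have hd : ∀ τ, UHP τ → DifferentiableAt ℂ F τ := by
    intro τ h
    refine (hol τ h).congr_of_eventuallyEq ?_
    filter_upwards [isOpen_UHP.mem_nhds h] with t ht using hFf t ht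
  have hbF : Filter.BoundedAtFilter Iinf F := by
    show F =O[Iinf] (1 : ℂ → ℝ)
    refine (hb.congr' hev.symm (EventuallyEq.refl _ _)).trans ?_
    exact isBigO_of_le _ (by simp)
  have hol' : ∀ᶠ z in Iinf, DifferentiableAt ℂ F z := eventually_uhp.mono hd
  have hone : (0:ℝ) < 1 := one_pos
  set C := Function.Periodic.cuspFunction 1 F
  have hC : DifferentiableOn ℂ C (Metric.ball 0 1) := by
    intro q hq
    by_cases h0 : q = 0
    · rw [h0]
      exact (Function.Periodic.differentiableAt_cuspFunction_zero hone hper hol' hbF).differentiableWithinAt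
    · have : DifferentiableAt ℂ C (Function.Periodic.qParam 1 (Function.Periodic.invQParam 1 q)) := by
        apply Function.Periodic.differentiableAt_cuspFunction one_ne_zero hper
        apply hd
        show 0 < Complex.im _
        rw [Function.Periodic.im_invQParam]
        have : Real.log ‖q‖ < 0 := Real.log_neg (norm_pos_iff.2 h0) (by simpa using hq)
        have hpi := Real.pi_pos
        have h1 : (-1 : ℝ) / (2 * Real.pi) < 0 := div_neg_of_neg_of_pos (by norm_num) (by positivity)
        exact mul_pos_of_neg_of_neg h1 this
      rw [Function.Periodic.qParam_right_inv one_ne_zero h0] at this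
      exact this.differentiableWithinAt
  have hq : ∀ τ, Function.Periodic.qParam 1 τ = eC τ := by
    intro τ; simp [Function.Periodic.qParam, eC]
  refine ⟨fun n => (n.factorial : ℂ)⁻¹ * iteratedDeriv n C 0, ?_, ?_, ?_⟩
  · have := Function.Periodic.tendsto_at_I_inf hone hper hol' hbF
    simpa using this.congr' hev
  · have := Function.Periodic.exp_decay_sub_of_bounded_at_inf hone hper hol' hbF
    simp only [Nat.factorial_zero, Nat.cast_one, inv_one, one_mul, iteratedDeriv_zero]
    refine ((this.congr' (hev.sub (EventuallyEq.refl _ _)) (EventuallyEq.refl _ _))).trans ?_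
    refine isBigO_of_le _ fun τ => ?_
    rw [norm_eC]; simp
  · intro τ h
    have hlt : eC τ ∈ Metric.ball (0:ℂ) 1 := by
      rw [mem_ball_zero_iff, norm_eC, Real.exp_lt_one_iff]
      have : 0 < τ.im := h
      have := mul_pos Real.pi_pos this
      nlinarith
    have := Complex.hasSum_taylorSeries_on_ball hC hlt
    have hv : C (eC τ) = f τ := by
      rw [← hq]
      exact (Function.Periodic.eq_cuspFunction one_ne_zero hper τ).trans (hFf τ h)
    rw [hv] at this
    have e : (fun n : ℕ => (n.factorial : ℂ)⁻¹ * iteratedDeriv n C 0 * eC (n * τ)) =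
        fun n : ℕ => (n.factorial : ℂ)⁻¹ • (eC τ - 0) ^ n • iteratedDeriv n C 0 := by
      funext n
      rw [eC_nat_mul]; simp only [smul_eq_mul, sub_zero]; ring
    show HasSum (fun n : ℕ => (n.factorial : ℂ)⁻¹ * iteratedDeriv n C 0 * eC (n * τ)) (f τ)
    rw [e]; exact this

/-- existence of a Fourier expansion of Jacobi type -/
def FE {L Z : Type*} (Q : L → ℕ) (E : L → Z → ℂ) (φ : ℂ → Z → ℂ) : Prop :=
  ∃ c : ℕ → L → ℂ, (∀ n l, 8 * n < Q l → c n l = 0) ∧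
    ∀ τ z, UHP τ → HasSum (fun p : ℕ × L => c p.1 p.2 * (eC (p.1 * τ) * E p.2 z)) (φ τ z)

lemma FE.add {L Z : Type*} {Q : L → ℕ} {E : L → Z → ℂ} {φ ψ : ℂ → Z → ℂ} (h1 : FE Q E φ)
    (h2 : FE Q E ψ) : FE Q E (fun τ z => φ τ z + ψ τ z) := by
  obtain ⟨c, hc, hs⟩ := h1
  obtain ⟨d, hd, ht⟩ := h2
  refine ⟨fun n l => c n l + d n l, fun n l h => by simp [hc n l h, hd n l h], fun τ z hτ => ?_⟩
  convert (hs τ z hτ).add (ht τ z hτ) using 2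
  ring

lemma FE.congr {L Z : Type*} {Q : L → ℕ} {E : L → Z → ℂ} {φ ψ : ℂ → Z → ℂ} (h1 : FE Q E φ)
    (h : ∀ τ z, UHP τ → φ τ z = ψ τ z) : FE Q E ψ := by
  obtain ⟨c, hc, hs⟩ := h1
  exact ⟨c, hc, fun τ z hτ => h τ z hτ ▸ hs τ z hτ⟩

lemma FE_term {L Z : Type*} {Q : L → ℕ} {E : L → Z → ℂ} (N : ℕ) (hN : N < 8) {h : ℂ → ℂ}
    (hol : ∀ τ, UHP τ → DifferentiableAt ℂ h τ)
    (hT : ∀ τ, UHP τ → h (τ + 1) = eC (-(N / 8)) * h τ) (hb : h =O[Iinf] (fun _ => (1 : ℂ)))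
    (χ : L → ℂ) (hχ : ∀ l, χ l ≠ 0 → Q l % 8 = N) (Θ : ℂ → Z → ℂ)
    (hΘ : ∀ τ z, UHP τ → HasSum (fun l => χ l * (eC (Q l / 8 * τ) * E l z)) (Θ τ z)) :
    FE Q E (fun τ z => h τ * Θ τ z) := by
  classical
  obtain ⟨d, hd0, -, hd⟩ := qexp (f := fun τ => h τ * eC (N / 8 * τ))
    (fun τ hτ => (hol τ hτ).mul (eC_diff (by fun_prop)))
    (fun τ hτ => by
      rw [hT τ hτ, mul_add, mul_one, eC_add, eC_neg]
      field_simp [eC_ne_zero])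
    (by
      have h1 : (fun τ => eC ((N : ℂ) / 8 * τ)) =O[Iinf] (fun _ => (1 : ℂ)) := by
        rw [bdd_Iinf]
        refine ⟨1, 0, fun τ hτ => ?_⟩
        rw [norm_eC, Real.exp_le_one_iff]
        have e : ((N : ℂ) / 8 * τ).im = N / 8 * τ.im := by
          have : ((N : ℂ) / 8) = ((N / 8 : ℝ) : ℂ) := by push_cast; rfl
          rw [this, Complex.im_ofReal_mul]
        rw [e]
        have : 0 ≤ Real.pi * (N / 8 * τ.im) := by
          have := Real.pi_pos
          positivity
        linarith
      simpa using hb.mul h1)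
  have hd00 : 0 < N → d 0 = 0 := by
    intro hN0
    refine tendsto_nhds_unique hd0 ?_
    have : Tendsto (fun τ => eC ((N : ℂ) / 8 * τ)) Iinf (𝓝 0) := by
      have := eC_tendsto_zero (a := N / 8) (by positivity)
      push_cast at this; exact this
    have h2 := hb.mul (isBigO_refl (fun τ => eC ((N : ℂ) / 8 * τ)) Iinf)
    exact h2.trans_tendsto (by simpa using this)
  refine ⟨fun n l => if Q l / 8 ≤ n then d (n - Q l / 8) * χ l else 0, ?_, ?_⟩
  · intro n l hn
    by_cases hc : χ l = 0
    · simp [hc]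
    have h1 := hχ l hc
    show (if Q l / 8 ≤ n then d (n - Q l / 8) * χ l else 0) = 0
    split_ifs with hle
    · have h2 : n - Q l / 8 = 0 := by omega
      rw [h2, hd00 (by omega), zero_mul]
    · rfl
  · intro τ z hτ
    have hs1 := hd τ hτ
    have hs2 := hΘ τ z hτ
    have hsm : Summable fun p : ℕ × L => (d p.1 * eC (p.1 * τ)) *
        (χ p.2 * (eC (Q p.2 / 8 * τ) * E p.2 z)) :=
      summable_mul_of_summable_norm (f := fun n : ℕ => d n * eC (n * τ))
        (g := fun l => χ l * (eC (Q l / 8 * τ) * E l z)) hs1.summable.norm hs2.summable.norm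
    have hs := hs1.mul hs2 hsm
    have hinj : Function.Injective (fun p : ℕ × L => (p.1 + Q p.2 / 8, p.2)) := by
      rintro ⟨a, l⟩ ⟨b, m⟩ h
      simp only [Prod.mk.injEq] at h
      obtain ⟨h1, rfl⟩ := h
      simp at h1
      simp [h1]
    beta_reduce
    rw [← hinj.hasSum_iff]
    · have e : h τ * Θ τ z = (h τ * eC (N / 8 * τ) * Θ τ z) * eC (-(N / 8 * τ)) := by
        rw [eC_neg]; field_simp [eC_ne_zero]
      beta_reduce
      rw [e]
      have hs3 := hs.mul_right (eC (-(N / 8 * τ)))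
      refine Eq.mp (congrArg (fun F => HasSum F _) (funext fun p => ?_)) hs3
      symm
      obtain ⟨n, l⟩ := p
      simp only [Function.comp_apply, le_add_iff_nonneg_left, zero_le, if_true, Nat.add_sub_cancel]
      by_cases hc : χ l = 0
      · simp [hc]
      have h1 := hχ l hc
      have h2 : (Q l : ℂ) = 8 * ((Q l / 8 : ℕ) : ℂ) + N := by
        have : Q l = 8 * (Q l / 8) + N := by omega
        exact_mod_cast this
      rw [show d n * eC (n * τ) * (χ l * (eC (Q l / 8 * τ) * E l z)) * eC (-(N / 8 * τ)) =
        d n * χ l * ((eC (n * τ) * eC (Q l / 8 * τ) * eC (-(N / 8 * τ))) * E l z) by ring,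
        ← eC_add, ← eC_add, h2]
      congr 4
      push_cast; ring
    · rintro ⟨n, l⟩ hn
      have : ¬ Q l / 8 ≤ n := by
        intro hle
        exact hn ⟨(n - Q l / 8, l), by simp [hle]⟩
      simp [this]
end


/-! ### construction of Jacobi forms -/

section
open Filter Topology Asymptotics

lemma cI_ne {a A : ℤ} (h : cI a A ≠ 0) : A % 4 = a % 4 := by
  unfold cI at h; grind
lemma cZ_ne {A : ℤ} (h : cZ A ≠ 0) : A % 2 = 1 := by
  unfold cZ at h
  split_ifs at h with h1 h2
  · omega
  · omega
  · simp at h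
lemma cO_ne {A : ℤ} (h : cO A ≠ 0) : A % 2 = 1 := by
  unfold cO at h
  split_ifs at h with h1 h2
  · omega
  · omega
  · simp at h

lemma sq_mod0 {A : ℤ} (h : A % 4 = 0) : A ^ 2 % 8 = 0 := by
  obtain ⟨b, rfl⟩ : ∃ b, A = 4 * b := ⟨A / 4, by omega⟩
  ring_nf; omega
lemma sq_mod2 {A : ℤ} (h : A % 4 = 2) : A ^ 2 % 8 = 4 := by
  obtain ⟨b, rfl⟩ : ∃ b, A = 4 * b + 2 := ⟨A / 4, by omega⟩
  ring_nf; omega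
lemma sq_mod1 {A : ℤ} (h : A % 2 = 1) : A ^ 2 % 8 = 1 := by
  rcases (by omega : A % 4 = 1 ∨ A % 4 = 3) with h | h
  · obtain ⟨b, rfl⟩ : ∃ b, A = 4 * b + 1 := ⟨A / 4, by omega⟩
    ring_nf; omega
  · obtain ⟨b, rfl⟩ : ∃ b, A = 4 * b + 3 := ⟨A / 4, by omega⟩
    ring_nf; omega

/-- exponents for Jacobi forms -/
def QJ (A : ℤ) : ℕ := (A ^ 2).toNat
def EJ (A : ℤ) (z : ℂ) : ℂ := eC (A * z)
def QH (A : ℤ × ℤ) : ℕ := (A.1 ^ 2 + A.2 ^ 2).toNat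
def EH (A : ℤ × ℤ) (z : ℂ × ℂ) : ℂ := eC (A.1 * z.1 + A.2 * z.2)

lemma QJ_int (A : ℤ) : (QJ A : ℤ) = A ^ 2 := Int.toNat_of_nonneg (by positivity)
lemma QH_int (A : ℤ × ℤ) : (QH A : ℤ) = A.1 ^ 2 + A.2 ^ 2 := Int.toNat_of_nonneg (by positivity)
lemma QJ_c (A : ℤ) : (QJ A : ℂ) = (A : ℂ) ^ 2 := by exact_mod_cast congrArg (Int.cast (R := ℂ)) (QJ_int A)
lemma QH_c (A : ℤ × ℤ) : (QH A : ℂ) = (A.1 : ℂ) ^ 2 + (A.2 : ℂ) ^ 2 := by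
  exact_mod_cast congrArg (Int.cast (R := ℂ)) (QH_int A)

lemma FEJ_term (N : ℕ) (hN : N < 8) {h : ℂ → ℂ}
    (hol : ∀ τ, UHP τ → DifferentiableAt ℂ h τ)
    (hT : ∀ τ, UHP τ → h (τ + 1) = eC (-(N / 8)) * h τ) (hb : h =O[Iinf] (fun _ => (1 : ℂ)))
    {χ : ℤ → ℂ} (hχ : ∀ A, ‖χ A‖ ≤ 1) (hm : ∀ A, χ A ≠ 0 → A ^ 2 % 8 = N) :
    FE QJ EJ (fun τ z => h τ * thT χ 0 τ z) := by
  refine FE_term N hN hol hT hb χ (fun A hA => ?_) (fun τ z => thT χ 0 τ z) fun τ z hτ => ?_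
  · have := hm A hA
    have h2 := QJ_int A
    omega
  · refine (hasSum_thT hχ 0 hτ z).congr_fun fun A => ?_
    rw [EJ, eA, QJ_c, ← eC_add]; ring

lemma hasSum_mul' {ι κ : Type*} {f : ι → ℂ} {g : κ → ℂ} {a b : ℂ} (hf : HasSum f a)
    (hg : HasSum g b) : HasSum (fun p : ι × κ => f p.1 * g p.2) (a * b) := by
  have h := summable_mul_of_summable_norm hf.summable.norm hg.summable.norm
  exact hf.mul hg h

lemma FEH_term (N : ℕ) (hN : N < 8) {h : ℂ → ℂ}
    (hol : ∀ τ, UHP τ → DifferentiableAt ℂ h τ)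
    (hT : ∀ τ, UHP τ → h (τ + 1) = eC (-(N / 8)) * h τ) (hb : h =O[Iinf] (fun _ => (1 : ℂ)))
    {χ χ' : ℤ → ℂ} (hχ : ∀ A, ‖χ A‖ ≤ 1) (hχ' : ∀ A, ‖χ' A‖ ≤ 1)
    (hm : ∀ A B, χ A ≠ 0 → χ' B ≠ 0 → (A ^ 2 + B ^ 2) % 8 = N) :
    FE QH EH (fun τ z => h τ * (thT χ 0 τ z.1 * thT χ' 0 τ z.2)) := by
  have c1 : ∀ A : ℤ × ℤ, χ A.1 * χ' A.2 ≠ 0 → QH A % 8 = N := by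
    intro A hA
    have := hm A.1 A.2 (left_ne_zero_of_mul hA) (right_ne_zero_of_mul hA)
    have h2 := QH_int A
    omega
  have c2 : ∀ (τ : ℂ) (z : ℂ × ℂ), UHP τ → HasSum (fun A : ℤ × ℤ => χ A.1 * χ' A.2 *
      (eC (QH A / 8 * τ) * EH A z)) (thT χ 0 τ z.1 * thT χ' 0 τ z.2) := by
    intro τ z hτ
    have h1 := hasSum_thT hχ 0 hτ z.1
    have h2 := hasSum_thT hχ' 0 hτ z.2
    refine (hasSum_mul' h1 h2).congr_fun fun A => ?_
    have e : eC ((A.1 : ℂ) ^ 2 / 8 * τ + A.1 * z.1) * eC ((A.2 : ℂ) ^ 2 / 8 * τ + A.2 * z.2) =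
        eC (((A.1 : ℂ) ^ 2 + (A.2 : ℂ) ^ 2) / 8 * τ) * eC (A.1 * z.1 + A.2 * z.2) := by
      rw [← eC_add, ← eC_add]; ring_nf
    rw [EH, eA, eA, QH_c, ← e]; ring
  exact FE_term N hN hol hT hb (fun A : ℤ × ℤ => χ A.1 * χ' A.2) c1
    (fun (τ : ℂ) (z : ℂ × ℂ) => thT χ 0 τ z.1 * thT χ' 0 τ z.2) c2

lemma eC_n1 : eC (-((1 : ℕ) / 8)) * eC (1 / 8) = 1 := by
  rw [← eC_add]; simp [eC_zero]
lemma eC_n4 : eC (-((4 : ℕ) / 8)) = -1 := by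
  have : (-((4 : ℕ) / 8) : ℂ) = -(1 / 2) := by push_cast; ring
  rw [this, eC_neg, eC_half]; norm_num
lemma eC_n2 : eC (-((2 : ℕ) / 8)) = -I := by
  have : (-((2 : ℕ) / 8) : ℂ) = -(1 / 4) := by push_cast; ring
  rw [this, eC_neg, eC_quarter]; simp
lemma eC_n5 : eC (-((5 : ℕ) / 8)) = -eC (-((1 : ℕ) / 8)) := by
  have : (-((5 : ℕ) / 8) : ℂ) = -((4 : ℕ) / 8) + -((1 : ℕ) / 8) := by push_cast; ring
  rw [this, eC_add, eC_n4]; ring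

structure GData (k : ℕ) (Gx Gy Gz : ℂ → ℂ) : Prop where
  hx : ∀ τ, UHP τ → DifferentiableAt ℂ Gx τ
  hy : ∀ τ, UHP τ → DifferentiableAt ℂ Gy τ
  hz : ∀ τ, UHP τ → DifferentiableAt ℂ Gz τ
  Tx : ∀ τ, UHP τ → Gx (τ + 1) = Gy τ
  Ty : ∀ τ, UHP τ → Gy (τ + 1) = Gx τ
  Tz : ∀ τ, UHP τ → eC (1 / 8) * Gz (τ + 1) = Gz τ
  Sx : ∀ τ, UHP τ → rtS τ * Gx (-1 / τ) = τ ^ k * Gx τ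
  Sy : ∀ τ, UHP τ → rtS τ * Gy (-1 / τ) = τ ^ k * Gz τ
  Sz : ∀ τ, UHP τ → rtS τ * Gz (-1 / τ) = τ ^ k * Gy τ
  bx : Gx =O[Iinf] (fun _ => (1 : ℂ))
  bY : Gy =O[Iinf] (fun _ => (1 : ℂ))
  bz : Gz =O[Iinf] (fun _ => (1 : ℂ))

lemma mkJF {k : ℕ} {Gx Gy Gz : ℂ → ℂ} (G : GData k Gx Gy Gz) :
    IsJF k 2 (fun τ z => Gx τ * tX τ z + Gy τ * tY τ z + Gz τ * tZ τ z) where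
  holo := by
    intro p hp
    have hp' : UHP p.1 := hp
    refine DifferentiableAt.differentiableWithinAt ?_
    have h1 : DifferentiableAt ℂ (fun p : ℂ × ℂ => p.1) p := differentiableAt_fst
    have h2 : DifferentiableAt ℂ (fun p : ℂ × ℂ => p.2) p := differentiableAt_snd
    exact ((((G.hx _ hp').comp p h1).mul (tX_diff h2 h1 hp')).add
      (((G.hy _ hp').comp p h1).mul (tY_diff h2 h1 hp'))).add
      (((G.hz _ hp').comp p h1).mul (tZ_diff h2 h1 hp'))
  transf := by
    intro M τ z hτ
    have := slash_gen (fun v : ℂ => v ^ 2) (fun a v => by simp [mul_pow]) k 2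
      (fun τ z => Gx τ * tX τ z + Gy τ * tY τ z + Gz τ * tZ τ z) ?_ ?_ M τ z hτ
    · simpa [smul_eq_mul, div_eq_inv_mul, mul_assoc] using this
    · intro τ v hτ
      have e : Gz (τ + 1) * (eC (1 / 8) * tZ τ v) = Gz τ * tZ τ v := by rw [← G.Tz τ hτ]; ring
      simp only [tX, tY, tZ, tX_T, tY_T, tZ_T, G.Tx τ hτ, G.Ty τ hτ] at e ⊢
      rw [e]; ring
    · intro τ v hτ
      simp only [smul_eq_mul]
      rw [show (1 / τ * v) = v / τ by ring, tX_S hτ, tY_S hτ, tZ_S hτ]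
      linear_combination (eC (2 * v ^ 2 / τ) * tX τ v) * G.Sx τ hτ +
        (eC (2 * v ^ 2 / τ) * tZ τ v) * G.Sy τ hτ + (eC (2 * v ^ 2 / τ) * tY τ v) * G.Sz τ hτ
  ellip := by
    intro p q τ z hτ
    simp only [tX, tY, tZ]
    rw [thT_ellip cX_per, thT_ellip cY_per, thT_ellip cZ_per]
    have : (-(2 * (p : ℂ) ^ 2 * τ + 4 * p * z)) = -((2 : ℕ) : ℂ) * (p ^ 2 * τ + 2 * p * z) := by
      push_cast; ring
    rw [this]; ring
  fourier := by
    have h1 : FE QJ EJ (fun τ z => (Gx τ + Gy τ) * thT (cI 0) 0 τ z) := by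
      refine FEJ_term 0 (by norm_num) (h := fun τ => Gx τ + Gy τ) (fun τ hτ => (G.hx τ hτ).add (G.hy τ hτ)) (fun τ hτ => ?_)
        (G.bx.add G.bY) (cI_bd 0) (fun A hA => sq_mod0 (cI_ne hA))
      rw [G.Tx τ hτ, G.Ty τ hτ]; simp [eC_zero]; ring
    have h2 : FE QJ EJ (fun τ z => (Gx τ - Gy τ) * thT (cI 2) 0 τ z) := by
      refine FEJ_term 4 (by norm_num) (h := fun τ => Gx τ - Gy τ) (fun τ hτ => (G.hx τ hτ).sub (G.hy τ hτ)) (fun τ hτ => ?_)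
        (G.bx.sub G.bY) (cI_bd 2) (fun A hA => sq_mod2 (cI_ne hA))
      rw [G.Tx τ hτ, G.Ty τ hτ, eC_n4]; ring
    have h3 : FE QJ EJ (fun τ z => Gz τ * thT cZ 0 τ z) := by
      refine FEJ_term 1 (by norm_num) (fun τ hτ => (G.hz τ hτ)) (fun τ hτ => ?_)
        G.bz cZ_bd (fun A hA => sq_mod1 (cZ_ne hA))
      rw [← G.Tz τ hτ]; linear_combination (-Gz (τ + 1)) * eC_n1
    obtain ⟨c, hc, hs⟩ := (h1.add h2).add h3
    refine ⟨c, fun n r hn => hc n r ?_, fun τ z hτ => ?_⟩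
    · have := QJ_int r
      push_cast at hn
      omega
    · have e : Gx τ * tX τ z + Gy τ * tY τ z + Gz τ * tZ τ z =
        (Gx τ + Gy τ) * thT (cI 0) 0 τ z + (Gx τ - Gy τ) * thT (cI 2) 0 τ z + Gz τ * thT cZ 0 τ z := by
        simp only [tX, tY]
        rw [thX_I 0 hτ, thY_I 0 hτ]; ring
      rw [e]
      refine (hs τ z hτ).congr_fun fun p => ?_
      rw [EJ, eC_add]
end


/-! ### construction of Hermitian Jacobi forms -/

section
open Filter Topology Asymptotics

structure PData (k : ℕ) (Px Py Pz H : ℂ → ℂ) : Prop where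
  hx : ∀ τ, UHP τ → DifferentiableAt ℂ Px τ
  hy : ∀ τ, UHP τ → DifferentiableAt ℂ Py τ
  hz : ∀ τ, UHP τ → DifferentiableAt ℂ Pz τ
  hh : ∀ τ, UHP τ → DifferentiableAt ℂ H τ
  Tx : ∀ τ, UHP τ → eC (1 / 8) * Px (τ + 1) = -Py τ
  Ty : ∀ τ, UHP τ → eC (1 / 8) * Py (τ + 1) = -Px τ
  Tz : ∀ τ, UHP τ → Pz (τ + 1) = -Pz τ
  Th : ∀ τ, UHP τ → H (τ + 1) = -I * H τ
  Sx : ∀ τ, UHP τ → I * τ * Px (-1 / τ) = τ ^ k * Px τ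
  Sy : ∀ τ, UHP τ → I * τ * Py (-1 / τ) = τ ^ k * Pz τ
  Sz : ∀ τ, UHP τ → I * τ * Pz (-1 / τ) = τ ^ k * Py τ
  Sh : ∀ τ, UHP τ → I * τ * H (-1 / τ) = τ ^ k * H τ
  bx : Px =O[Iinf] (fun _ => (1 : ℂ))
  bY : Py =O[Iinf] (fun _ => (1 : ℂ))
  bz : Pz =O[Iinf] (fun _ => (1 : ℂ))
  bh : H =O[Iinf] (fun _ => (1 : ℂ))

/-- the form with given components, in the variables `u, v` -/
def PhiUV (Px Py Pz H : ℂ → ℂ) (τ u v : ℂ) : ℂ :=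
  Px τ * (tY τ u * tZ τ v - tZ τ u * tY τ v) + Py τ * (tZ τ u * tX τ v - tX τ u * tZ τ v) +
    Pz τ * (tX τ u * tY τ v - tY τ u * tX τ v) + H τ * (tO τ u * tO τ v)

def PhiZ (Px Py Pz H : ℂ → ℂ) (τ z₁ z₂ : ℂ) : ℂ :=
  PhiUV Px Py Pz H τ ((z₁ + z₂) / 2) (I * (z₁ - z₂) / 2)

def PhiH (Px Py Pz H : ℂ → ℂ) (a b : ℤ) (τ : ℂ) : ℂ :=
  Px τ * (cY a * cZ b - cZ a * cY b) + Py τ * (cZ a * cX b - cX a * cZ b) +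
    Pz τ * (cX a * cY b - cY a * cX b) + H τ * (cO a * cO b)

lemma PhiH_11 (Px Py Pz H : ℂ → ℂ) (τ : ℂ) : PhiH Px Py Pz H 1 1 τ = H τ := by
  simp [PhiH, cX, cY, cZ, cO]

lemma PhiZ_decomp (Px Py Pz H : ℂ → ℂ) : HasThetaDecomp 2 (PhiZ Px Py Pz H) (PhiH Px Py Pz H) := by
  constructor
  · intro a b τ
    have e : (2 * ((2 : ℕ) : ℤ)) = 4 := by norm_num
    rw [e]
    simp only [PhiH, cX_per, cY_per, cZ_per, cO_per, and_self]
  · intro τ z₁ z₂ hτ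
    simp only [thetaH_eq _ _ hτ]
    rw [PhiZ, PhiUV]
    generalize (z₁ + z₂) / 2 = u
    generalize I * (z₁ - z₂) / 2 = v
    simp only [tX, tY, tZ, tO, thX_I 0 hτ, thY_I 0 hτ, thZ_I 0 hτ, thO_I 0 hτ]
    simp [Finset.sum_range_succ, PhiH, cX, cY, cZ, cO]
    ring

lemma rot (Px Py Pz H : ℂ → ℂ) (τ u v : ℂ) :
    PhiUV Px Py Pz H τ v (-u) = -PhiUV Px Py Pz H τ u v := by
  simp only [PhiUV, tX_neg, tY_neg, tZ_neg, tO_neg]; ring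

lemma rot_eps {k : ℕ} (hk : k % 4 = 2) (Px Py Pz H : ℂ → ℂ) {ε : ℂ}
    (hε : ε ∈ ({1, -1, Complex.I, -Complex.I} : Set ℂ)) (τ z₁ z₂ : ℂ) :
    PhiZ Px Py Pz H τ (ε * z₁) ((starRingEnd ℂ) ε * z₂) = ε ^ k * PhiZ Px Py Pz H τ z₁ z₂ := by
  have key : ∀ z₁ z₂, PhiZ Px Py Pz H τ (I * z₁) (-I * z₂) = -PhiZ Px Py Pz H τ z₁ z₂ := by
    intro z₁ z₂
    rw [PhiZ, PhiZ, ← rot]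
    congr 1
    · ring
    · linear_combination (z₁ + z₂) / 2 * I_sq
  obtain ⟨n, rfl⟩ : ∃ n, k = 4 * n + 2 := ⟨k / 4, by omega⟩
  have hp : ∀ ε : ℂ, ε ^ 4 = 1 → ε ^ (4 * n + 2) = ε ^ 2 := by
    intro ε h; rw [pow_add, pow_mul, h]; simp
  rcases hε with rfl | rfl | rfl | rfl
  · simp
  · rw [hp _ (by norm_num)]
    have h1 := key (I * z₁) (-I * z₂)
    have h2 := key z₁ z₂
    have e1 : I * (I * z₁) = -1 * z₁ := by linear_combination z₁ * I_sq
    have e2 : -I * (-I * z₂) = -1 * z₂ := by linear_combination z₂ * I_sq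
    rw [e1, e2, h2] at h1
    simp at h1 ⊢
    exact h1
  · rw [hp _ (by simp)]
    have := key z₁ z₂
    simp at this ⊢
    exact this
  · rw [hp _ (by rw [neg_pow, I_pow_four]; norm_num)]
    have h1 := key (-I * z₁) (I * z₂)
    have e1 : I * (-I * z₁) = z₁ := by linear_combination (-z₁) * I_sq
    have e2 : -I * (I * z₂) = z₂ := by linear_combination (-z₂) * I_sq
    rw [e1, e2] at h1
    simp at h1 ⊢
    rw [h1]; simp

lemma Phi_T {k : ℕ} {Px Py Pz H : ℂ → ℂ} (P : PData k Px Py Pz H) {τ : ℂ} (hτ : UHP τ) (u v : ℂ) :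
    PhiUV Px Py Pz H (τ + 1) u v = PhiUV Px Py Pz H τ u v := by
  simp only [PhiUV, tX, tY, tZ, tO, tX_T, tY_T, tZ_T, tO_T]
  rw [P.Tz τ hτ, P.Th τ hτ]
  have h8 := eC_sq8
  linear_combination (thT cX 0 τ u * thT cZ 0 τ v - thT cZ 0 τ u * thT cX 0 τ v) * P.Tx τ hτ +
    (thT cZ 0 τ u * thT cY 0 τ v - thT cY 0 τ u * thT cZ 0 τ v) * P.Ty τ hτ
    - I * H τ * thT cO 0 τ u * thT cO 0 τ v * h8 - H τ * thT cO 0 τ u * thT cO 0 τ v * I_sq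

lemma Phi_S {k : ℕ} {Px Py Pz H : ℂ → ℂ} (P : PData k Px Py Pz H) {τ : ℂ} (hτ : UHP τ) (u v : ℂ) :
    PhiUV Px Py Pz H (-1 / τ) (u / τ) (v / τ) =
      τ ^ k * eC (2 * (u ^ 2 + v ^ 2) / τ) * PhiUV Px Py Pz H τ u v := by
  simp only [PhiUV, tX_S hτ, tY_S hτ, tZ_S hτ, tO_S hτ]
  have e : eC (2 * (u ^ 2 + v ^ 2) / τ) = eC (2 * u ^ 2 / τ) * eC (2 * v ^ 2 / τ) := by
    rw [← eC_add]; ring_nf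
  rw [e]
  have hs := rtS_sq τ
  generalize eC (2 * u ^ 2 / τ) = a
  generalize eC (2 * v ^ 2 / τ) = b
  have h1 := P.Sx τ hτ
  have h2 := P.Sy τ hτ
  have h3 := P.Sz τ hτ
  have h4 := P.Sh τ hτ
  generalize Px (-1 / τ) = p1 at *
  generalize Py (-1 / τ) = p2 at *
  generalize Pz (-1 / τ) = p3 at *
  generalize H (-1 / τ) = p4 at *
  generalize rtS τ = s at *
  generalize tX τ u = xu
  generalize tX τ v = xv
  generalize tY τ u = yu
  generalize tY τ v = yv
  generalize tZ τ u = zu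
  generalize tZ τ v = zv
  generalize tO τ u = ou
  generalize tO τ v = ov
  linear_combination a * b * (yu * zv - zu * yv) * h1 + a * b * (xu * yv - yu * xv) * h2 +
    a * b * (zu * xv - xu * zv) * h3 + a * b * ou * ov * h4 +
    a * b * (-p1 * (yu * zv - zu * yv) + p2 * (yu * xv - xu * yv) + p3 * (xu * zv - zu * xv)
      + I ^ 2 * p4 * ou * ov) * hs - a * b * ou * ov * p4 * I * τ * I_sq

lemma mkHJF {k : ℕ} (hk : k % 4 = 2) {Px Py Pz H : ℂ → ℂ} (P : PData k Px Py Pz H) :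
    IsHJF k 2 (PhiZ Px Py Pz H) where
  holo := by
    intro p hp
    have hp' : UHP p.1 := hp
    refine DifferentiableAt.differentiableWithinAt ?_
    have h1 : DifferentiableAt ℂ (fun p : ℂ × ℂ × ℂ => p.1) p := differentiableAt_fst
    have hu : DifferentiableAt ℂ (fun p : ℂ × ℂ × ℂ => (p.2.1 + p.2.2) / 2) p := by fun_prop
    have hv : DifferentiableAt ℂ (fun p : ℂ × ℂ × ℂ => I * (p.2.1 - p.2.2) / 2) p := by fun_prop
    have xu := tX_diff hu h1 hp'
    have xv := tX_diff hv h1 hp'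
    have yu := tY_diff hu h1 hp'
    have yv := tY_diff hv h1 hp'
    have zu := tZ_diff hu h1 hp'
    have zv := tZ_diff hv h1 hp'
    have ou := tO_diff hu h1 hp'
    have ov := tO_diff hv h1 hp'
    exact (((((P.hx _ hp').comp p h1).mul ((yu.mul zv).sub (zu.mul yv))).add
      (((P.hy _ hp').comp p h1).mul ((zu.mul xv).sub (xu.mul zv)))).add
      (((P.hz _ hp').comp p h1).mul ((xu.mul yv).sub (yu.mul xv)))).add
      (((P.hh _ hp').comp p h1).mul (ou.mul ov))
  transf := by
    intro ε hε M τ z₁ z₂ hτ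
    have := slash_gen (fun v : ℂ × ℂ => v.1 * v.2) (fun a v => by simp; ring) k 2
      (fun τ z => PhiZ Px Py Pz H τ z.1 z.2) ?_ ?_ M τ (z₁, z₂) hτ
    · simp only [Prod.smul_mk, smul_eq_mul] at this
      rw [mul_div_assoc, mul_div_assoc, rot_eps hk _ _ _ _ hε]
      rw [show z₁ / (Mc M * τ + Md M) = 1 / (Mc M * τ + Md M) * z₁ by ring,
        show z₂ / (Mc M * τ + Md M) = 1 / (Mc M * τ + Md M) * z₂ by ring, this]
      push_cast
      rw [show 2 * Mc M * z₁ * z₂ = 2 * Mc M * (z₁ * z₂) by ring]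
      ring
    · intro τ v hτ
      exact Phi_T P hτ _ _
    · intro τ v hτ
      have := Phi_S P hτ ((v.1 + v.2) / 2) (I * (v.1 - v.2) / 2)
      simp only [PhiZ, Prod.smul_fst, Prod.smul_snd, smul_eq_mul]
      have e : ((v.1 + v.2) / 2) ^ 2 + (I * (v.1 - v.2) / 2) ^ 2 = v.1 * v.2 := by
        linear_combination (v.1 - v.2) ^ 2 / 4 * I_sq
      rw [e] at this
      rw [← this]
      congr 1 <;> ring
  ellip := by
    intro p q a b τ z₁ z₂ hτ
    have e1 : (z₁ + ((p : ℂ) + q * I) * τ + (a + b * I) + (z₂ + ((p : ℂ) - q * I) * τ + (a - b * I))) / 2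
      = (z₁ + z₂) / 2 + p * τ + a := by ring
    have e2 : I * (z₁ + ((p : ℂ) + q * I) * τ + (a + b * I) - (z₂ + ((p : ℂ) - q * I) * τ + (a - b * I))) / 2
      = I * (z₁ - z₂) / 2 + ((-q : ℤ) : ℂ) * τ + ((-b : ℤ) : ℂ) := by
      push_cast; linear_combination (q * τ + b) * I_sq
    rw [PhiZ, PhiZ, e1, e2]
    have e3 : eC (-((2 : ℕ) : ℂ) * (((p : ℂ) ^ 2 + (q : ℂ) ^ 2) * τ + ((p : ℂ) - q * I) * z₁ + ((p : ℂ) + q * I) * z₂))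
      = eC (-(2 * p ^ 2 * τ + 4 * p * ((z₁ + z₂) / 2))) *
        eC (-(2 * ((-q : ℤ) : ℂ) ^ 2 * τ + 4 * ((-q : ℤ) : ℂ) * (I * (z₁ - z₂) / 2))) := by
      rw [← eC_add]; congr 1; push_cast; ring
    rw [e3]
    generalize (z₁ + z₂) / 2 = u
    generalize I * (z₁ - z₂) / 2 = v
    simp only [PhiUV, tX, tY, tZ, tO, thT_ellip cX_per, thT_ellip cY_per, thT_ellip cZ_per, thT_ellip cO_per]
    ring
  fourier := by
    have TT : ∀ τ, UHP τ → Px (τ + 1) - Py (τ + 1) = eC (-((1 : ℕ) / 8)) * (Px τ - Py τ) := by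
      intro τ hτ
      linear_combination -(Px (τ + 1) - Py (τ + 1)) * eC_n1
        + eC (-((1 : ℕ) / 8)) * (P.Tx τ hτ - P.Ty τ hτ)
    have TT5 : ∀ τ, UHP τ → Px (τ + 1) + Py (τ + 1) = eC (-((5 : ℕ) / 8)) * (Px τ + Py τ) := by
      intro τ hτ
      rw [eC_n5]
      linear_combination -(Px (τ + 1) + Py (τ + 1)) * eC_n1
        + eC (-((1 : ℕ) / 8)) * (P.Tx τ hτ + P.Ty τ hτ)
    have h1 : FE QH EH (fun τ z => (Px τ - Py τ) * (thT (cI 0) 0 τ z.1 * thT cZ 0 τ z.2)) := by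
      refine FEH_term 1 (by norm_num) (h := fun τ => Px τ - Py τ)
        (fun τ hτ => (P.hx τ hτ).sub (P.hy τ hτ)) TT (P.bx.sub P.bY) (cI_bd 0) cZ_bd
        (fun A B hA hB => ?_)
      have := sq_mod0 (cI_ne hA); have := sq_mod1 (cZ_ne hB); push_cast; omega
    have h2 : FE QH EH (fun τ z => (-(Px τ - Py τ)) * (thT cZ 0 τ z.1 * thT (cI 0) 0 τ z.2)) := by
      refine FEH_term 1 (by norm_num) (h := fun τ => -(Px τ - Py τ))
        (fun τ hτ => ((P.hx τ hτ).sub (P.hy τ hτ)).neg) (fun τ hτ => by rw [TT τ hτ]; ring)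
        (P.bx.sub P.bY).neg_left cZ_bd (cI_bd 0) (fun A B hA hB => ?_)
      have := sq_mod0 (cI_ne hB); have := sq_mod1 (cZ_ne hA); push_cast; omega
    have h3 : FE QH EH (fun τ z => (-(Px τ + Py τ)) * (thT (cI 2) 0 τ z.1 * thT cZ 0 τ z.2)) := by
      refine FEH_term 5 (by norm_num) (h := fun τ => -(Px τ + Py τ))
        (fun τ hτ => ((P.hx τ hτ).add (P.hy τ hτ)).neg) (fun τ hτ => by rw [TT5 τ hτ]; ring)
        (P.bx.add P.bY).neg_left (cI_bd 2) cZ_bd (fun A B hA hB => ?_)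
      have := sq_mod2 (cI_ne hA); have := sq_mod1 (cZ_ne hB); push_cast; omega
    have h4 : FE QH EH (fun τ z => (Px τ + Py τ) * (thT cZ 0 τ z.1 * thT (cI 2) 0 τ z.2)) := by
      refine FEH_term 5 (by norm_num) (h := fun τ => Px τ + Py τ)
        (fun τ hτ => (P.hx τ hτ).add (P.hy τ hτ)) TT5 (P.bx.add P.bY) cZ_bd (cI_bd 2)
        (fun A B hA hB => ?_)
      have := sq_mod2 (cI_ne hB); have := sq_mod1 (cZ_ne hA); push_cast; omega
    have h5 : FE QH EH (fun τ z => (2 * Pz τ) * (thT (cI 2) 0 τ z.1 * thT (cI 0) 0 τ z.2)) := by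
      refine FEH_term 4 (by norm_num) (h := fun τ => 2 * Pz τ)
        (fun τ hτ => (P.hz τ hτ).const_mul 2) (fun τ hτ => by rw [P.Tz τ hτ, eC_n4]; ring)
        (P.bz.const_mul_left 2) (cI_bd 2) (cI_bd 0) (fun A B hA hB => ?_)
      have := sq_mod2 (cI_ne hA); have := sq_mod0 (cI_ne hB); push_cast; omega
    have h6 : FE QH EH (fun τ z => ((-2) * Pz τ) * (thT (cI 0) 0 τ z.1 * thT (cI 2) 0 τ z.2)) := by
      refine FEH_term 4 (by norm_num) (h := fun τ => (-2) * Pz τ)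
        (fun τ hτ => (P.hz τ hτ).const_mul (-2)) (fun τ hτ => by rw [P.Tz τ hτ, eC_n4]; ring)
        (P.bz.const_mul_left (-2)) (cI_bd 0) (cI_bd 2) (fun A B hA hB => ?_)
      have := sq_mod0 (cI_ne hA); have := sq_mod2 (cI_ne hB); push_cast; omega
    have h7 : FE QH EH (fun τ z => H τ * (thT cO 0 τ z.1 * thT cO 0 τ z.2)) := by
      refine FEH_term 2 (by norm_num) P.hh (fun τ hτ => by rw [P.Th τ hτ, eC_n2])
        P.bh cO_bd cO_bd (fun A B hA hB => ?_)
      have := sq_mod1 (cO_ne hA); have := sq_mod1 (cO_ne hB); push_cast; omega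
    have hFE : FE QH EH (fun τ z => PhiUV Px Py Pz H τ z.1 z.2) := by
      refine ((((((h1.add h2).add h3).add h4).add h5).add h6).add h7).congr fun τ z hτ => ?_
      rw [PhiUV]
      simp only [tX, tY]
      rw [thX_I 0 hτ, thX_I 0 hτ, thY_I 0 hτ, thY_I 0 hτ]
      ring
    obtain ⟨c, hc, hs⟩ := hFE
    refine ⟨fun n a b => c n (a, b), fun n a b hn => hc n (a, b) ?_, fun τ z₁ z₂ hτ => ?_⟩
    · have := QH_int (a, b)
      push_cast at hn
      simp only at this
      omega
    · have := hs τ ((z₁ + z₂) / 2, I * (z₁ - z₂) / 2) hτ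
      refine this.congr_fun fun p => ?_
      obtain ⟨n, a, b⟩ := p
      simp only
      rw [EH, ← eC_add]
      congr 2
      ring
end


/-! ### surjectivity statements -/

section
open Filter Topology Asymptotics

lemma mf_T {k : ℕ} {f : ℂ → ℂ} (h : ∀ M : Matrix.SpecialLinearGroup (Fin 2) ℤ, ∀ τ : ℂ, UHP τ →
      f ((Ma M * τ + Mb M) / (Mc M * τ + Md M)) = (Mc M * τ + Md M) ^ k * f τ) {τ : ℂ} (hτ : UHP τ) :
    f (τ + 1) = f τ := by
  have := h ModularGroup.T τ hτ
  simpa [Ma, Mb, Mc, Md, ModularGroup.T] using this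

lemma mf_S {k : ℕ} {f : ℂ → ℂ} (h : ∀ M : Matrix.SpecialLinearGroup (Fin 2) ℤ, ∀ τ : ℂ, UHP τ →
      f ((Ma M * τ + Mb M) / (Mc M * τ + Md M)) = (Mc M * τ + Md M) ^ k * f τ) {τ : ℂ} (hτ : UHP τ) :
    f (-1 / τ) = τ ^ k * f τ := by
  have := h ModularGroup.S τ hτ
  simpa [Ma, Mb, Mc, Md, ModularGroup.S] using this

lemma mf_transf {k : ℕ} {f : ℂ → ℂ} (hT : ∀ τ, UHP τ → f (τ + 1) = f τ)
    (hS : ∀ τ, UHP τ → f (-1 / τ) = τ ^ k * f τ) (M : Matrix.SpecialLinearGroup (Fin 2) ℤ)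
    (τ : ℂ) (hτ : UHP τ) :
    f ((Ma M * τ + Mb M) / (Mc M * τ + Md M)) = (Mc M * τ + Md M) ^ k * f τ := by
  have := slash_gen (V := ℂ) (fun _ => 0) (by simp) k 0 (fun τ _ => f τ) (fun τ _ h => hT τ h)
    (fun τ _ h => by simp [eC_zero, hS τ h]) M τ 0 hτ
  simpa [eC_zero] using this

lemma holo_at {f : ℂ → ℂ} (h : DifferentiableOn ℂ f {τ | UHP τ}) {τ : ℂ} (hτ : UHP τ) :
    DifferentiableAt ℂ f τ := h.differentiableAt (isOpen_UHP.mem_nhds hτ)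

lemma decayO {f : ℂ → ℂ} (hol : ∀ τ, UHP τ → DifferentiableAt ℂ f τ)
    (hT : ∀ τ, UHP τ → f (τ + 1) = f τ) (h0 : Tendsto f Iinf (𝓝 0)) :
    f =O[Iinf] fun τ => eC (1 * τ) := by
  obtain ⟨d, h1, h2, -⟩ := qexp hol hT (h0.isBigO_one ℂ)
  rw [tendsto_nhds_unique h1 h0] at h2
  simpa using h2

lemma bdd_eC {a : ℝ} (ha : 0 ≤ a) : (fun τ => eC ((a : ℂ) * τ)) =O[Iinf] (fun _ => (1 : ℂ)) := by
  rw [bdd_Iinf]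
  refine ⟨1, 0, fun τ hτ => ?_⟩
  rw [norm_eC, Real.exp_le_one_iff, Complex.im_ofReal_mul]
  have : 0 ≤ Real.pi * (a * τ.im) := by
    have := Real.pi_pos
    positivity
  linarith

lemma bdd_div (a b : ℝ) (hab : b ≤ a) {a' b' : ℂ} (ha : a' = a) (hb : b' = b) {F D : ℂ → ℂ} {L : ℂ}
    (hL : L ≠ 0) (hF : F =O[Iinf] fun τ => eC (a' * τ))
    (hD : Tendsto (fun τ => D τ * eC (-(b' * τ))) Iinf (𝓝 L)) :
    (fun τ => F τ / D τ) =O[Iinf] (fun _ => (1 : ℂ)) := by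
  subst ha hb
  have h1 := (hD.inv₀ hL).isBigO_one ℂ
  have h2 := (hF.mul h1).mul (isBigO_refl (fun τ => eC (-((b : ℂ) * τ))) Iinf)
  have h3 := bdd_eC (sub_nonneg.2 hab)
  refine (h2.congr_left ?_).trans (h3.congr_left ?_)
  · intro τ
    have := eC_ne_zero (-((b : ℂ) * τ))
    by_cases hD0 : D τ = 0
    · simp [hD0]
    field_simp
  · intro τ
    rw [mul_one, ← eC_add]; congr 1; push_cast; ring

lemma z_lim : Tendsto (fun τ => tZ τ 0) Iinf (𝓝 0) := by
  have h1 := asymp_Z 0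
  have h2 := eC_tendsto_zero (a := 1 / 8) (by norm_num)
  have h3 := h1.mul h2
  rw [mul_zero] at h3
  refine h3.congr fun τ => ?_
  rw [mul_assoc, ← eC_add]; push_cast; simp [eC_zero]

lemma z8_8 : eC (1 / 8) ^ 8 = 1 := by
  rw [show (8 : ℕ) = 4 * 2 from rfl, pow_mul, z8_4]; norm_num

lemma partA (k : ℕ) (hk4 : k % 4 = 2) (f : ℂ → ℂ) (hf : IsMF k f) :
    ∃ ψ : ℂ → ℂ → ℂ, IsJF k 2 ψ ∧ ∀ τ : ℂ, UHP τ → ψ τ 0 = f τ := by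
  obtain ⟨j, rfl⟩ : ∃ n, k = 4 * n + 2 := ⟨k / 4, by omega⟩
  obtain ⟨d, hd, -⟩ := qexp (fun τ hτ => holo_at hf.holo hτ) (fun τ hτ => mf_T hf.transf hτ)
    (bdd_Iinf.2 hf.bounded)
  set c := d 0
  have xl : Tendsto (fun τ => tX τ 0) Iinf (𝓝 1) := by simpa using asymp_X 0
  have yl : Tendsto (fun τ => tY τ 0) Iinf (𝓝 1) := by simpa using asymp_Y 0
  have zl := z_lim
  have xd := fun {τ : ℂ} (hτ : UHP τ) => thT_diff cX_bd 0 0 hτ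
  have yd := fun {τ : ℂ} (hτ : UHP τ) => thT_diff cY_bd 0 0 hτ
  have zd := fun {τ : ℂ} (hτ : UHP τ) => thT_diff cZ_bd 0 0 hτ
  have fT := fun {τ : ℂ} (hτ : UHP τ) => mf_T hf.transf hτ
  have fS := fun {τ : ℂ} (hτ : UHP τ) => mf_S hf.transf hτ
  set E : ℂ → ℂ := fun τ => ((tX τ 0 ^ 8 + tY τ 0 ^ 8 + tZ τ 0 ^ 8) / 2) ^ j with hE
  have ET : ∀ τ, E (τ + 1) = E τ := by
    intro τ
    simp only [hE, tX, tY, tZ, tX_T, tY_T, tZ_T, mul_pow, z8_8]; ring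
  have ES : ∀ τ, UHP τ → E (-1 / τ) = τ ^ (4 * j) * E τ := by
    intro τ hτ
    have h8 : rtS τ ^ 8 = τ ^ 4 := by
      rw [show (8 : ℕ) = 2 * 4 from rfl, s_pow, mul_pow, neg_pow, I_pow_four]; norm_num
    simp only [hE, tX_S0 hτ, tY_S0 hτ, tZ_S0 hτ, mul_pow, h8]
    rw [pow_mul, ← mul_pow]; ring
  have Ed : ∀ τ, UHP τ → DifferentiableAt ℂ E τ := fun τ hτ =>
    (((((xd hτ).pow 8).add ((yd hτ).pow 8)).add ((zd hτ).pow 8)).div_const 2).pow j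
  have El : Tendsto E Iinf (𝓝 1) := by
    have := ((((xl.pow 8).add (yl.pow 8)).add (zl.pow 8)).div_const 2).pow j
    convert this using 2
    norm_num
  set Fx : ℂ → ℂ := fun τ => f τ / 3 + c / 6 * (E τ * (tY τ 0 ^ 4 - tZ τ 0 ^ 4)) with hFx
  set Fy : ℂ → ℂ := fun τ => f τ / 3 + c / 6 * (E τ * (tX τ 0 ^ 4 + tZ τ 0 ^ 4)) with hFy
  set Fz : ℂ → ℂ := fun τ => f τ / 3 - c / 6 * (E τ * (tX τ 0 ^ 4 + tY τ 0 ^ 4)) with hFz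
  have z4 := z8_4
  have s4 : ∀ τ, rtS τ ^ 4 = -τ ^ 2 := by
    intro τ
    rw [show (4 : ℕ) = 2 * 2 from rfl, s_pow, mul_pow, neg_sq, I_sq]; ring
  have FxT : ∀ τ, UHP τ → Fx (τ + 1) = Fy τ := by
    intro τ hτ
    simp only [hFx, hFy, ET, fT hτ, tX, tY, tZ, tX_T, tY_T, tZ_T, mul_pow, z4]; ring
  have FyT : ∀ τ, UHP τ → Fy (τ + 1) = Fx τ := by
    intro τ hτ
    simp only [hFx, hFy, ET, fT hτ, tX, tY, tZ, tX_T, tY_T, tZ_T, mul_pow, z4]; ring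
  have FzT : ∀ τ, UHP τ → Fz (τ + 1) = Fz τ := by
    intro τ hτ
    simp only [hFz, ET, fT hτ, tX, tY, tZ, tX_T, tY_T, tZ_T, mul_pow, z4]; ring
  have FxS : ∀ τ, UHP τ → Fx (-1 / τ) = τ ^ (4 * j + 2) * Fx τ := by
    intro τ hτ
    simp only [hFx, ES τ hτ, fS hτ, tX_S0 hτ, tY_S0 hτ, tZ_S0 hτ, mul_pow, s4]; ring
  have FyS : ∀ τ, UHP τ → Fy (-1 / τ) = τ ^ (4 * j + 2) * Fz τ := by
    intro τ hτ
    simp only [hFy, hFz, ES τ hτ, fS hτ, tX_S0 hτ, tY_S0 hτ, tZ_S0 hτ, mul_pow, s4]; ring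
  have FzS : ∀ τ, UHP τ → Fz (-1 / τ) = τ ^ (4 * j + 2) * Fy τ := by
    intro τ hτ
    simp only [hFy, hFz, ES τ hτ, fS hτ, tX_S0 hτ, tY_S0 hτ, tZ_S0 hτ, mul_pow, s4]; ring
  have Fxd : ∀ τ, UHP τ → DifferentiableAt ℂ Fx τ := fun τ hτ =>
    ((holo_at hf.holo hτ).div_const 3).add (((Ed τ hτ).mul (((yd hτ).pow 4).sub ((zd hτ).pow 4))).const_mul _)
  have Fyd : ∀ τ, UHP τ → DifferentiableAt ℂ Fy τ := fun τ hτ =>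
    ((holo_at hf.holo hτ).div_const 3).add (((Ed τ hτ).mul (((xd hτ).pow 4).add ((zd hτ).pow 4))).const_mul _)
  have Fzd : ∀ τ, UHP τ → DifferentiableAt ℂ Fz τ := fun τ hτ =>
    ((holo_at hf.holo hτ).div_const 3).sub (((Ed τ hτ).mul (((xd hτ).pow 4).add ((yd hτ).pow 4))).const_mul _)
  have Fxl : Tendsto Fx Iinf (𝓝 (c / 3 + c / 6 * (1 * (1 ^ 4 - 0 ^ 4)))) :=
    (hd.div_const 3).add ((El.mul ((yl.pow 4).sub (zl.pow 4))).const_mul _)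
  have Fyl : Tendsto Fy Iinf (𝓝 (c / 3 + c / 6 * (1 * (1 ^ 4 + 0 ^ 4)))) :=
    (hd.div_const 3).add ((El.mul ((xl.pow 4).add (zl.pow 4))).const_mul _)
  have Fzl : Tendsto Fz Iinf (𝓝 0) := by
    have : Tendsto Fz Iinf (𝓝 (c / 3 - c / 6 * (1 * (1 ^ 4 + 1 ^ 4)))) :=
      (hd.div_const 3).sub ((El.mul ((xl.pow 4).add (yl.pow 4))).const_mul _)
    convert this using 2
    ring
  have FzO := decayO Fzd FzT Fzl
  have G : GData (4 * j + 2) (fun τ => Fx τ / tX τ 0) (fun τ => Fy τ / tY τ 0) (fun τ => Fz τ / tZ τ 0) := by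
    constructor
    · exact fun τ hτ => (Fxd τ hτ).div (xd hτ) (x_ne hτ)
    · exact fun τ hτ => (Fyd τ hτ).div (yd hτ) (y_ne hτ)
    · exact fun τ hτ => (Fzd τ hτ).div (zd hτ) (z_ne hτ)
    · intro τ hτ; simp only [FxT τ hτ, tX, tX_T]
    · intro τ hτ; simp only [FyT τ hτ, tY, tY_T]
    · intro τ hτ; simp only [FzT τ hτ, tZ, tZ_T]
      have := z_ne hτ
      have := eC_ne_zero (1 / 8)
      field_simp
    · intro τ hτ; simp only [FxS τ hτ, tX_S0 hτ]
      have := rtS_ne_zero hτ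
      have := x_ne hτ
      field_simp
    · intro τ hτ; simp only [FyS τ hτ, tY_S0 hτ]
      have := rtS_ne_zero hτ
      have := z_ne hτ
      field_simp
    · intro τ hτ; simp only [FzS τ hτ, tZ_S0 hτ]
      have := rtS_ne_zero hτ
      have := y_ne hτ
      field_simp
    · exact (Fxl.div xl one_ne_zero).isBigO_one ℂ
    · exact (Fyl.div yl one_ne_zero).isBigO_one ℂ
    · exact bdd_div 1 (1 / 8) (by norm_num) (by norm_num) (b' := 1 / 8) (by norm_num) (L := 2) two_ne_zero FzO
        (by have := asymp_Z 0; norm_num at this ⊢; exact this)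
  refine ⟨_, mkJF G, fun τ hτ => ?_⟩
  rw [div_mul_cancel₀ _ (x_ne hτ), div_mul_cancel₀ _ (y_ne hτ), div_mul_cancel₀ _ (z_ne hτ)]
  simp only [hFx, hFy, hFz]; ring

/-- the constant relating the sixth Taylor coefficient to `WW` -/
def kap : ℂ := 1 / 720 * (30 * (Real.pi * I) ^ 6)

lemma kap_ne : kap ≠ 0 := by
  have : (Real.pi : ℂ) ≠ 0 := by exact_mod_cast Real.pi_ne_zero
  unfold kap
  simp [I_ne_zero, this]

lemma chi_eq {ψ : ℂ → ℂ → ℂ → ℂ} {τ : ℂ} (hτ : UHP τ) (g : ℂ)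
    (h : ∀ z, ψ τ z 0 = g * DD τ ((z + 0) / 2) (I * (z - 0) / 2)) :
    chiHJF ψ 6 0 τ = kap * g * WW τ := by
  unfold chiHJF
  simp only [iteratedDeriv_zero, h]
  have e : (fun z => g * DD τ ((z + 0) / 2) (I * (z - 0) / 2)) =
      fun z => g * (fun z => DD τ (1 / 2 * z) (I / 2 * z)) z := by
    funext z
    simp only
    congr 2 <;> ring
  rw [e, iteratedDeriv_const_mul_field, DD_iter hτ, kap]
  norm_num [Nat.factorial]
  ring

lemma OO_eq {τ : ℂ} (hτ : UHP τ) (z₁ z₂ : ℂ) :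
    thetaH 2 1 1 τ z₁ z₂ - thetaH 2 1 3 τ z₁ z₂ - thetaH 2 3 1 τ z₁ z₂ + thetaH 2 3 3 τ z₁ z₂ =
      tO τ ((z₁ + z₂) / 2) * tO τ (I * (z₁ - z₂) / 2) := by
  simp only [thetaH_eq _ _ hτ, tO, thO_I 0 hτ]; ring

lemma partE (k : ℕ) (hk4 : k % 4 = 2) (f₁ f₂ : ℂ → ℂ) (hf₁ : IsCF (k + 2) f₁) (hf₂ : IsCF (k + 6) f₂) :
      ∃ (φ : ℂ → ℂ → ℂ → ℂ) (h : ℤ → ℤ → ℂ → ℂ),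
        IsHJF k 2 φ ∧ HasThetaDecomp 2 φ h ∧ (∀ τ z : ℂ, UHP τ → φ τ z z = 0) ∧
        (∀ τ : ℂ, UHP τ → xiC τ * h 1 1 τ = f₁ τ) ∧
        (∀ τ : ℂ, UHP τ → chiHJF (psiOf φ h) 6 0 τ = f₂ τ) := by
  have xl : Tendsto (fun τ => tX τ 0) Iinf (𝓝 1) := by simpa using asymp_X 0
  have yl : Tendsto (fun τ => tY τ 0) Iinf (𝓝 1) := by simpa using asymp_Y 0
  have xd := fun {τ : ℂ} (hτ : UHP τ) => thT_diff cX_bd 0 0 hτ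
  have yd := fun {τ : ℂ} (hτ : UHP τ) => thT_diff cY_bd 0 0 hτ
  have zd := fun {τ : ℂ} (hτ : UHP τ) => thT_diff cZ_bd 0 0 hτ
  have O1 := decayO (fun τ hτ => holo_at hf₁.holo hτ) (fun τ hτ => mf_T hf₁.transf hτ)
    (tendsto_zero_Iinf.2 hf₁.decay)
  have O2 := decayO (fun τ hτ => holo_at hf₂.holo hτ) (fun τ hτ => mf_T hf₂.transf hτ)
    (tendsto_zero_Iinf.2 hf₂.decay)
  have hpi : (Real.pi : ℂ) * I ≠ 0 := mul_ne_zero (by exact_mod_cast Real.pi_ne_zero) I_ne_zero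
  have bH := bdd_div 1 (1 / 4) (by norm_num) (by norm_num) (b' := 1 / 4) (by norm_num)
    (neg_ne_zero.2 hpi) O1 xi_lim
  have bg := (bdd_div 1 (5 / 8) (by norm_num) (by norm_num) (b' := 5 / 8) (by norm_num)
    (by norm_num) O2 WW_lim).const_mul_left kap⁻¹
  set H : ℂ → ℂ := fun τ => f₁ τ / xiC τ with hH
  set g : ℂ → ℂ := fun τ => kap⁻¹ * (f₂ τ / WW τ) with hg
  have gd : ∀ τ, UHP τ → DifferentiableAt ℂ g τ := fun τ hτ =>
    ((holo_at hf₂.holo hτ).div (WW_diff hτ) (WW_ne hτ)).const_mul _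
  have gT : ∀ τ, UHP τ → eC (1 / 8) * g (τ + 1) = -g τ := by
    intro τ hτ
    simp only [hg, mf_T hf₂.transf hτ, WW_T]
    have := WW_ne hτ
    have := eC_ne_zero (1 / 8)
    have := kap_ne
    field_simp
  have gS : ∀ τ, UHP τ → rtS τ ^ 3 * g (-1 / τ) = -τ ^ k * g τ := by
    intro τ hτ
    simp only [hg, mf_S hf₂.transf hτ, WW_S hτ]
    have := WW_ne hτ
    have := rtS_ne_zero hτ
    have := kap_ne
    have := uhp_ne_zero hτ
    rw [pow_add]
    field_simp
  have hIs : ∀ τ, I * τ = -rtS τ ^ 2 := by intro τ; rw [rtS_sq]; ring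
  have P : PData k (fun τ => g τ * tX τ 0) (fun τ => g τ * tY τ 0) (fun τ => g τ * tZ τ 0) H := by
    constructor
    · exact fun τ hτ => (gd τ hτ).mul (xd hτ)
    · exact fun τ hτ => (gd τ hτ).mul (yd hτ)
    · exact fun τ hτ => (gd τ hτ).mul (zd hτ)
    · exact fun τ hτ => (holo_at hf₁.holo hτ).div (xi_diff hτ) (xi_ne hτ)
    · intro τ hτ; simp only [tX, tY, tX_T]; linear_combination thT cY 0 τ 0 * gT τ hτ
    · intro τ hτ; simp only [tX, tY, tY_T]; linear_combination thT cX 0 τ 0 * gT τ hτ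
    · intro τ hτ; simp only [tZ, tZ_T]; linear_combination thT cZ 0 τ 0 * gT τ hτ
    · intro τ hτ; simp only [hH, mf_T hf₁.transf hτ, xi_T hτ]
      have := xi_ne hτ
      have := I_ne_zero
      field_simp
      simp
    · intro τ hτ; simp only [tX_S0 hτ]; rw [hIs]; linear_combination -tX τ 0 * gS τ hτ
    · intro τ hτ; simp only [tY_S0 hτ]; rw [hIs]; linear_combination -tZ τ 0 * gS τ hτ
    · intro τ hτ; simp only [tZ_S0 hτ]; rw [hIs]; linear_combination -tY τ 0 * gS τ hτ
    · intro τ hτ; simp only [hH, mf_S hf₁.transf hτ, xi_S hτ]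
      have := xi_ne hτ
      have := I_ne_zero
      have := uhp_ne_zero hτ
      rw [pow_add]
      field_simp
    · simpa using bg.mul (xl.isBigO_one ℂ)
    · simpa using bg.mul (yl.isBigO_one ℂ)
    · simpa using bg.mul (z_lim.isBigO_one ℂ)
    · exact bH
  refine ⟨_, _, mkHJF hk4 P, PhiZ_decomp _ _ _ _, ?_, ?_, ?_⟩
  · intro τ z hτ
    rw [PhiZ, PhiUV]
    simp only [sub_self, mul_zero, zero_div, tO_zero]
    ring
  · intro τ hτ
    rw [PhiH_11]
    simp only [hH]
    exact mul_div_cancel₀ _ (xi_ne hτ)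
  · intro τ hτ
    rw [chi_eq hτ (g τ)]
    · have := WW_ne hτ
      have := kap_ne
      simp only [hg]
      field_simp
    · intro z
      rw [psiOf, OO_eq hτ, PhiH_11, PhiZ, PhiUV, DD]; ring
end


/-! ### Fourier expansions: limits and uniqueness, theta decomposition -/

section
open Filter Topology Asymptotics

lemma lim_four {ι : Type} {c : ι → ℂ} {n : ι → ℕ} {t : ι → ℂ} (ht : ∀ i, (t i).im = 0) {F : ℂ → ℂ}
    (hF : ∀ τ, UHP τ → HasSum (fun i => c i * eC (n i * τ + t i)) (F τ)) (i0 : ι) (hn0 : n i0 = 0)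
    (h0 : ∀ i, n i = 0 → i ≠ i0 → c i = 0) : Tendsto F Iinf (𝓝 (c i0 * eC (t i0))) := by
  classical
  have hI : UHP I := by simp [UHP]
  have hs := (hF I hI).summable.norm
  have h1 : Tendsto (fun τ => ∑' i, c i * eC (n i * τ + t i)) Iinf
      (𝓝 (∑' i, if i = i0 then c i * eC (t i) else 0)) := by
    refine tendsto_tsum_of_dominated_convergence hs ?_ ?_
    · intro i
      split_ifs with h
      · subst h
        simp [hn0]
      · by_cases hn : n i = 0
        · simp [h0 i hn h]
        · have h2 := (eC_tendsto_zero (a := (n i : ℝ)) (by positivity)).mul_const (eC (t i))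
          have h3 := h2.const_mul (c i)
          simp only [zero_mul, mul_zero] at h3
          refine h3.congr fun τ => ?_
          rw [eC_add]; push_cast; ring
    · filter_upwards [eventually_ge 1] with τ hτ i
      rw [norm_mul, norm_mul]
      refine mul_le_mul_of_nonneg_left ?_ (norm_nonneg _)
      rw [norm_eC, norm_eC, Real.exp_le_exp]
      simp only [Complex.add_im, ht, Complex.mul_im, Complex.natCast_re, Complex.natCast_im, I_re, I_im]
      have h4 : (n i : ℝ) ≤ n i * τ.im := by
        nlinarith [Nat.cast_nonneg (α := ℝ) (n i)]
      nlinarith [Real.pi_pos]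
  rw [tsum_ite_eq] at h1
  refine h1.congr' ?_
  filter_upwards [eventually_uhp] with τ hτ
  exact (hF τ hτ).tsum_eq

lemma int_eC (n : ℤ) : ∫ x in (0 : ℝ)..1, eC (n * (x : ℂ)) = if n = 0 then 1 else 0 := by
  split_ifs with h
  · subst h; simp [eC_zero]
  · have hc : 2 * (Real.pi : ℂ) * I * n ≠ 0 := by
      have : (Real.pi : ℂ) ≠ 0 := by exact_mod_cast Real.pi_ne_zero
      have : (n : ℂ) ≠ 0 := by exact_mod_cast h
      simp [*, I_ne_zero]
    have h1 := integral_exp_mul_complex (a := 0) (b := 1) hc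
    have h2 : ∀ x : ℝ, eC (n * (x : ℂ)) = cexp (2 * (Real.pi : ℂ) * I * n * x) := by
      intro x; rw [eC]; ring_nf
    simp_rw [h2]
    rw [h1]
    have h3 : cexp (2 * (Real.pi : ℂ) * I * n * (1 : ℝ)) = 1 := by
      rw [← h2, show (n : ℂ) * ((1 : ℝ) : ℂ) = n by simp]
      exact eC_int n
    rw [h3]; simp

lemma four_uniq {a : ℤ → ℂ} (h : ∀ x : ℝ, HasSum (fun r : ℤ => a r * eC (r * (x : ℂ))) 0) (m : ℤ) :
    a m = 0 := by
  have hs : Summable fun r => ‖a r‖ := by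
    have := (h 0).summable.norm
    simpa [eC_zero] using this
  set F : ℤ → ℝ → ℂ := fun r x => a r * eC (((r - m : ℤ) : ℂ) * (x : ℂ)) with hFdef
  have hFc : ∀ r, Continuous (F r) := by
    intro r
    have : Continuous eC := differentiable_eC.continuous
    fun_prop
  have hn : ∀ r x, ‖F r x‖ = ‖a r‖ := by
    intro r x
    simp only [hFdef]
    rw [norm_mul, norm_eC]
    simp
  have key := MeasureTheory.hasSum_integral_of_summable_integral_norm
    (μ := MeasureTheory.volume.restrict (Set.Ioc (0 : ℝ) 1)) (F := F)
    (fun r => (hFc r).integrableOn_Ioc) (by simpa [hn] using hs)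
  have h0 : ∀ x, ∑' r, F r x = 0 := by
    intro x
    have := (h x).mul_right (eC (-(m * (x : ℂ))))
    rw [zero_mul] at this
    refine HasSum.tsum_eq ?_
    refine this.congr_fun fun r => ?_
    simp only [hFdef]
    rw [mul_assoc, ← eC_add]; push_cast; ring_nf
  simp only [h0, MeasureTheory.integral_zero] at key
  have h1 : ∀ r, ∫ x in Set.Ioc (0 : ℝ) 1, F r x = if r = m then a m else 0 := by
    intro r
    rw [← intervalIntegral.integral_of_le zero_le_one]
    simp only [hFdef]
    rw [intervalIntegral.integral_const_mul, int_eC]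
    by_cases hr : r = m
    · simp [hr]
    · simp [hr, sub_eq_zero]
  simp only [h1] at key
  have := key.tsum_eq
  rwa [tsum_ite_eq] at this

lemma jf_decomp {k : ℕ} {ψ : ℂ → ℂ → ℂ} (hψ : IsJF k 2 ψ) {τ : ℂ} (hτ : UHP τ) :
    ∃ g : ℤ → ℂ, ∀ z, ψ τ z = ∑ a ∈ Finset.range 4, g a * tI a τ z := by
  obtain ⟨c, -, hc⟩ := hψ.fourier
  set a : ℤ → ℂ := fun r => ∑' n : ℕ, c n r * eC (n * τ) with ha
  have h1 : ∀ z, HasSum (fun r : ℤ => a r * eC (r * z)) (ψ τ z) := by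
    intro z
    have h2 := (Equiv.prodComm ℤ ℕ).hasSum_iff.2 (hc τ z hτ)
    refine h2.prod_fiberwise fun r => ?_
    have h3 := (h2.summable.prod_factor r).mul_right (eC (-(r * z)))
    have h4 : Summable fun n : ℕ => c n r * eC (n * τ) := by
      refine h3.congr fun n => ?_
      simp only [Function.comp, Equiv.prodComm_apply, Prod.swap_prod_mk]
      rw [mul_assoc, ← eC_add]; ring_nf
    refine (h4.hasSum.mul_right (eC (r * z))).congr_fun fun n => ?_
    simp only [Function.comp, Equiv.prodComm_apply, Prod.swap_prod_mk]
    rw [mul_assoc, ← eC_add]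
  have h2 : ∀ r, a r * eC (r * τ) - a (r + 4) * eC (-(2 * τ)) = 0 := by
    refine four_uniq fun x => ?_
    have e1 := h1 ((x : ℂ) + τ)
    have e2 := (Equiv.addRight (4 : ℤ)).hasSum_iff.2 ((h1 x).mul_left (eC (-(2 * (τ + 2 * x)))))
    have e3 := hψ.ellip 1 0 τ x hτ
    have e4 : ψ τ ((x : ℂ) + τ) = eC (-(2 * (τ + 2 * x))) * ψ τ x := by
      simp only [Int.cast_one, one_mul, Int.cast_zero, add_zero, one_pow, mul_one] at e3
      rw [e3]; congr 2; push_cast; ring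
    rw [← e4] at e2
    have e5 := e1.sub e2
    rw [sub_self] at e5
    refine e5.congr_fun fun r => ?_
    simp only [Function.comp, Equiv.coe_addRight]
    have f1 : eC (r * ((x : ℂ) + τ)) = eC (r * τ) * eC (r * (x : ℂ)) := by
      rw [← eC_add]; ring_nf
    have f2 : eC (-(2 * (τ + 2 * (x : ℂ)))) * eC (((r + 4 : ℤ) : ℂ) * x) = eC (-(2 * τ)) * eC (r * (x : ℂ)) := by
      rw [← eC_add, ← eC_add]; congr 1; push_cast; ring
    rw [f1]
    linear_combination a (r + 4) * f2
  refine ⟨fun r => a r * eC (-((r : ℂ) ^ 2 / 8 * τ)), fun z => ?_⟩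
  have hper : ∀ r : ℤ, a (r + 4) * eC (-(((r + 4 : ℤ) : ℂ) ^ 2 / 8 * τ)) = a r * eC (-((r : ℂ) ^ 2 / 8 * τ)) := by
    intro r
    have e1 : a (r + 4) = a r * eC (r * τ + 2 * τ) := by
      have := sub_eq_zero.1 (h2 r)
      rw [eC_add, ← mul_assoc, this, mul_assoc, ← eC_add]
      simp [eC_zero]
    rw [e1, mul_assoc, ← eC_add]; congr 2; push_cast; ring
  refine Eq.trans ?_ (thT_decomp (χ := fun r : ℤ => a r * eC (-((r : ℂ) ^ 2 / 8 * τ))) hper 0 hτ z)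
  rw [← (h1 z).tsum_eq, thT]
  refine tsum_congr fun r => ?_
  rw [eA, pow_zero, mul_one, mul_assoc, ← eC_add]; congr 2; ring

lemma jf_even {k : ℕ} (hk : k % 4 = 2) {ψ : ℂ → ℂ → ℂ} (hψ : IsJF k 2 ψ) {τ : ℂ} (hτ : UHP τ) (z : ℂ) :
    ψ τ (-z) = ψ τ z := by
  have h := hψ.transf (-1) τ z hτ
  have hev : Even k := ⟨k / 2, by omega⟩
  simpa [Ma, Mb, Mc, Md, hev.neg_one_pow, eC_zero, div_neg] using h

lemma jf_xyz {k : ℕ} (hk : k % 4 = 2) {ψ : ℂ → ℂ → ℂ} (hψ : IsJF k 2 ψ) {τ : ℂ} (hτ : UHP τ) :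
    ∃ a b c : ℂ, ∀ z, ψ τ z = a * tX τ z + b * tY τ z + c * tZ τ z := by
  obtain ⟨g, hg⟩ := jf_decomp hψ hτ
  refine ⟨(g 0 + g 2) / 2, (g 0 - g 2) / 2, (g 1 + g 3) / 2, fun z => ?_⟩
  have h1 := hg z
  have h2 := hg (-z)
  rw [jf_even hk hψ hτ] at h2
  have i0 : tI (-0) τ z = tI 0 τ z := by simp
  have i1 : tI (-1) τ z = tI 3 τ z := thT_congr (fun A => by simp [cI]) 0 τ z
  have i2 : tI (-2) τ z = tI 2 τ z := thT_congr (fun A => by simp [cI]) 0 τ z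
  have i3 : tI (-3) τ z = tI 1 τ z := thT_congr (fun A => by simp [cI]) 0 τ z
  simp only [tI_neg] at h2
  simp only [Finset.sum_range_succ, Finset.sum_range_zero] at h1 h2
  push_cast at h1 h2
  rw [i1, i2, i3, i0] at h2
  simp only [tX, tY, tZ, thX_I 0 hτ, thY_I 0 hτ, thZ_I 0 hτ]
  simp only [tI] at h1 h2
  linear_combination (h1 + h2) / 2
end


/-! ### the image of the restriction map -/

section
open Filter Topology Asymptotics

lemma jf_T {k : ℕ} {ψ : ℂ → ℂ → ℂ} (hψ : IsJF k 2 ψ) {τ : ℂ} (hτ : UHP τ) (z : ℂ) :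
    ψ (τ + 1) z = ψ τ z := by
  have h := hψ.transf ModularGroup.T τ z hτ
  simpa [Ma, Mb, Mc, Md, ModularGroup.T, eC_zero] using h

lemma jf_S {k : ℕ} {ψ : ℂ → ℂ → ℂ} (hψ : IsJF k 2 ψ) {τ : ℂ} (hτ : UHP τ) (z : ℂ) :
    ψ (-1 / τ) (z / τ) = τ ^ k * eC (2 * z ^ 2 / τ) * ψ τ z := by
  have h := hψ.transf ModularGroup.S τ z hτ
  simpa [Ma, Mb, Mc, Md, ModularGroup.S, eC_zero] using h

lemma jf_diff {k : ℕ} {ψ : ℂ → ℂ → ℂ} (hψ : IsJF k 2 ψ) {τ : ℂ} (hτ : UHP τ) (z : ℂ) :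
    DifferentiableAt ℂ (fun τ => ψ τ z) τ := by
  have ho : IsOpen {p : ℂ × ℂ | UHP p.1} := isOpen_UHP.preimage continuous_fst
  have h1 := hψ.holo.differentiableAt (x := (τ, z)) (ho.mem_nhds hτ)
  have h2 : DifferentiableAt ℂ (fun t : ℂ => (t, z)) τ := differentiableAt_id.prodMk (differentiableAt_const z)
  exact DifferentiableAt.comp (g := fun p : ℂ × ℂ => ψ p.1 p.2) τ h1 h2

lemma jf_lim {k : ℕ} {ψ : ℂ → ℂ → ℂ} (hψ : IsJF k 2 ψ) (h0 : ∀ τ, UHP τ → ψ τ 0 = 0) {z : ℂ}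
    (hz : z.im = 0) : Tendsto (fun τ => ψ τ z) Iinf (𝓝 0) := by
  obtain ⟨c, hc0, hc⟩ := hψ.fourier
  have key : ∀ z : ℂ, z.im = 0 → Tendsto (fun τ => ψ τ z) Iinf (𝓝 (c 0 0)) := by
    intro z hz
    have := lim_four (c := fun p : ℕ × ℤ => c p.1 p.2) (n := fun p => p.1) (t := fun p => (p.2 : ℂ) * z)
      (by simp [hz]) (fun τ hτ => hc τ z hτ) (0, 0) rfl (by
        rintro ⟨n, r⟩ rfl' hne
        have hn : n = 0 := rfl'
        subst hn
        refine hc0 0 r ?_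
        have hr : r ≠ 0 := fun h => hne (by rw [h])
        have : 0 < r ^ 2 := by positivity
        simpa using this)
    simpa [eC_zero] using this
  have h1 : c 0 0 = 0 := by
    refine tendsto_nhds_unique (key 0 (by simp)) ?_
    refine tendsto_const_nhds.congr' ?_
    filter_upwards [eventually_uhp] with τ hτ
    exact (h0 τ hτ).symm
  rw [← h1]
  exact key z hz

lemma xyz_solve {τ : ℂ} (hτ : UHP τ) {ψ : ℂ → ℂ} {a b c : ℂ}
    (h : ∀ z, ψ z = a * tX τ z + b * tY τ z + c * tZ τ z) :
    a = (((ψ 0 + ψ (1 / 2)) / 2 + ψ (1 / 4)) / tI 0 τ 0 + ((ψ 0 + ψ (1 / 2)) / 2 - ψ (1 / 4)) / tI 2 τ 0) / 4 ∧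
    b = (((ψ 0 + ψ (1 / 2)) / 2 + ψ (1 / 4)) / tI 0 τ 0 - ((ψ 0 + ψ (1 / 2)) / 2 - ψ (1 / 4)) / tI 2 τ 0) / 4 ∧
    c = (ψ 0 - ψ (1 / 2)) / (2 * tZ τ 0) := by
  have e0 := h 0
  have e1 := h (1 / 2)
  have e2 := h (1 / 4)
  rw [tX_12, tY_12, tZ_12] at e1
  rw [tX_14, tY_14, tZ_14] at e2
  have hs := x_y_sub hτ
  have hp := x_y_add hτ
  have n0 := t0_ne hτ
  have n2 := t2_ne hτ
  have nz := z_ne hτ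
  have f1 : ((ψ 0 + ψ (1 / 2)) / 2 + ψ (1 / 4)) / tI 0 τ 0 = 2 * (a + b) := by
    rw [div_eq_iff n0]
    linear_combination (e0 + e1) / 2 + e2 + (a + b) * hp
  have f2 : ((ψ 0 + ψ (1 / 2)) / 2 - ψ (1 / 4)) / tI 2 τ 0 = 2 * (a - b) := by
    rw [div_eq_iff n2]
    linear_combination (e0 + e1) / 2 - e2 + (a - b) * hs
  have f3 : (ψ 0 - ψ (1 / 2)) / (2 * tZ τ 0) = c := by
    rw [div_eq_iff (by simp [nz])]
    linear_combination e0 - e1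
  rw [f1, f2, f3]
  refine ⟨by ring, by ring, rfl⟩

lemma xyz_uniq {τ : ℂ} (hτ : UHP τ) {a b c a' b' c' : ℂ}
    (h : ∀ z, a * tX τ z + b * tY τ z + c * tZ τ z = a' * tX τ z + b' * tY τ z + c' * tZ τ z) :
    a = a' ∧ b = b' ∧ c = c' := by
  obtain ⟨h1, h2, h3⟩ := xyz_solve hτ (ψ := fun z => a * tX τ z + b * tY τ z + c * tZ τ z) (fun z => rfl)
  obtain ⟨g1, g2, g3⟩ := xyz_solve hτ (ψ := fun z => a * tX τ z + b * tY τ z + c * tZ τ z) h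
  exact ⟨h1.trans g1.symm, h2.trans g2.symm, h3.trans g3.symm⟩

lemma crossS {s t A B A' B' p q : ℂ} (hs : s ≠ 0) (hp : p ≠ 0) (hq : q ≠ 0) (h1 : s * A' = t * B)
    (h2 : s * B' = t * A) : -s ^ 2 * ((A' / (s * p) - B' / (s * q)) / 3) = t * ((A / q - B / p) / 3) := by
  field_simp
  linear_combination -q * h1 + p * h2

lemma crossR {x y z A B C X Y Z : ℂ} (hx : x ≠ 0) (hy : y ≠ 0) (hz : z ≠ 0)
    (h : A * x + B * y + C * z = 0) :
    (B / z - C / y) / 3 * (Y * z - Z * y) + (C / x - A / z) / 3 * (Z * x - X * z) +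
      (A / y - B / x) / 3 * (X * y - Y * x) = A * X + B * Y + C * Z := by
  have h1 : A * x / x = A := by field_simp
  have e : (B / z - C / y) / 3 * (Y * z - Z * y) + (C / x - A / z) / 3 * (Z * x - X * z) +
      (A / y - B / x) / 3 * (X * y - Y * x) - (A * X + B * Y + C * Z) =
      -(A * x + B * y + C * z) * (X / x + Y / y + Z / z) / 3 := by
    field_simp
    ring
  rw [h] at e
  simp at e
  exact sub_eq_zero.1 e

lemma partB1 (k : ℕ) (hk4 : k % 4 = 2) (ψ : ℂ → ℂ → ℂ) (hψ : IsJF k 2 ψ)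
    (h0 : ∀ τ : ℂ, UHP τ → ψ τ 0 = 0) :
    ∃ φ : ℂ → ℂ → ℂ → ℂ, IsHJF k 2 φ ∧ ∀ τ z : ℂ, UHP τ → φ τ z z = ψ τ z := by
  set P : ℂ → ℂ := fun τ => (ψ τ 0 + ψ τ (1 / 2)) / 2 + ψ τ (1 / 4) with hP
  set M : ℂ → ℂ := fun τ => (ψ τ 0 + ψ τ (1 / 2)) / 2 - ψ τ (1 / 4) with hM
  set R : ℂ → ℂ := fun τ => ψ τ 0 - ψ τ (1 / 2) with hR
  set Gx : ℂ → ℂ := fun τ => (P τ / tI 0 τ 0 + M τ / tI 2 τ 0) / 4 with hGx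
  set Gy : ℂ → ℂ := fun τ => (P τ / tI 0 τ 0 - M τ / tI 2 τ 0) / 4 with hGy
  set Gz : ℂ → ℂ := fun τ => R τ / (2 * tZ τ 0) with hGz
  have rep : ∀ τ, UHP τ → ∀ z, ψ τ z = Gx τ * tX τ z + Gy τ * tY τ z + Gz τ * tZ τ z := by
    intro τ hτ
    obtain ⟨a, b, c, h⟩ := jf_xyz hk4 hψ hτ
    obtain ⟨h1, h2, h3⟩ := xyz_solve hτ h
    have e1 : a = Gx τ := h1
    have e2 : b = Gy τ := h2
    have e3 : c = Gz τ := h3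
    rw [← e1, ← e2, ← e3]
    exact h
  -- differentiability
  have xd := fun {τ : ℂ} (hτ : UHP τ) => thT_diff cX_bd 0 0 hτ
  have yd := fun {τ : ℂ} (hτ : UHP τ) => thT_diff cY_bd 0 0 hτ
  have zd := fun {τ : ℂ} (hτ : UHP τ) => thT_diff cZ_bd 0 0 hτ
  have d0 := fun {τ : ℂ} (hτ : UHP τ) => thT_diff (cI_bd 0) 0 0 hτ
  have d2 := fun {τ : ℂ} (hτ : UHP τ) => thT_diff (cI_bd 2) 0 0 hτ
  have Pd : ∀ {τ}, UHP τ → DifferentiableAt ℂ P τ := fun hτ =>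
    (((jf_diff hψ hτ 0).add (jf_diff hψ hτ (1 / 2))).div_const 2).add (jf_diff hψ hτ (1 / 4))
  have Md : ∀ {τ}, UHP τ → DifferentiableAt ℂ M τ := fun hτ =>
    (((jf_diff hψ hτ 0).add (jf_diff hψ hτ (1 / 2))).div_const 2).sub (jf_diff hψ hτ (1 / 4))
  have Rd : ∀ {τ}, UHP τ → DifferentiableAt ℂ R τ := fun hτ =>
    (jf_diff hψ hτ 0).sub (jf_diff hψ hτ (1 / 2))
  have Gxd : ∀ {τ}, UHP τ → DifferentiableAt ℂ Gx τ := fun hτ =>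
    (((Pd hτ).div (d0 hτ) (t0_ne hτ)).add ((Md hτ).div (d2 hτ) (t2_ne hτ))).div_const 4
  have Gyd : ∀ {τ}, UHP τ → DifferentiableAt ℂ Gy τ := fun hτ =>
    (((Pd hτ).div (d0 hτ) (t0_ne hτ)).sub ((Md hτ).div (d2 hτ) (t2_ne hτ))).div_const 4
  have Gzd : ∀ {τ}, UHP τ → DifferentiableAt ℂ Gz τ := fun hτ =>
    (Rd hτ).div ((zd hτ).const_mul 2) (mul_ne_zero two_ne_zero (z_ne hτ))
  -- decay
  have l0 := jf_lim hψ h0 (z := 0) (by simp)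
  have l2 := jf_lim hψ h0 (z := 1 / 2) (by simp)
  have l4 := jf_lim hψ h0 (z := 1 / 4) (by simp)
  have PO : P =O[Iinf] fun τ => eC (1 * τ) := by
    refine decayO (fun τ hτ => Pd hτ) (fun τ hτ => by simp only [hP, jf_T hψ hτ]) ?_
    have := ((l0.add l2).div_const 2).add l4
    rwa [add_zero, add_zero, zero_div] at this
  have MO : M =O[Iinf] fun τ => eC (1 * τ) := by
    refine decayO (fun τ hτ => Md hτ) (fun τ hτ => by simp only [hM, jf_T hψ hτ]) ?_
    have := ((l0.add l2).div_const 2).sub l4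
    rwa [add_zero, zero_div, sub_zero] at this
  have RO : R =O[Iinf] fun τ => eC (1 * τ) := by
    refine decayO (fun τ hτ => Rd hτ) (fun τ hτ => by simp only [hR, jf_T hψ hτ]) ?_
    have := l0.sub l2
    rwa [sub_zero] at this
  have xl : Tendsto (fun τ => tX τ 0) Iinf (𝓝 1) := by simpa using asymp_X 0
  have yl : Tendsto (fun τ => tY τ 0) Iinf (𝓝 1) := by simpa using asymp_Y 0
  have zl : Tendsto (fun τ => tZ τ 0 * eC (-(1 / 8 * τ))) Iinf (𝓝 2) := by
    have := asymp_Z 0; norm_num at this ⊢; exact this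
  have tl0 : Tendsto (fun τ => tI 0 τ 0) Iinf (𝓝 1) := by
    have := (xl.add yl).div_const 2
    norm_num at this
    refine this.congr' ?_
    filter_upwards [eventually_uhp] with τ hτ
    rw [x_y_add hτ]; ring
  have tl2 : Tendsto (fun τ => tI 2 τ 0 * eC (-(1 / 2 * τ))) Iinf (𝓝 2) := by
    have := asymp_2 0; norm_num at this ⊢; exact this
  -- transformation laws
  have LT : ∀ τ, UHP τ → Gx (τ + 1) = Gy τ ∧ Gy (τ + 1) = Gx τ ∧ eC (1 / 8) * Gz (τ + 1) = Gz τ := by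
    intro τ hτ
    have := xyz_uniq hτ (a := Gy (τ + 1)) (b := Gx (τ + 1)) (c := eC (1 / 8) * Gz (τ + 1))
      (a' := Gx τ) (b' := Gy τ) (c' := Gz τ) (by
        intro z
        rw [← rep τ hτ, ← jf_T hψ hτ, rep _ (uhp_add_one hτ)]
        simp only [tX, tY, tZ, tX_T, tY_T, tZ_T]; ring)
    exact ⟨this.2.1, this.1, this.2.2⟩
  have LS : ∀ τ, UHP τ → rtS τ * Gx (-1 / τ) = τ ^ k * Gx τ ∧ rtS τ * Gy (-1 / τ) = τ ^ k * Gz τ ∧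
      rtS τ * Gz (-1 / τ) = τ ^ k * Gy τ := by
    intro τ hτ
    have := xyz_uniq hτ (a := rtS τ * Gx (-1 / τ)) (b := rtS τ * Gz (-1 / τ)) (c := rtS τ * Gy (-1 / τ))
      (a' := τ ^ k * Gx τ) (b' := τ ^ k * Gy τ) (c' := τ ^ k * Gz τ) (by
        intro z
        have h1 := jf_S hψ hτ z
        rw [rep τ hτ, rep _ (uhp_S hτ), tX_S hτ, tY_S hτ, tZ_S hτ] at h1
        refine mul_left_cancel₀ (eC_ne_zero (2 * z ^ 2 / τ)) ?_
        linear_combination h1)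
    exact ⟨this.1, this.2.2, this.2.1⟩
  have dot : ∀ τ, UHP τ → Gx τ * tX τ 0 + Gy τ * tY τ 0 + Gz τ * tZ τ 0 = 0 := fun τ hτ => by
    rw [← rep τ hτ, h0 τ hτ]
  have hIs : ∀ τ, I * τ = -rtS τ ^ 2 := by intro τ; rw [rtS_sq]; ring
  have PD : PData k (fun τ => (Gy τ / tZ τ 0 - Gz τ / tY τ 0) / 3)
      (fun τ => (Gz τ / tX τ 0 - Gx τ / tZ τ 0) / 3)
      (fun τ => (Gx τ / tY τ 0 - Gy τ / tX τ 0) / 3) (fun _ => 0) := by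
    have c1 := bdd_div 1 (1 / 8) (by norm_num) (by norm_num) (b' := 1 / 8) (by norm_num)
      (D := fun τ => tI 0 τ 0 * tZ τ 0) (L := 1 * 2) (by norm_num) PO
      ((tl0.mul zl).congr fun τ => by ring)
    have c2 := bdd_div 1 (5 / 8) (by norm_num) (by norm_num) (b' := 5 / 8) (by norm_num)
      (D := fun τ => tI 2 τ 0 * tZ τ 0) (L := 2 * 2) (by norm_num) MO
      ((tl2.mul zl).congr fun τ => by
        have : eC (-(5 / 8 * τ)) = eC (-(1 / 2 * τ)) * eC (-(1 / 8 * τ)) := by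
          rw [← eC_add]; ring_nf
        rw [this]; ring)
    have c3 := bdd_div 1 0 (by norm_num) (by norm_num) (b' := 0) (by norm_num)
      (D := fun τ => tI 0 τ 0) (L := 1) (by norm_num) PO
      (tl0.congr fun τ => by simp [eC_zero])
    have c4 := bdd_div 1 (1 / 2) (by norm_num) (by norm_num) (b' := 1 / 2) (by norm_num)
      (D := fun τ => tI 2 τ 0) (L := 2) (by norm_num) MO tl2
    have c5 := bdd_div 1 (1 / 8) (by norm_num) (by norm_num) (b' := 1 / 8) (by norm_num)
      (D := fun τ => 2 * tZ τ 0) (L := 2 * 2) (by norm_num) RO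
      ((zl.const_mul 2).congr fun τ => by ring)
    have xi := (xl.inv₀ one_ne_zero).isBigO_one ℂ
    have yi := (yl.inv₀ one_ne_zero).isBigO_one ℂ
    have bGyz : (fun τ => Gy τ / tZ τ 0) =O[Iinf] (fun _ => (1 : ℂ)) := by
      refine ((c1.sub c2).const_mul_left (1 / 4)).congr_left fun τ => ?_
      simp only [hGy, div_eq_mul_inv, mul_inv]; ring
    have bGxz : (fun τ => Gx τ / tZ τ 0) =O[Iinf] (fun _ => (1 : ℂ)) := by
      refine ((c1.add c2).const_mul_left (1 / 4)).congr_left fun τ => ?_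
      simp only [hGx, div_eq_mul_inv, mul_inv]; ring
    have bGx : Gx =O[Iinf] (fun _ => (1 : ℂ)) := by
      refine ((c3.add c4).const_mul_left (1 / 4)).congr_left fun τ => ?_
      simp only [hGx]; ring
    have bGy : Gy =O[Iinf] (fun _ => (1 : ℂ)) := by
      refine ((c3.sub c4).const_mul_left (1 / 4)).congr_left fun τ => ?_
      simp only [hGy]; ring
    have o1 : ∀ {f g : ℂ → ℂ}, f =O[Iinf] (fun _ => (1 : ℂ)) → (fun τ => (g τ)⁻¹) =O[Iinf] (fun _ => (1 : ℂ)) →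
        (fun τ => f τ / g τ) =O[Iinf] (fun _ => (1 : ℂ)) := by
      intro f g hf hg
      have := hf.mul hg
      simpa [div_eq_mul_inv] using this
    have o3 : ∀ {f g : ℂ → ℂ}, f =O[Iinf] (fun _ => (1 : ℂ)) → g =O[Iinf] (fun _ => (1 : ℂ)) →
        (fun τ => (f τ - g τ) / 3) =O[Iinf] (fun _ => (1 : ℂ)) := by
      intro f g hf hg
      refine ((hf.sub hg).const_mul_left (1 / 3)).congr_left fun τ => by ring
    constructor
    · exact fun τ hτ => (((Gyd hτ).div (zd hτ) (z_ne hτ)).sub ((Gzd hτ).div (yd hτ) (y_ne hτ))).div_const 3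
    · exact fun τ hτ => (((Gzd hτ).div (xd hτ) (x_ne hτ)).sub ((Gxd hτ).div (zd hτ) (z_ne hτ))).div_const 3
    · exact fun τ hτ => (((Gxd hτ).div (yd hτ) (y_ne hτ)).sub ((Gyd hτ).div (xd hτ) (x_ne hτ))).div_const 3
    · exact fun τ hτ => differentiableAt_const _
    · intro τ hτ
      obtain ⟨a1, a2, a3⟩ := LT τ hτ
      have n1 := x_ne hτ
      have n2 := z_ne hτ
      have n3 := eC_ne_zero (1 / 8)
      rw [← a3]
      simp only [a1, a2, tX, tY, tZ, tX_T, tY_T, tZ_T]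
      simp only [tX, tZ] at n1 n2
      field_simp
      ring
    · intro τ hτ
      obtain ⟨a1, a2, a3⟩ := LT τ hτ
      have n1 := y_ne hτ
      have n2 := z_ne hτ
      have n3 := eC_ne_zero (1 / 8)
      rw [← a3]
      simp only [a1, a2, tX, tY, tZ, tX_T, tY_T, tZ_T]
      simp only [tY, tZ] at n1 n2
      field_simp
      ring
    · intro τ hτ
      obtain ⟨a1, a2, a3⟩ := LT τ hτ
      simp only [a1, a2, tX, tY, tZ, tX_T, tY_T, tZ_T]
      ring
    · intro τ hτ; simp
    · intro τ hτ
      obtain ⟨a1, a2, a3⟩ := LS τ hτ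
      rw [tY_S0 hτ, tZ_S0 hτ, hIs]
      exact crossS (rtS_ne_zero hτ) (y_ne hτ) (z_ne hτ) a2 a3
    · intro τ hτ
      obtain ⟨a1, a2, a3⟩ := LS τ hτ
      rw [tX_S0 hτ, tZ_S0 hτ, hIs]
      exact crossS (rtS_ne_zero hτ) (x_ne hτ) (y_ne hτ) a3 a1
    · intro τ hτ
      obtain ⟨a1, a2, a3⟩ := LS τ hτ
      rw [tX_S0 hτ, tY_S0 hτ, hIs]
      exact crossS (rtS_ne_zero hτ) (z_ne hτ) (x_ne hτ) a1 a2
    · intro τ hτ; simp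
    · exact o3 bGyz (o1 c5 yi)
    · exact o3 (o1 c5 xi) bGxz
    · exact o3 (o1 bGx yi) (o1 bGy xi)
    · exact isBigO_zero _ _
  refine ⟨_, mkHJF hk4 PD, fun τ z hτ => ?_⟩
  rw [rep τ hτ, PhiZ, PhiUV]
  have hd := dot τ hτ
  have ez : (z + z) / 2 = z := by ring
  simp only [sub_self, mul_zero, zero_div, ez, zero_mul, add_zero]
  exact crossR (x_ne hτ) (y_ne hτ) (z_ne hτ) hd

lemma partB2 (k : ℕ) (hk4 : k % 4 = 2) (φ : ℂ → ℂ → ℂ → ℂ) (hφ : IsHJF k 2 φ) {τ : ℂ} (hτ : UHP τ) :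
    φ τ 0 0 = 0 := by
  have h := hφ.transf I (by simp) 1 τ 0 0 hτ
  obtain ⟨n, rfl⟩ : ∃ n, k = 4 * n + 2 := ⟨k / 4, by omega⟩
  have e : I ^ (4 * n + 2) = -1 := by rw [pow_add, pow_mul, I_pow_four]; simp
  simp [Ma, Mb, Mc, Md, eC_zero, e] at h
  exact self_eq_neg.1 h
end


/-! ### the kernel of the restriction map -/

section
open Filter Topology Asymptotics

lemma ker_coef {τ : ℂ} (hτ : UHP τ) {c : ℕ → ℕ → ℂ} {F : ℂ → ℂ → ℂ}
    (hF : ∀ u v, F u v = ∑ a ∈ Finset.range 4, ∑ b ∈ Finset.range 4, c a b * (tI a τ u * tI b τ v))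
    (hrot : ∀ u v, F v (-u) = -F u v) :
    ∀ b ∈ Finset.range 4, c b 0 + c 0 b = 0 ∧ c b 3 + c 1 b = 0 ∧ c b 2 + c 2 b = 0 ∧ c b 1 + c 3 b = 0 := by
  have i0 : ∀ z, tI (-0) τ z = tI 0 τ z := fun z => by simp
  have i1 : ∀ z, tI (-1) τ z = tI 3 τ z := fun z => thT_congr (fun A => by simp [cI]) 0 τ z
  have i2 : ∀ z, tI (-2) τ z = tI 2 τ z := fun z => thT_congr (fun A => by simp [cI]) 0 τ z
  have i3 : ∀ z, tI (-3) τ z = tI 1 τ z := fun z => thT_congr (fun A => by simp [cI]) 0 τ z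
  have key : ∀ v u, ∑ j ∈ Finset.range 4,
      (∑ b ∈ Finset.range 4, (c b ((4 - j) % 4) + c j b) * tI b τ v) * tI j τ u = 0 := by
    intro v u
    have h := hrot u v
    rw [hF, hF] at h
    simp only [tI_neg] at h
    simp only [Finset.sum_range_succ, Finset.sum_range_zero] at h ⊢
    push_cast at h ⊢
    simp only [i0, i1, i2, i3] at h
    norm_num
    linear_combination h
  have k2 : ∀ v, _ := fun v => tI_li hτ (key v)
  have k3 : ∀ j ∈ Finset.range 4, ∀ v, ∑ b ∈ Finset.range 4, (c b ((4 - j) % 4) + c j b) * tI b τ v = 0 := by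
    intro j hj v
    obtain ⟨h0, h1, h2, h3⟩ := k2 v
    rw [Finset.mem_range] at hj
    interval_cases j
    exacts [h0, h1, h2, h3]
  have k4 : ∀ j ∈ Finset.range 4, ∀ b ∈ Finset.range 4, c b ((4 - j) % 4) + c j b = 0 := by
    intro j hj b hb
    obtain ⟨h0, h1, h2, h3⟩ := tI_li hτ (k3 j hj)
    rw [Finset.mem_range] at hb
    interval_cases b
    exacts [h0, h1, h2, h3]
  intro b hb
  exact ⟨k4 0 (by simp) b hb, k4 1 (by simp) b hb, k4 2 (by simp) b hb, k4 3 (by simp) b hb⟩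

lemma ker_rep {τ : ℂ} (hτ : UHP τ) {c : ℕ → ℕ → ℂ} {F : ℂ → ℂ → ℂ}
    (hF : ∀ u v, F u v = ∑ a ∈ Finset.range 4, ∑ b ∈ Finset.range 4, c a b * (tI a τ u * tI b τ v))
    (hrot : ∀ u v, F v (-u) = -F u v) (h0 : ∀ u, F u 0 = 0) :
    ∃ g, ∀ u v, F u v = c 1 1 * (tO τ u * tO τ v) + g * DD τ u v := by
  have hc := ker_coef hτ hF hrot
  obtain ⟨a00, a03, a02, a01⟩ := hc 0 (by simp)
  obtain ⟨a10, a13, a12, a11⟩ := hc 1 (by simp)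
  obtain ⟨a20, a23, a22, a21⟩ := hc 2 (by simp)
  obtain ⟨a30, a33, a32, a31⟩ := hc 3 (by simp)
  clear hc
  have e00 : c 0 0 = 0 := by linear_combination a00 / 2
  have e22 : c 2 2 = 0 := by linear_combination a22 / 2
  have e10 : c 1 0 = -c 0 1 := by linear_combination a10
  have e03 : c 0 3 = c 0 1 := by linear_combination a03 - a10
  have e30 : c 3 0 = -c 0 1 := by linear_combination a01
  have e20 : c 2 0 = -c 0 2 := by linear_combination a02
  have e21 : c 2 1 = -c 1 2 := by linear_combination a12
  have e23 : c 2 3 = -c 1 2 := by linear_combination a23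
  have e32 : c 3 2 = c 1 2 := by linear_combination a32 - a23
  have e13 : c 1 3 = -c 1 1 := by linear_combination a13
  have e31 : c 3 1 = -c 1 1 := by linear_combination a11
  have e33 : c 3 3 = c 1 1 := by linear_combination a33 - a13
  have k1 := tI_li hτ (c := fun a => ∑ b ∈ Finset.range 4, c a b * tI b τ 0) (by
    intro u
    refine Eq.trans ?_ (h0 u)
    rw [hF]
    refine Finset.sum_congr rfl fun a _ => ?_
    rw [Finset.sum_mul]
    refine Finset.sum_congr rfl fun b _ => ?_
    ring)
  obtain ⟨b0, b1, b2, -⟩ := k1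
  have t3 := tI_13 τ
  simp only [Finset.sum_range_succ, Finset.sum_range_zero] at b0 b1 b2
  push_cast at b0 b1 b2
  rw [e00, e03, t3] at b0
  rw [e10, e13, t3] at b1
  rw [e20, e21, e22, e23, t3] at b2
  have n0 := t0_ne hτ
  have hz := t1_eq hτ
  have hs := x_y_sub hτ
  have hp := x_y_add hτ
  obtain ⟨g, hg⟩ : ∃ g, c 1 2 = g * (2 * tI 0 τ 0) := ⟨c 1 2 / (2 * tI 0 τ 0), by field_simp⟩
  have h01 : c 0 1 = g * (2 * tI 2 τ 0) := by
    refine mul_right_cancel₀ n0 ?_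
    linear_combination -b1 + tI 2 τ 0 * hg
  have h02 : c 0 2 = -(g * (2 * tZ τ 0)) := by
    refine mul_right_cancel₀ n0 ?_
    linear_combination -b2 - 2 * tI 1 τ 0 * hg + 2 * g * tI 0 τ 0 * hz
  have hx : tX τ 0 = tI 0 τ 0 + tI 2 τ 0 := by linear_combination (hs + hp) / 2
  have hy : tY τ 0 = tI 0 τ 0 - tI 2 τ 0 := by linear_combination (hp - hs) / 2
  refine ⟨g, fun u v => ?_⟩
  rw [hF, DD, hx, hy]
  simp only [Finset.sum_range_succ, Finset.sum_range_zero]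
  push_cast
  rw [e00, e22, e10, e03, e30, e20, e21, e23, e32, e13, e31, e33, hg, h01, h02]
  generalize tZ τ 0 = ζ
  simp only [tX, tY, tZ, tO, thX_I 0 hτ, thY_I 0 hτ, thZ_I 0 hτ, thO_I 0 hτ, tI]
  ring

lemma DD_44 (τ : ℂ) : DD τ (1 / 4) (1 / 4) = 0 := by rw [DD]; ring

lemma DD_42 {τ : ℂ} (hτ : UHP τ) : DD τ (1 / 4) (1 / 2) = -8 * (tZ τ 0 * (tI 0 τ 0 * tI 2 τ 0)) := by
  rw [DD, tX_14, tY_14, tZ_14, tX_12, tY_12, tZ_12]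
  have hs := x_y_sub hτ
  have hp := x_y_add hτ
  linear_combination -2 * tZ τ 0 * (tX τ 0 + tY τ 0) * hs - 4 * tZ τ 0 * tI 2 τ 0 * hp

lemma hjf_T {k : ℕ} {φ : ℂ → ℂ → ℂ → ℂ} (hφ : IsHJF k 2 φ) {τ : ℂ} (hτ : UHP τ) (z₁ z₂ : ℂ) :
    φ (τ + 1) z₁ z₂ = φ τ z₁ z₂ := by
  have h := hφ.transf 1 (by simp) ModularGroup.T τ z₁ z₂ hτ
  simpa [Ma, Mb, Mc, Md, ModularGroup.T, eC_zero] using h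

lemma hjf_S {k : ℕ} {φ : ℂ → ℂ → ℂ → ℂ} (hφ : IsHJF k 2 φ) {τ : ℂ} (hτ : UHP τ) (z₁ z₂ : ℂ) :
    φ (-1 / τ) (z₁ / τ) (z₂ / τ) = τ ^ k * eC (2 * z₁ * z₂ / τ) * φ τ z₁ z₂ := by
  have h := hφ.transf 1 (by simp) ModularGroup.S τ z₁ z₂ hτ
  simpa [Ma, Mb, Mc, Md, ModularGroup.S, eC_zero] using h

lemma hjf_diff {k : ℕ} {φ : ℂ → ℂ → ℂ → ℂ} (hφ : IsHJF k 2 φ) {τ : ℂ} (hτ : UHP τ) (z₁ z₂ : ℂ) :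
    DifferentiableAt ℂ (fun τ => φ τ z₁ z₂) τ := by
  have ho : IsOpen {p : ℂ × ℂ × ℂ | UHP p.1} := isOpen_UHP.preimage continuous_fst
  have h1 := hφ.holo.differentiableAt (x := (τ, z₁, z₂)) (ho.mem_nhds hτ)
  have h2 : DifferentiableAt ℂ (fun t : ℂ => (t, z₁, z₂)) τ :=
    differentiableAt_id.prodMk (differentiableAt_const (z₁, z₂))
  exact DifferentiableAt.comp (g := fun p : ℂ × ℂ × ℂ => φ p.1 p.2.1 p.2.2) τ h1 h2

/-- the form in the coordinates `u, v` -/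
def FUV (φ : ℂ → ℂ → ℂ → ℂ) (τ u v : ℂ) : ℂ := φ τ (u - I * v) (u + I * v)

lemma FUV_eq (φ : ℂ → ℂ → ℂ → ℂ) (τ z₁ z₂ : ℂ) :
    φ τ z₁ z₂ = FUV φ τ ((z₁ + z₂) / 2) (I * (z₁ - z₂) / 2) := by
  rw [FUV]
  congr 1
  · linear_combination (z₁ - z₂) / 2 * I_sq
  · linear_combination -(z₁ - z₂) / 2 * I_sq

lemma hjf_lim {k : ℕ} (hk4 : k % 4 = 2) {φ : ℂ → ℂ → ℂ → ℂ} (hφ : IsHJF k 2 φ) {u v : ℂ}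
    (hu : u.im = 0) (hv : v.im = 0) : Tendsto (fun τ => FUV φ τ u v) Iinf (𝓝 0) := by
  obtain ⟨c, hc0, hc⟩ := hφ.fourier
  have key : ∀ u v : ℂ, u.im = 0 → v.im = 0 → Tendsto (fun τ => FUV φ τ u v) Iinf (𝓝 (c 0 0 0)) := by
    intro u v hu hv
    have := lim_four (c := fun p : ℕ × ℤ × ℤ => c p.1 p.2.1 p.2.2) (n := fun p => p.1)
      (t := fun p => (p.2.1 : ℂ) * u + (p.2.2 : ℂ) * v)
      (by simp [hu, hv]) (F := fun τ => FUV φ τ u v) (fun τ hτ => (hc τ (u - I * v) (u + I * v) hτ).congr_fun (by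
        intro p
        congr 2
        linear_combination (p.2.2 : ℂ) * v * I_sq)) (0, 0, 0) rfl (by
        rintro ⟨n, a, b⟩ hn' hne
        have hn : n = 0 := hn'
        subst hn
        refine hc0 0 a b ?_
        have hr : a ≠ 0 ∨ b ≠ 0 := by
          by_contra hcon
          push Not at hcon
          exact hne (by rw [hcon.1, hcon.2])
        have : 0 < a ^ 2 + b ^ 2 := by
          rcases hr with hr | hr
          · have : 0 < a ^ 2 := by positivity
            nlinarith [sq_nonneg b]
          · have : 0 < b ^ 2 := by positivity
            nlinarith [sq_nonneg a]
        simpa using this)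
    simpa [eC_zero] using this
  have h1 : c 0 0 0 = 0 := by
    refine tendsto_nhds_unique (key 0 0 (by simp) (by simp)) ?_
    refine tendsto_const_nhds.congr' ?_
    filter_upwards [eventually_uhp] with τ hτ
    rw [FUV]
    simpa using (partB2 k hk4 φ hφ hτ).symm
  rw [← h1]
  exact key u v hu hv
end


section
open Filter Topology Asymptotics

/-- the second coordinate of a form in the kernel -/
def GG (φ : ℂ → ℂ → ℂ → ℂ) (τ : ℂ) : ℂ :=
  FUV φ τ (1 / 4) (1 / 2) / (-8 * (tZ τ 0 * (tI 0 τ 0 * tI 2 τ 0)))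

lemma den_ne {τ : ℂ} (hτ : UHP τ) : -8 * (tZ τ 0 * (tI 0 τ 0 * tI 2 τ 0)) ≠ 0 :=
  mul_ne_zero (by norm_num) (mul_ne_zero (z_ne hτ) (mul_ne_zero (t0_ne hτ) (t2_ne hτ)))

variable {k : ℕ} {φ : ℂ → ℂ → ℂ → ℂ} {h : ℤ → ℤ → ℂ → ℂ}

lemma ker_eq (hk4 : k % 4 = 2) (hφ : IsHJF k 2 φ) (hh : HasThetaDecomp 2 φ h)
    (h0 : ∀ τ z : ℂ, UHP τ → φ τ z z = 0) {τ : ℂ} (hτ : UHP τ) (u v : ℂ) :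
    FUV φ τ u v = h 1 1 τ * (tO τ u * tO τ v) + GG φ τ * DD τ u v := by
  obtain ⟨g, hg⟩ := ker_rep hτ (c := fun a b => h a b τ) (F := FUV φ τ) (by
      intro u v
      rw [FUV, hh.2 τ _ _ hτ]
      refine Finset.sum_congr rfl fun a _ => Finset.sum_congr rfl fun b _ => ?_
      rw [thetaH_eq _ _ hτ]
      congr 3
      · ring
      · linear_combination -v * I_sq) (by
      intro u v
      have e := hφ.transf I (by simp) 1 τ (u - I * v) (u + I * v) hτ
      obtain ⟨n, rfl⟩ : ∃ n, k = 4 * n + 2 := ⟨k / 4, by omega⟩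
      have e' : I ^ (4 * n + 2) = -1 := by rw [pow_add, pow_mul, I_pow_four]; simp
      simp [Ma, Mb, Mc, Md, eC_zero, e'] at e
      rw [FUV, FUV, ← e]
      congr 1
      · linear_combination v * I_sq
      · linear_combination v * I_sq) (by
      intro u
      rw [FUV]
      simpa using h0 τ u hτ)
  have e1 := hg (1 / 4) (1 / 2)
  rw [tO_12, DD_42 hτ, mul_zero, mul_zero, zero_add] at e1
  have e2 : GG φ τ = g := by
    rw [GG, e1, mul_div_cancel_right₀ _ (den_ne hτ)]
  rw [e2]
  have := hg u v
  push_cast at this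
  exact this

lemma ker_H (hk4 : k % 4 = 2) (hφ : IsHJF k 2 φ) (hh : HasThetaDecomp 2 φ h)
    (h0 : ∀ τ z : ℂ, UHP τ → φ τ z z = 0) {τ : ℂ} (hτ : UHP τ) :
    h 1 1 τ = FUV φ τ (1 / 4) (1 / 4) / -(tZ τ 0 ^ 2) := by
  have e := ker_eq hk4 hφ hh h0 hτ (1 / 4) (1 / 4)
  rw [DD_44, tO_14, mul_zero, add_zero] at e
  rw [eq_div_iff (neg_ne_zero.2 (pow_ne_zero 2 (z_ne hτ))), e]
  linear_combination -h 1 1 τ * tZ τ 0 ^ 2 * I_sq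

lemma ker_lawT (hk4 : k % 4 = 2) (hφ : IsHJF k 2 φ) (hh : HasThetaDecomp 2 φ h)
    (h0 : ∀ τ z : ℂ, UHP τ → φ τ z z = 0) {τ : ℂ} (hτ : UHP τ) :
    h 1 1 (τ + 1) = -I * h 1 1 τ ∧ -eC (1 / 8) * GG φ (τ + 1) = GG φ τ := by
  have key : ∀ u v, I * h 1 1 (τ + 1) * (tO τ u * tO τ v) + -eC (1 / 8) * GG φ (τ + 1) * DD τ u v =
      h 1 1 τ * (tO τ u * tO τ v) + GG φ τ * DD τ u v := by
    intro u v
    rw [← ker_eq hk4 hφ hh h0 hτ]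
    have e : FUV φ (τ + 1) u v = FUV φ τ u v := hjf_T hφ hτ _ _
    rw [← e, ker_eq hk4 hφ hh h0 (uhp_add_one hτ), DD_T]
    simp only [tO, tO_T]
    linear_combination -h 1 1 (τ + 1) * thT cO 0 τ u * thT cO 0 τ v * eC_sq8
  have k1 := key (1 / 4) (1 / 4)
  have k2 := key (1 / 4) (1 / 2)
  rw [DD_44, tO_14, mul_zero, mul_zero, add_zero, add_zero] at k1
  rw [tO_12, mul_zero, mul_zero, mul_zero, zero_add, zero_add, DD_42 hτ] at k2
  have n1 : I * tZ τ 0 * (I * tZ τ 0) ≠ 0 := by simp [I_ne_zero, z_ne hτ]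
  have k1' := mul_right_cancel₀ n1 k1
  refine ⟨?_, mul_right_cancel₀ (den_ne hτ) k2⟩
  linear_combination -I * k1' + h 1 1 (τ + 1) * I_sq

lemma ker_lawS (hk4 : k % 4 = 2) (hφ : IsHJF k 2 φ) (hh : HasThetaDecomp 2 φ h)
    (h0 : ∀ τ z : ℂ, UHP τ → φ τ z z = 0) {τ : ℂ} (hτ : UHP τ) :
    I * τ * h 1 1 (-1 / τ) = τ ^ k * h 1 1 τ ∧ -rtS τ ^ 3 * GG φ (-1 / τ) = τ ^ k * GG φ τ := by
  have hIs : I * τ = -rtS τ ^ 2 := by rw [rtS_sq]; ring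
  have key : ∀ u v, I * τ * h 1 1 (-1 / τ) * (tO τ u * tO τ v) + -rtS τ ^ 3 * GG φ (-1 / τ) * DD τ u v =
      τ ^ k * h 1 1 τ * (tO τ u * tO τ v) + τ ^ k * GG φ τ * DD τ u v := by
    intro u v
    have e := hjf_S hφ hτ (u - I * v) (u + I * v)
    have e1 : φ (-1 / τ) ((u - I * v) / τ) ((u + I * v) / τ) = FUV φ (-1 / τ) (u / τ) (v / τ) := by
      rw [FUV]; congr 1 <;> ring
    have e2 : eC (2 * (u - I * v) * (u + I * v) / τ) = eC (2 * u ^ 2 / τ) * eC (2 * v ^ 2 / τ) := by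
      rw [← eC_add]; congr 1
      linear_combination (-2 * v ^ 2 / τ) * I_sq
    have e3 : eC (2 * (u ^ 2 + v ^ 2) / τ) = eC (2 * u ^ 2 / τ) * eC (2 * v ^ 2 / τ) := by
      rw [← eC_add]; ring_nf
    have e4 : φ τ (u - I * v) (u + I * v) = FUV φ τ u v := rfl
    rw [e1, e2, e4, ker_eq hk4 hφ hh h0 hτ, ker_eq hk4 hφ hh h0 (uhp_S hτ), DD_S hτ, e3, tO_S hτ, tO_S hτ] at e
    rw [hIs]
    refine mul_left_cancel₀ (mul_ne_zero (eC_ne_zero (2 * u ^ 2 / τ)) (eC_ne_zero (2 * v ^ 2 / τ))) ?_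
    linear_combination e - h 1 1 (-1 / τ) * rtS τ ^ 2 * eC (2 * u ^ 2 / τ) * eC (2 * v ^ 2 / τ) *
      (tO τ u * tO τ v) * I_sq
  have k1 := key (1 / 4) (1 / 4)
  have k2 := key (1 / 4) (1 / 2)
  rw [DD_44, tO_14, mul_zero, mul_zero, add_zero, add_zero] at k1
  rw [tO_12, mul_zero, mul_zero, mul_zero, zero_add, zero_add, DD_42 hτ] at k2
  have n1 : I * tZ τ 0 * (I * tZ τ 0) ≠ 0 := by simp [I_ne_zero, z_ne hτ]
  exact ⟨mul_right_cancel₀ n1 k1, mul_right_cancel₀ (den_ne hτ) k2⟩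

lemma ker_chi (hk4 : k % 4 = 2) (hφ : IsHJF k 2 φ) (hh : HasThetaDecomp 2 φ h)
    (h0 : ∀ τ z : ℂ, UHP τ → φ τ z z = 0) {τ : ℂ} (hτ : UHP τ) :
    chiHJF (psiOf φ h) 6 0 τ = kap * GG φ τ * WW τ := by
  refine chi_eq hτ _ fun z => ?_
  rw [psiOf, OO_eq hτ, FUV_eq φ, ker_eq hk4 hφ hh h0 hτ]
  ring

lemma FO (hk4 : k % 4 = 2) (hφ : IsHJF k 2 φ) {u v : ℂ} (hu : u.im = 0) (hv : v.im = 0) :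
    (fun τ => FUV φ τ u v) =O[Iinf] fun τ => eC (1 * τ) :=
  decayO (fun τ hτ => hjf_diff hφ hτ _ _) (fun τ hτ => hjf_T hφ hτ _ _) (hjf_lim hk4 hφ hu hv)

lemma lim_of {f : ℂ → ℂ} {a : ℂ} (b : ℝ) (hb : 0 < b) (ha : a = b) {L : ℂ}
    (hf : Tendsto (fun τ => f τ * eC (-(a * τ))) Iinf (𝓝 L)) : Tendsto f Iinf (𝓝 0) := by
  subst ha
  have h2 := eC_tendsto_zero hb
  have h3 := hf.mul h2
  rw [mul_zero] at h3
  refine h3.congr fun τ => ?_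
  rw [mul_assoc, ← eC_add]; simp [eC_zero]

lemma partC1 (hk4 : k % 4 = 2) (hφ : IsHJF k 2 φ) (hh : HasThetaDecomp 2 φ h)
    (h0 : ∀ τ z : ℂ, UHP τ → φ τ z z = 0) : IsCF (k + 2) (fun τ => xiC τ * h 1 1 τ) where
  holo := by
    have zd := fun {τ : ℂ} (hτ : UHP τ) => thT_diff cZ_bd 0 0 hτ
    have hd : DifferentiableOn ℂ (fun τ => xiC τ * (FUV φ τ (1 / 4) (1 / 4) / -(tZ τ 0 ^ 2))) {τ | UHP τ} := by
      intro τ hτ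
      have n : -(tZ τ 0 ^ 2) ≠ 0 := neg_ne_zero.2 (pow_ne_zero 2 (z_ne hτ))
      exact ((xi_diff hτ).mul ((hjf_diff hφ hτ _ _).div ((zd hτ).pow 2).neg n)).differentiableWithinAt
    refine hd.congr fun τ hτ => ?_
    rw [ker_H hk4 hφ hh h0 hτ]
  transf := by
    refine mf_transf (k := k + 2) (f := fun τ => xiC τ * h 1 1 τ) ?_ ?_
    · intro τ hτ
      simp only [xi_T hτ, (ker_lawT hk4 hφ hh h0 hτ).1]
      linear_combination -xiC τ * h 1 1 τ * I_sq
    · intro τ hτ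
      have e := (ker_lawS hk4 hφ hh h0 hτ).1
      simp only [xi_S hτ]
      rw [pow_add]
      linear_combination τ ^ 2 * xiC τ * e
  decay := by
    rw [← tendsto_zero_Iinf]
    have zl : Tendsto (fun τ => tZ τ 0 * eC (-(1 / 8 * τ))) Iinf (𝓝 2) := by
      have := asymp_Z 0; norm_num at this ⊢; exact this
    have b := bdd_div 1 (1 / 4) (by norm_num) (by norm_num) (b' := 1 / 4) (by norm_num)
      (D := fun τ => -(tZ τ 0 ^ 2)) (L := -(2 ^ 2)) (by norm_num)
      (FO hk4 hφ (u := 1 / 4) (v := 1 / 4) (by simp) (by simp))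
      ((zl.pow 2).neg.congr fun τ => by
        have : eC (-(1 / 4 * τ)) = eC (-(1 / 8 * τ)) * eC (-(1 / 8 * τ)) := by
          rw [← eC_add]; ring_nf
        rw [this]; ring)
    have l := lim_of (1 / 4) (by norm_num) (by norm_num) xi_lim
    have l2 := ((isLittleO_one_iff ℂ).2 l).mul_isBigO b
    simp only [mul_one] at l2
    refine ((isLittleO_one_iff ℂ).1 l2).congr' ?_
    filter_upwards [eventually_uhp] with τ hτ
    rw [ker_H hk4 hφ hh h0 hτ]

lemma partC2 (hk4 : k % 4 = 2) (hφ : IsHJF k 2 φ) (hh : HasThetaDecomp 2 φ h)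
    (h0 : ∀ τ z : ℂ, UHP τ → φ τ z z = 0) : IsCF (k + 6) (fun τ => chiHJF (psiOf φ h) 6 0 τ) where
  holo := by
    have zd := fun {τ : ℂ} (hτ : UHP τ) => thT_diff cZ_bd 0 0 hτ
    have d0 := fun {τ : ℂ} (hτ : UHP τ) => thT_diff (cI_bd 0) 0 0 hτ
    have d2 := fun {τ : ℂ} (hτ : UHP τ) => thT_diff (cI_bd 2) 0 0 hτ
    have hd : DifferentiableOn ℂ (fun τ => kap * GG φ τ * WW τ) {τ | UHP τ} := by
      intro τ hτ
      have e : DifferentiableAt ℂ (GG φ) τ :=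
        (hjf_diff hφ hτ _ _).div (((zd hτ).mul ((d0 hτ).mul (d2 hτ))).const_mul (-8)) (den_ne hτ)
      exact ((e.const_mul kap).mul (WW_diff hτ)).differentiableWithinAt
    exact hd.congr fun τ hτ => ker_chi hk4 hφ hh h0 hτ
  transf := by
    refine mf_transf (k := k + 6) (f := fun τ => chiHJF (psiOf φ h) 6 0 τ) ?_ ?_
    · intro τ hτ
      rw [ker_chi hk4 hφ hh h0 hτ, ker_chi hk4 hφ hh h0 (uhp_add_one hτ), WW_T]
      linear_combination kap * WW τ * (ker_lawT hk4 hφ hh h0 hτ).2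
    · intro τ hτ
      rw [ker_chi hk4 hφ hh h0 hτ, ker_chi hk4 hφ hh h0 (uhp_S hτ), WW_S hτ, pow_add]
      linear_combination kap * τ ^ 6 * WW τ * (ker_lawS hk4 hφ hh h0 hτ).2
  decay := by
    rw [← tendsto_zero_Iinf]
    have zl : Tendsto (fun τ => tZ τ 0 * eC (-(1 / 8 * τ))) Iinf (𝓝 2) := by
      have := asymp_Z 0; norm_num at this ⊢; exact this
    have xl : Tendsto (fun τ => tX τ 0) Iinf (𝓝 1) := by simpa using asymp_X 0
    have yl : Tendsto (fun τ => tY τ 0) Iinf (𝓝 1) := by simpa using asymp_Y 0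
    have tl0 : Tendsto (fun τ => tI 0 τ 0) Iinf (𝓝 1) := by
      have := (xl.add yl).div_const 2
      norm_num at this
      refine this.congr' ?_
      filter_upwards [eventually_uhp] with τ hτ
      rw [x_y_add hτ]; ring
    have tl2 : Tendsto (fun τ => tI 2 τ 0 * eC (-(1 / 2 * τ))) Iinf (𝓝 2) := by
      have := asymp_2 0; norm_num at this ⊢; exact this
    have b := bdd_div 1 (5 / 8) (by norm_num) (by norm_num) (b' := 5 / 8) (by norm_num)
      (D := fun τ => -8 * (tZ τ 0 * (tI 0 τ 0 * tI 2 τ 0))) (L := -8 * (2 * (1 * 2))) (by norm_num)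
      (FO hk4 hφ (u := 1 / 4) (v := 1 / 2) (by simp) (by simp))
      (((zl.mul (tl0.mul tl2)).const_mul (-8)).congr fun τ => by
        have : eC (-(5 / 8 * τ)) = eC (-(1 / 2 * τ)) * eC (-(1 / 8 * τ)) := by
          rw [← eC_add]; ring_nf
        rw [this]; ring)
    have l := lim_of (5 / 8) (by norm_num) (by norm_num) WW_lim
    have l2 := ((isLittleO_one_iff ℂ).2 (l.const_mul kap |>.trans (by rw [mul_zero]))).mul_isBigO b
    simp only [mul_one] at l2
    refine ((isLittleO_one_iff ℂ).1 l2).congr' ?_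
    filter_upwards [eventually_uhp] with τ hτ
    rw [ker_chi hk4 hφ hh h0 hτ, GG]
    ring

lemma partD (hk4 : k % 4 = 2) {φ' : ℂ → ℂ → ℂ → ℂ} {h' : ℤ → ℤ → ℂ → ℂ} (hφ : IsHJF k 2 φ)
    (hφ' : IsHJF k 2 φ') (hh : HasThetaDecomp 2 φ h) (hh' : HasThetaDecomp 2 φ' h')
    (h0 : ∀ τ z : ℂ, UHP τ → φ τ z z = 0) (h0' : ∀ τ z : ℂ, UHP τ → φ' τ z z = 0) 
    (e1 : ∀ τ : ℂ, UHP τ → xiC τ * h 1 1 τ = xiC τ * h' 1 1 τ)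
    (e2 : ∀ τ : ℂ, UHP τ → chiHJF (psiOf φ h) 6 0 τ = chiHJF (psiOf φ' h') 6 0 τ)
    (τ z₁ z₂ : ℂ) (hτ : UHP τ) : φ τ z₁ z₂ = φ' τ z₁ z₂ := by
  have f1 := mul_left_cancel₀ (xi_ne hτ) (e1 τ hτ)
  have f2 := e2 τ hτ
  rw [ker_chi hk4 hφ hh h0 hτ, ker_chi hk4 hφ' hh' h0' hτ] at f2
  have f3 := mul_left_cancel₀ kap_ne (mul_right_cancel₀ (WW_ne hτ) f2)
  rw [FUV_eq φ, FUV_eq φ', ker_eq hk4 hφ hh h0 hτ, ker_eq hk4 hφ' hh' h0' hτ, f1, f3]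
end

/-- for `k ≡ 2 (mod 4)` there is an exact sequence
`0 → S_{k+2} × S_{k+6} → J_{k,2}(O_K) →(π₁) J_{k,2} →(D₀) M_k → 0`, where
`ker π₁ ≅ S_{k+2} × S_{k+6}` via `φ ↦ (ξ h_{1,1}, χ_{6,0}(ψ))`. -/
theorem stmt13 (k : ℕ) (hk : 0 < k) (hk4 : k % 4 = 2) :
    (∀ f : ℂ → ℂ, IsMF k f →
      ∃ ψ : ℂ → ℂ → ℂ, IsJF k 2 ψ ∧ ∀ τ : ℂ, UHP τ → ψ τ 0 = f τ) ∧
    (∀ ψ : ℂ → ℂ → ℂ, IsJF k 2 ψ →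
      ((∀ τ : ℂ, UHP τ → ψ τ 0 = 0) ↔
        ∃ φ : ℂ → ℂ → ℂ → ℂ, IsHJF k 2 φ ∧ ∀ τ z : ℂ, UHP τ → φ τ z z = ψ τ z)) ∧
    (∀ (φ : ℂ → ℂ → ℂ → ℂ) (h : ℤ → ℤ → ℂ → ℂ),
      IsHJF k 2 φ → HasThetaDecomp 2 φ h → (∀ τ z : ℂ, UHP τ → φ τ z z = 0) →
      IsCF (k + 2) (fun τ => xiC τ * h 1 1 τ) ∧
      IsCF (k + 6) (fun τ => chiHJF (psiOf φ h) 6 0 τ)) ∧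
    (∀ (φ φ' : ℂ → ℂ → ℂ → ℂ) (h h' : ℤ → ℤ → ℂ → ℂ),
      IsHJF k 2 φ → IsHJF k 2 φ' → HasThetaDecomp 2 φ h → HasThetaDecomp 2 φ' h' →
      (∀ τ z : ℂ, UHP τ → φ τ z z = 0) → (∀ τ z : ℂ, UHP τ → φ' τ z z = 0) →
      (∀ τ : ℂ, UHP τ → xiC τ * h 1 1 τ = xiC τ * h' 1 1 τ) →
      (∀ τ : ℂ, UHP τ → chiHJF (psiOf φ h) 6 0 τ = chiHJF (psiOf φ' h') 6 0 τ) →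
      ∀ τ z₁ z₂ : ℂ, UHP τ → φ τ z₁ z₂ = φ' τ z₁ z₂) ∧
    (∀ f₁ f₂ : ℂ → ℂ, IsCF (k + 2) f₁ → IsCF (k + 6) f₂ →
      ∃ (φ : ℂ → ℂ → ℂ → ℂ) (h : ℤ → ℤ → ℂ → ℂ),
        IsHJF k 2 φ ∧ HasThetaDecomp 2 φ h ∧ (∀ τ z : ℂ, UHP τ → φ τ z z = 0) ∧
        (∀ τ : ℂ, UHP τ → xiC τ * h 1 1 τ = f₁ τ) ∧
        (∀ τ : ℂ, UHP τ → chiHJF (psiOf φ h) 6 0 τ = f₂ τ)) := by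
  refine ⟨fun f hf => partA k hk4 f hf, fun ψ hψ => ⟨fun h0 => partB1 k hk4 ψ hψ h0, ?_⟩, ?_, ?_,
    fun f₁ f₂ h₁ h₂ => partE k hk4 f₁ f₂ h₁ h₂⟩
  · rintro ⟨φ, hφ, h⟩ τ hτ
    rw [← h τ 0 hτ]
    exact partB2 k hk4 φ hφ hτ
  · intro φ h hφ hh h0
    exact ⟨partC1 hk4 hφ hh h0, partC2 hk4 hφ hh h0⟩
  · intro φ φ' h h' hφ hφ' hh hh' h0 h0' e1 e2 τ z₁ z₂ hτ
    exact partD hk4 hφ hφ' hh hh' h0 h0' e1 e2 τ z₁ z₂ hτ
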